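/- arXiv:2011.04581 — 2 statements merged into one kernel-verified Lean document; each statement's English description precedes it below -/
import Mathlib

section
/- For each K ∈ ℕ, a DCPS has an infinite progressive K-context switch bounded run if and only if it has a shallow infinite progressive K-context switch bounded run. -/
/-!
Formalization of context-bounded liveness for dynamic networks of concurrent
pushdown systems (DCPS) and VASS with balloons (VASSB).
Global states, stack symbols, places, balloon states etc. are drawn from ℕ;
the finite components of the systems are recorded as `Finset`s.
-/

noncomputable section

namespace CBL

/-! ### Dynamic networks of concurrent pushdown systems (DCPS) -/

/-- A local configuration of a thread: its stack content (top of stack is the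
head of the list) together with its context-switch number. -/
abbrev Loc : Type := List ℕ × ℕ

/-- A DCPS `(G, Γ, Δ, g0, γ0)`.  The transition rules `Δ` are split into the
four kinds.  A creation rule `g|γ ↪ g'|w' (▷ γ')` is recorded as
`(g, γ, g', w', none/some γ')`; an interruption rule `g|γ ↦ g'|w'` as
`(g, γ, g', w')`; a resumption rule `g ↦ g' ◁ γ` as `(g, g', γ)`; a
termination rule `g ↦ g'` as `(g, g')`. -/
structure DCPS where
  glob : Finset ℕ
  alph : Finset ℕ
  creation : Finset (ℕ × ℕ × ℕ × List ℕ × Option ℕ)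
  interruption : Finset (ℕ × ℕ × ℕ × List ℕ)
  resumption : Finset (ℕ × ℕ × ℕ)
  termination : Finset (ℕ × ℕ)
  g0 : ℕ
  gamma0 : ℕ
  creation_wf : ∀ r ∈ creation, r.2.2.2.1.length ≤ 2
  interruption_wf : ∀ r ∈ interruption, 1 ≤ r.2.2.2.length ∧ r.2.2.2.length ≤ 2

/-- A configuration `⟨g, t, m⟩` of a DCPS: global state, active slot
(`none` denotes the schedule point `#`), and the multiset of local
configurations of the inactive threads. -/
structure DConfig where
  g : ℕ
  act : Option Loc
  pend : Multiset Loc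

/-- The initial configuration `⟨g0, #, {(γ0, 0)}⟩`. -/
def DCPS.init (A : DCPS) : DConfig :=
  ⟨A.g0, none, {([A.gamma0], 0)}⟩

/-- The multiset of freshly spawned threads of a creation rule. -/
def spawnOf : Option ℕ → Multiset Loc
  | none => 0
  | some gam => {([gam], 0)}

/-- A thread step: a creation rule rewrites the global state and the top of
stack of the active thread, possibly spawning a new thread. -/
def ThreadStep (A : DCPS) (c c' : DConfig) : Prop :=
  ∃ (gam : ℕ) (w : List ℕ) (i : ℕ) (g' : ℕ) (w' : List ℕ) (sp : Option ℕ),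
    (c.g, gam, g', w', sp) ∈ A.creation ∧
    c.act = some (gam :: w, i) ∧ c'.g = g' ∧ c'.act = some (w' ++ w, i) ∧
    c'.pend = c.pend + spawnOf sp

/-- The scheduler step `Swap`. -/
def SwapStep (A : DCPS) (c c' : DConfig) : Prop :=
  ∃ (gam : ℕ) (w : List ℕ) (i : ℕ) (g' : ℕ) (w' : List ℕ),
    (c.g, gam, g', w') ∈ A.interruption ∧
    c.act = some (gam :: w, i) ∧ c'.g = g' ∧ c'.act = none ∧
    c'.pend = c.pend + {(w' ++ w, i + 1)}

/-- The scheduler step `Resume`, resuming (an instance of) the local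
configuration `t`. -/
def ResumeStep (A : DCPS) (t : Loc) (c c' : DConfig) : Prop :=
  ∃ (gam : ℕ) (w : List ℕ) (i : ℕ) (g' : ℕ) (p0 : Multiset Loc),
    (c.g, g', gam) ∈ A.resumption ∧ t = (gam :: w, i) ∧
    c.act = none ∧ c.pend = p0 + {t} ∧
    c'.g = g' ∧ c'.act = some t ∧ c'.pend = p0

/-- The scheduler step `Term`, removing the active thread when its stack is
empty. -/
def TermStep (A : DCPS) (c c' : DConfig) : Prop :=
  ∃ (i : ℕ) (g' : ℕ),
    (c.g, g') ∈ A.termination ∧ c.act = some ([], i) ∧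
    c'.g = g' ∧ c'.act = none ∧ c'.pend = c.pend

/-- Any single step of the DCPS. -/
def DStep (A : DCPS) (c c' : DConfig) : Prop :=
  ThreadStep A c c' ∨ SwapStep A c c' ∨ (∃ t, ResumeStep A t c c') ∨ TermStep A c c'

/-- An infinite run of a DCPS: it starts in the initial configuration, takes a
step at each moment, performs at least one thread step between consecutive
scheduler steps (every scheduled thread executes a nonempty sequence of thread
steps), and alternates thread executions with scheduler steps forever (there
are infinitely many scheduler steps, witnessed by schedule points `#`). -/
def IsInfRunD (A : DCPS) (rho : ℕ → DConfig) : Prop :=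
  rho 0 = A.init ∧ (∀ i, DStep A (rho i) (rho (i + 1))) ∧
  (∀ i, (rho i).act = none → (rho (i + 2)).act ≠ none) ∧
  (∀ i, ∃ j ≥ i, (rho j).act = none)

/-- A finite run of length `n` of a DCPS (the first `n` steps of `rho`). -/
def IsFinRunD (A : DCPS) (rho : ℕ → DConfig) (n : ℕ) : Prop :=
  rho 0 = A.init ∧ (∀ i < n, DStep A (rho i) (rho (i + 1))) ∧
  (∀ i, i + 2 ≤ n → (rho i).act = none → (rho (i + 2)).act ≠ none)

/-- A run is `K`-context switch bounded if in every configuration the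
context-switch number of the active thread is at most `K`. -/
def KBoundedD (K : ℕ) (rho : ℕ → DConfig) : Prop :=
  ∀ i w j, (rho i).act = some (w, j) → j ≤ K

/-- `K`-context switch boundedness for the first `n + 1` configurations. -/
def KBoundedUpToD (K n : ℕ) (rho : ℕ → DConfig) : Prop :=
  ∀ i ≤ n, ∀ w j, (rho i).act = some (w, j) → j ≤ K

/-- The thread `t = (γw, i)` is ready at configuration `c = ⟨g, #, m⟩`. -/
def ReadyAt (A : DCPS) (t : Loc) (c : DConfig) : Prop :=
  c.act = none ∧ t ∈ c.pend ∧
  ∃ (gam : ℕ) (w : List ℕ) (g' : ℕ), t.1 = gam :: w ∧ (c.g, g', gam) ∈ A.resumption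

/-- The thread `t` is resumed (made active) at moment `k` of the run `rho`. -/
def ResumedAt (A : DCPS) (rho : ℕ → DConfig) (k : ℕ) (t : Loc) : Prop :=
  ResumeStep A t (rho k) (rho (k + 1))

/-- Fairness: no thread is ready at infinitely many configurations while being
resumed only finitely often. -/
def FairD (A : DCPS) (rho : ℕ → DConfig) : Prop :=
  ∀ t : Loc, (∀ N, ∃ k ≥ N, ReadyAt A t (rho k)) → (∀ N, ∃ k ≥ N, ResumedAt A rho k t)

/-- Progressiveness for a context-switch bound `K`:  the rule `Term` is only
ever applied to an active thread with exactly `K` context switches (from an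
active thread with empty stack only `Term` steps are possible, so this is
expressed by requiring that an active thread with an empty stack has
context-switch number `K`), and every local configuration of an inactive
thread is resumed at some later point of the run. -/
def ProgressiveD (A : DCPS) (K : ℕ) (rho : ℕ → DConfig) : Prop :=
  (∀ k i, (rho k).act = some ([], i) → i = K) ∧
  (∀ k, ∀ t ∈ (rho k).pend, ∃ j ≥ k, ResumedAt A rho j t)

/-- All threads (active and inactive) of a configuration. -/
def allThreads (c : DConfig) : Multiset Loc :=
  c.pend + (match c.act with | none => 0 | some t => {t})

/-- The thread `t = (w, i)` is starved in the run `rho`: from some moment `j`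
on, at least one thread with local configuration `t` is always present, and
whenever `t` is resumed there are at least two of them. -/
def StarvesD (A : DCPS) (rho : ℕ → DConfig) (t : Loc) : Prop :=
  ∃ j, (∀ k ≥ j, 1 ≤ (allThreads (rho k)).count t) ∧
       (∀ k ≥ j, ResumedAt A rho k t → 2 ≤ (allThreads (rho k)).count t)

/-- Step `k` of the run is a thread step spawning a new thread. -/
def SpawnAt (rho : ℕ → DConfig) (k : ℕ) : Prop :=
  (rho k).act ≠ none ∧ (rho (k + 1)).act ≠ none ∧
  ∃ gam : ℕ, (rho (k + 1)).pend = (rho k).pend + {([gam], 0)}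

/-- A run is shallow if there is a bound `B ∈ ℕ` on the number of threads
spawned by each thread along the run, i.e. on the number of spawns performed
during any contiguous interval of the run in which a single thread stays
active. -/
def ShallowD (rho : ℕ → DConfig) : Prop :=
  ∃ B, ∀ a b : ℕ, (∀ k, a ≤ k → k ≤ b → (rho k).act ≠ none) →
    Set.ncard {k | a ≤ k ∧ k < b ∧ SpawnAt rho k} ≤ B

/-- The number of pending threads of a configuration: the size of the multiset
of inactive threads, plus one if there is an active thread. -/
def pendCount (c : DConfig) : ℕ :=
  Multiset.card c.pend + (match c.act with | none => 0 | some _ => 1)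

/-! ### Well-quasi-orders -/

/-- In a well-quasi-order, every sequence paired with a sequence of finite range has a subsequence
along which the latter is constant and the former is monotone. -/
theorem exists_subseq_const_monotone {β X : Type*} [Preorder X] [WellQuasiOrderedLE X]
    (f : ℕ → β) (hf : (Set.range f).Finite) (h : ℕ → X) :
    ∃ φ : ℕ → ℕ, StrictMono φ ∧ ∀ i j, i ≤ j → f (φ i) = f (φ j) ∧ h (φ i) ≤ h (φ j) := by
  have : Finite (Set.range f) := hf
  have h1 : WellQuasiOrdered (fun a b : Set.range f => a = b) := Finite.wellQuasiOrdered _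
  have h2 := h1.prod (wellQuasiOrdered_le (α := X))
  have : IsPreorder (Set.range f × X)
      (fun a b : Set.range f × X => a.1 = b.1 ∧ a.2 ≤ b.2) :=
    { refl := fun a => ⟨rfl, le_rfl⟩
      trans := fun a b c hab hbc => ⟨hab.1.trans hbc.1, hab.2.trans hbc.2⟩ }
  obtain ⟨g, hg⟩ := h2.exists_monotone_subseq (fun n => (⟨f n, n, rfl⟩, h n))
  exact ⟨g, g.strictMono, fun i j hij => ⟨congrArg Subtype.val (hg i j hij).1, (hg i j hij).2⟩⟩

theorem wellFounded_lowerSet {α : Type*} [Preorder α] [WellQuasiOrderedLE α] :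
    WellFounded (fun a b : LowerSet α => a < b) := by
  rw [RelEmbedding.wellFounded_iff_isEmpty]
  refine ⟨fun f => ?_⟩
  have hlt : ∀ m n, m < n → f n < f m := fun m n hmn => f.map_rel_iff.2 hmn
  have hx : ∀ n, ∃ x, x ∈ f n ∧ x ∉ f (n + 1) := fun n =>
    Set.exists_of_ssubset (hlt n (n + 1) n.lt_succ_self)
  choose x hx1 hx2 using hx
  obtain ⟨i, j, hij, hle⟩ := wellQuasiOrdered_le x
  apply hx2 i
  have : f j ≤ f (i + 1) := by
    rcases (Nat.succ_le_of_lt hij).eq_or_lt with h | h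
    · rw [← h]
    · exact (hlt _ _ h).le
  exact (f (i + 1)).lower hle (this (hx1 j))

/-- Every well-quasi-ordered set is a finite union of directed sets. -/
theorem exists_finite_directedOn_cover (α : Type*) [Preorder α] [WellQuasiOrderedLE α] :
    ∃ F : Set (Set α), F.Finite ∧ (∀ D ∈ F, DirectedOn (· ≤ ·) D) ∧ ∀ a, ∃ D ∈ F, a ∈ D := by
  suffices H : ∀ L : LowerSet α, ∃ F : Set (Set α), F.Finite ∧ (∀ D ∈ F, DirectedOn (· ≤ ·) D) ∧
      ∀ a ∈ L, ∃ D ∈ F, a ∈ D by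
    obtain ⟨F, h1, h2, h3⟩ := H ⊤
    exact ⟨F, h1, h2, fun a => h3 a trivial⟩
  intro L
  refine wellFounded_lowerSet.induction (C := fun L : LowerSet α => ∃ F : Set (Set α), F.Finite ∧
      (∀ D ∈ F, DirectedOn (· ≤ ·) D) ∧ ∀ a ∈ L, ∃ D ∈ F, a ∈ D) L ?_
  intro L ih
  by_cases hL : DirectedOn (· ≤ ·) (L : Set α)
  · exact ⟨{(L : Set α)}, by simp, by simpa using hL, fun a ha => ⟨L, rfl, ha⟩⟩
  · simp only [DirectedOn, not_forall, not_exists, not_and] at hL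
    obtain ⟨x, hx, y, hy, hxy⟩ := hL
    have aux : ∀ z ∈ L, ∃ F : Set (Set α), F.Finite ∧ (∀ D ∈ F, DirectedOn (· ≤ ·) D) ∧
        ∀ a ∈ L, ¬ z ≤ a → ∃ D ∈ F, a ∈ D := by
      intro z hz
      let L' : LowerSet α := ⟨{a | a ∈ L ∧ ¬ z ≤ a}, fun a b hba ha =>
        ⟨L.lower hba ha.1, fun h => ha.2 (h.trans hba)⟩⟩
      have hlt : L' < L := by
        refine lt_of_le_of_ne (fun a ha => ha.1) fun h => ?_
        have : z ∈ L' := h ▸ hz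
        exact this.2 le_rfl
      obtain ⟨F, h1, h2, h3⟩ := ih L' hlt
      exact ⟨F, h1, h2, fun a ha hza => h3 a ⟨ha, hza⟩⟩
    obtain ⟨F, h1, h2, h3⟩ := aux x hx
    obtain ⟨F', h1', h2', h3'⟩ := aux y hy
    refine ⟨F ∪ F', h1.union h1', fun D hD => hD.elim (h2 D) (h2' D), fun a ha => ?_⟩
    by_cases hxa : x ≤ a
    · obtain ⟨D, hD, haD⟩ := h3' a ha (hxy a ha hxa)
      exact ⟨D, Or.inr hD, haD⟩
    · obtain ⟨D, hD, haD⟩ := h3 a ha hxa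
      exact ⟨D, Or.inl hD, haD⟩

theorem _root_.DirectedOn.exists_forall_le {α : Type*} [Preorder α] {D : Set α}
    (hD : DirectedOn (· ≤ ·) D) (hne : D.Nonempty) (s : Finset α) (hs : ∀ a ∈ s, a ∈ D) :
    ∃ b ∈ D, ∀ a ∈ s, a ≤ b := by
  classical
  induction s using Finset.induction_on with
  | empty => exact ⟨hne.some, hne.some_mem, by simp⟩
  | insert a s _ ih =>
    obtain ⟨b, hb, hsb⟩ := ih fun c hc => hs c (Finset.mem_insert_of_mem hc)
    obtain ⟨c, hc, hac, hbc⟩ := hD a (hs a (Finset.mem_insert_self _ _)) b hb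
    refine ⟨c, hc, fun d hd => ?_⟩
    rcases Finset.mem_insert.1 hd with rfl | hd
    · exact hac
    · exact (hsb d hd).trans hbc

/-- A value of a sequence of finite range that occurs late enough occurs infinitely often. -/
theorem exists_forall_ge_frequently {β : Type*} (f : ℕ → β) (hf : (Set.range f).Finite) :
    ∃ N, ∀ n ≥ N, ∀ M, ∃ m ≥ M, f m = f n := by
  have h : ∀ x : β, ∃ N, (∃ n ≥ N, f n = x) → ∀ M, ∃ m ≥ M, f m = x := by
    intro x
    by_cases hx : ∀ M, ∃ m ≥ M, f m = x
    · exact ⟨0, fun _ => hx⟩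
    · push Not at hx
      obtain ⟨M, hM⟩ := hx
      exact ⟨M, fun ⟨n, hn, h⟩ => absurd h (hM n hn)⟩
  choose N hN using h
  obtain ⟨B, hB⟩ := (hf.image N).bddAbove
  exact ⟨B, fun n hn => hN (f n) ⟨n, (hB ⟨f n, ⟨n, rfl⟩, rfl⟩).trans hn, rfl⟩⟩

/-! ### Segments: the activity of a thread between two schedule points -/

/-- The local configuration of a freshly spawned thread. -/
def newThread (γ : ℕ) : Loc := ([γ], 0)

theorem spawnOf_eq (sp : Option ℕ) :
    spawnOf sp = (sp.toList : Multiset ℕ).map newThread := by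
  cases sp <;> rfl

/-- `TSteps A g w n S g' w'`: a sequence of `n` thread steps leads from global state `g` and stack
`w` to `g'` and `w'`, spawning the symbols `S`. -/
inductive TSteps (A : DCPS) (g : ℕ) (w : List ℕ) : ℕ → Multiset ℕ → ℕ → List ℕ → Prop
  | refl : TSteps A g w 0 0 g w
  | tail {n : ℕ} {S : Multiset ℕ} {g₁ γ : ℕ} {w₁ : List ℕ} {g₂ : ℕ} {w' : List ℕ}
      {sp : Option ℕ} : TSteps A g w n S g₁ (γ :: w₁) → (g₁, γ, g₂, w', sp) ∈ A.creation →
      TSteps A g w (n + 1) (S + (sp.toList : Multiset ℕ)) g₂ (w' ++ w₁)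

/-- A segment: at global state `g` the thread `t` is resumed, takes a nonempty sequence of thread
steps spawning the symbols `S`, and returns control at global state `g'`.  The thread is then swapped
out as `t'` if `r = some t'`, and terminates (at context-switch number `K`) if `r = none`. -/
def Seg (A : DCPS) (K g : ℕ) (t : Loc) (S : Multiset ℕ) (r : Option Loc) (g' : ℕ) : Prop :=
  ∃ (γ : ℕ) (w : List ℕ) (i g₁ g₂ : ℕ) (w₁ : List ℕ) (n : ℕ),
    (g, g₁, γ) ∈ A.resumption ∧ t = (γ :: w, i) ∧ TSteps A g₁ (γ :: w) (n + 1) S g₂ w₁ ∧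
    ((∃ (γ₂ : ℕ) (w₂ w' : List ℕ), w₁ = γ₂ :: w₂ ∧ (g₂, γ₂, g', w') ∈ A.interruption ∧
      r = some (w' ++ w₂, i + 1)) ∨
     (w₁ = [] ∧ i = K ∧ (g₂, g') ∈ A.termination ∧ r = none))

/-- The multiset of inactive threads contributed by the end of a segment. -/
def optM {α : Type*} (r : Option α) : Multiset α := r.elim 0 fun t => {t}

/-- A progressive run, viewed at its schedule points only: segment `n` leads from global state `g n`
and inactive threads `m n` to `g (n + 1)` and `m (n + 1)`. -/
structure MacroRun (A : DCPS) (K : ℕ) (g : ℕ → ℕ) (m : ℕ → Multiset Loc) (t : ℕ → Loc)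
    (S : ℕ → Multiset ℕ) (r : ℕ → Option Loc) : Prop where
  g_zero : g 0 = A.g0
  m_zero : m 0 = {newThread A.gamma0}
  seg : ∀ n, Seg A K (g n) (t n) (S n) (r n) (g (n + 1))
  mem : ∀ n, t n ∈ m n
  step : ∀ n, m (n + 1) + {t n} = m n + (S n).map newThread + optM (r n)
  bound : ∀ n, (t n).2 ≤ K
  prog : ∀ n, ∀ l ∈ m n, ∃ j ≥ n, t j = l

section OfRun

variable {A : DCPS} {K : ℕ} {rho : ℕ → DConfig}

theorem ResumeStep.act_eq {t : Loc} {c c' : DConfig} (h : ResumeStep A t c c') :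
    c.act = none ∧ c'.act = some t := by
  obtain ⟨γ, w, i, g', p0, -, -, h3, -, -, h6, -⟩ := h
  exact ⟨h3, h6⟩

theorem DStep.resume_of_act_none {c c' : DConfig} (h : DStep A c c') (hc : c.act = none) :
    ∃ t, ResumeStep A t c c' := by
  rcases h with h | h | h | h
  · obtain ⟨_, _, _, _, _, _, _, h2, _⟩ := h
    simp [hc] at h2
  · obtain ⟨_, _, _, _, _, _, h2, _⟩ := h
    simp [hc] at h2
  · exact h
  · obtain ⟨_, _, _, h2, _⟩ := h
    simp [hc] at h2

theorem DStep.thread_of_act_ne_none {c c' : DConfig} (h : DStep A c c') (hc : c.act ≠ none)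
    (hc' : c'.act ≠ none) : ThreadStep A c c' := by
  rcases h with h | h | ⟨t, h⟩ | h
  · exact h
  · obtain ⟨_, _, _, _, _, _, _, _, h2, _⟩ := h
    exact absurd h2 hc'
  · exact absurd h.act_eq.1 hc
  · obtain ⟨_, _, _, _, _, h2, _⟩ := h
    exact absurd h2 hc'

theorem exists_tSteps (hstep : ∀ i, DStep A (rho i) (rho (i + 1))) {a : ℕ} {w : List ℕ} {i : ℕ}
    (ha : (rho a).act = some (w, i)) (n : ℕ) (hn : ∀ c, a ≤ c → c ≤ a + n → (rho c).act ≠ none) :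
    ∃ S w', TSteps A (rho a).g w n S (rho (a + n)).g w' ∧ (rho (a + n)).act = some (w', i) ∧
      (rho (a + n)).pend = (rho a).pend + S.map newThread := by
  induction n with
  | zero => exact ⟨0, w, .refl, ha, by simp⟩
  | succ n ih =>
    obtain ⟨S, w', h1, h2, h3⟩ := ih fun c hc hc' => hn c hc (by omega)
    obtain ⟨γ, w₁, i', g', w₂, sp, k1, k2, k3, k4, k5⟩ :=
      (hstep (a + n)).thread_of_act_ne_none (hn _ (by omega) (by omega))
        (hn (a + n + 1) (by omega) (by omega))
    rw [h2] at k2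
    simp only [Option.some.injEq, Prod.mk.injEq] at k2
    obtain ⟨rfl, rfl⟩ := k2
    subst k3
    refine ⟨S + (sp.toList : Multiset ℕ), w₂ ++ w₁, h1.tail k1, k4, ?_⟩
    rw [← add_assoc, k5, h3, spawnOf_eq, Multiset.map_add, add_assoc]

theorem exists_seg (hrun : IsInfRunD A rho) (hprog : ProgressiveD A K rho) {a b : ℕ} (hab : a < b)
    (ha : (rho a).act = none) (hb : (rho b).act = none)
    (hc : ∀ c, a < c → c < b → (rho c).act ≠ none) :
    ∃ t S r, Seg A K (rho a).g t S r (rho b).g ∧ ResumedAt A rho a t ∧ t ∈ (rho a).pend ∧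
      (rho b).pend + {t} = (rho a).pend + S.map newThread + optM r := by
  obtain ⟨-, hstep, hne, -⟩ := hrun
  obtain ⟨t, ht⟩ := (hstep a).resume_of_act_none ha
  have hres := ht
  obtain ⟨γ, w, i, g', p0, h1, h2, -, h4, h5, h6, h7⟩ := ht
  have hb1 : b ≠ a + 1 := by rintro rfl; simp [h6] at hb
  have hb2 : b ≠ a + 2 := by rintro rfl; exact hne a ha hb
  obtain ⟨n, rfl⟩ : ∃ n, b = a + 1 + (n + 1) + 1 := ⟨b - a - 3, by omega⟩
  rw [h2] at h6
  obtain ⟨S, w', k1, k2, k3⟩ := exists_tSteps hstep h6 (n + 1)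
    fun c hc1 hc2 => hc c (by omega) (by omega)
  subst h5
  rcases hstep (a + 1 + (n + 1)) with h | h | ⟨t', h⟩ | h
  · obtain ⟨_, _, _, _, _, _, _, _, _, h', _⟩ := h
    rw [h'] at hb
    simp at hb
  · obtain ⟨γ₂, w₂, i', g₂, w₃, l1, l2, l3, l4, l5⟩ := h
    rw [k2] at l2
    simp only [Option.some.injEq, Prod.mk.injEq] at l2
    obtain ⟨rfl, rfl⟩ := l2
    subst l3
    refine ⟨t, S, some (w₃ ++ w₂, i + 1), ⟨γ, w, i, _, _, _, n, h1, h2, k1,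
      Or.inl ⟨γ₂, w₂, w₃, rfl, l1, rfl⟩⟩, hres, by simp [h4], ?_⟩
    rw [l5, k3, h7, h4]
    simp only [optM, Option.elim]
    abel
  · exact absurd h.act_eq.1 (hc _ (by omega) (by omega))
  · obtain ⟨i', g₂, l1, l2, l3, l4, l5⟩ := h
    rw [k2] at l2
    simp only [Option.some.injEq, Prod.mk.injEq] at l2
    obtain ⟨rfl, rfl⟩ := l2
    subst l3
    refine ⟨t, S, none, ⟨γ, w, i, _, _, _, n, h1, h2, k1,
      Or.inr ⟨rfl, hprog.1 _ _ k2, l1, rfl⟩⟩, hres, by simp [h4], ?_⟩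
    rw [l5, k3, h7, h4]
    simp only [optM, Option.elim]
    abel

/-- Every progressive bounded run induces a macro run. -/
theorem exists_macroRun (hrun : IsInfRunD A rho) (hK : KBoundedD K rho)
    (hprog : ProgressiveD A K rho) : ∃ g m t S r, MacroRun A K g m t S r := by
  have hinf : (Set.ofPred fun k => (rho k).act = none).Infinite := by
    rw [Set.infinite_iff_exists_gt]
    intro N
    obtain ⟨j, hj, h⟩ := hrun.2.2.2 (N + 1)
    exact ⟨j, h, by omega⟩
  set κ := Nat.nth (fun k => (rho k).act = none) with hκ
  have hmono : StrictMono κ := Nat.nth_strictMono hinf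
  have hnone : ∀ n, (rho (κ n)).act = none := Nat.nth_mem_of_infinite hinf
  have hsurj : ∀ k, (rho k).act = none → ∃ n, κ n = k := fun k hk =>
    (Set.ext_iff.1 (Nat.range_nth_of_infinite hinf) k).2 hk
  have hzero : κ 0 = 0 := Nat.nth_zero_of_zero (by rw [hrun.1]; rfl)
  have hbetween : ∀ n c, κ n < c → c < κ (n + 1) → (rho c).act ≠ none := by
    intro n c h1 h2 h
    obtain ⟨j, rfl⟩ := hsurj c h
    have := hmono.lt_iff_lt.1 h1
    have := hmono.lt_iff_lt.1 h2
    omega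
  choose t S r hseg hres hmem hpend using fun n =>
    exists_seg hrun hprog (hmono n.lt_succ_self) (hnone n) (hnone (n + 1)) (hbetween n)
  refine ⟨fun n => (rho (κ n)).g, fun n => (rho (κ n)).pend, t, S, r, ?_, ?_, hseg, hmem, hpend,
    ?_, ?_⟩
  · simp only [hzero, hrun.1]; rfl
  · simp only [hzero, hrun.1]; rfl
  · intro n
    exact hK _ _ _ (hres n).act_eq.2
  · intro n l hl
    obtain ⟨k, hk, hkl⟩ := hprog.2 (κ n) l hl
    obtain ⟨j, rfl⟩ := hsurj k hkl.act_eq.1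
    refine ⟨j, hmono.le_iff_le.1 hk, ?_⟩
    have := (hres j).act_eq.2
    rw [hkl.act_eq.2] at this
    simpa using this.symm

end OfRun

/-! ### From macro runs to runs -/

theorem TSteps.exists_path {A : DCPS} {g : ℕ} {w : List ℕ} {n : ℕ} {S : Multiset ℕ} {g' : ℕ}
    {w' : List ℕ} (h : TSteps A g w n S g' w') (i : ℕ) (m : Multiset Loc) :
    ∃ conf : ℕ → DConfig, conf 0 = ⟨g, some (w, i), m⟩ ∧
      conf n = ⟨g', some (w', i), m + S.map newThread⟩ ∧
      (∀ j < n, ThreadStep A (conf j) (conf (j + 1))) ∧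
      ∀ j ≤ n, ∃ w₁ S₁, (conf j).act = some (w₁, i) ∧ (j < n → w₁ ≠ []) ∧
        (conf j).pend = m + S₁.map newThread ∧ S₁ ≤ S := by
  induction h with
  | refl => exact ⟨fun _ => ⟨g, some (w, i), m⟩, rfl, by simp, by simp,
      fun j _ => ⟨w, 0, rfl, by omega, by simp, le_rfl⟩⟩
  | @tail n S g₁ γ w₁ g₂ w₂ sp h hr ih =>
    obtain ⟨conf, h0, hn, hs, hp⟩ := ih
    refine ⟨fun j => if j ≤ n then conf j else
      ⟨g₂, some (w₂ ++ w₁, i), m + (S + (sp.toList : Multiset ℕ)).map newThread⟩,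
      by simpa using h0, by simp, fun j hj => ?_, fun j hj => ?_⟩
    · rcases (Nat.lt_succ_iff.1 hj).eq_or_lt with rfl | hj
      · simp only [le_refl, if_true, Nat.not_succ_le_self, if_false, hn]
        refine ⟨γ, w₁, i, g₂, w₂, sp, hr, rfl, rfl, rfl, ?_⟩
        simp only [spawnOf_eq, Multiset.map_add, add_assoc]
      · simpa only [hj.le, Nat.succ_le_of_lt hj, if_true] using hs j hj
    · by_cases hjn : j ≤ n
      · simp only [hjn, if_true]
        obtain ⟨w₃, S₃, k1, k2, k3, k4⟩ := hp j hjn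
        refine ⟨w₃, S₃, k1, fun _ => ?_, k3, k4.trans (Multiset.le_add_right _ _)⟩
        rcases hjn.eq_or_lt with rfl | hj'
        · rw [hn] at k1
          simp only [Option.some.injEq, Prod.mk.injEq, and_true] at k1
          simp [← k1]
        · exact k2 hj'
      · simp only [hjn, if_false]
        exact ⟨_, _, rfl, by omega, rfl, le_rfl⟩

theorem Seg.exists_path {A : DCPS} {K g : ℕ} {t : Loc} {S : Multiset ℕ} {r : Option Loc} {g' : ℕ}
    (h : Seg A K g t S r g') {m m' : Multiset Loc} (ht : t ∈ m)
    (hm : m' + {t} = m + S.map newThread + optM r) :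
    ∃ (len : ℕ) (conf : ℕ → DConfig) (m₀ : Multiset Loc), 3 ≤ len ∧
      conf 0 = ⟨g, none, m⟩ ∧ conf len = ⟨g', none, m'⟩ ∧
      (∀ j < len, DStep A (conf j) (conf (j + 1))) ∧ ResumeStep A t (conf 0) (conf 1) ∧
      (∀ j, 0 < j → j < len → ∃ w₁ S₁, (conf j).act = some (w₁, t.2) ∧ (w₁ = [] → t.2 = K) ∧
        (conf j).pend = m₀ + S₁.map newThread ∧ S₁ ≤ S) ∧ m₀ + S.map newThread ≤ m' := by
  obtain ⟨γ, w, i, g₁, g₂, w₁, n, h1, rfl, h3, h4⟩ := h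
  obtain ⟨m₀, rfl⟩ := Multiset.exists_cons_of_mem ht
  have hm' : m' = m₀ + S.map newThread + optM r := by
    rw [← Multiset.singleton_add] at hm
    apply add_right_cancel (b := ({(γ :: w, i)} : Multiset Loc))
    rw [hm]; abel
  obtain ⟨conf, c0, cn, cs, cp⟩ := h3.exists_path i m₀
  have hres : ResumeStep A (γ :: w, i) ⟨g, none, (γ :: w, i) ::ₘ m₀⟩ (conf 0) := by
    refine ⟨γ, w, i, g₁, m₀, h1, rfl, rfl, ?_, ?_, ?_, ?_⟩
    · rw [← Multiset.singleton_add, add_comm]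
    all_goals rw [c0]
  have hlast : DStep A (conf (n + 1)) ⟨g', none, m'⟩ := by
    rw [cn]
    rcases h4 with ⟨γ₂, w₂, w', rfl, k1, rfl⟩ | ⟨rfl, rfl, k1, rfl⟩
    · exact Or.inr (Or.inl ⟨γ₂, w₂, i, g', w', k1, rfl, rfl, rfl, hm'⟩)
    · exact Or.inr (Or.inr (Or.inr ⟨i, g', k1, rfl, rfl, rfl, by simpa [optM] using hm'⟩))
  refine ⟨n + 3, fun j => if j = 0 then ⟨g, none, (γ :: w, i) ::ₘ m₀⟩ else
    if j ≤ n + 2 then conf (j - 1) else ⟨g', none, m'⟩, m₀, by omega, by simp, by simp,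
    fun j hj => ?_, by simpa using hres, fun j hj hj' => ?_, by simp [hm']⟩
  · rcases j.eq_zero_or_pos with rfl | hj0
    · have : DStep A _ _ := Or.inr (Or.inr (Or.inl ⟨_, hres⟩))
      simpa using this
    · rcases (Nat.lt_succ_iff.1 hj).eq_or_lt with rfl | hj
      · simpa using hlast
      · obtain ⟨j, rfl⟩ : ∃ k, j = k + 1 := ⟨j - 1, by omega⟩
        have e1 : j + 1 ≤ n + 2 := by omega
        have e2 : j + 1 + 1 ≤ n + 2 := by omega
        simp only [Nat.succ_ne_zero, if_false, e1, e2, if_true, Nat.add_sub_cancel]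
        exact Or.inl (cs j (by omega))
  · obtain ⟨j, rfl⟩ : ∃ k, j = k + 1 := ⟨j - 1, by omega⟩
    have e1 : j + 1 ≤ n + 2 := by omega
    simp only [Nat.succ_ne_zero, if_false, e1, if_true, Nat.add_sub_cancel]
    obtain ⟨w₃, S₃, k1, k2, k3, k4⟩ := cp j (by omega)
    refine ⟨w₃, S₃, k1, fun hw => ?_, k3, k4⟩
    rcases (show j ≤ n + 1 by omega).eq_or_lt with rfl | hj
    · rw [cn] at k1
      simp only [Option.some.injEq, Prod.mk.injEq, and_true] at k1
      subst k1
      rcases h4 with ⟨γ₂, w₂, w', h, -⟩ | ⟨-, h, -⟩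
      · simp [hw] at h
      · exact h
    · exact absurd hw (k2 hj)

/-- Concatenation of an infinite sequence of nonempty finite paths. -/
theorem exists_concat {X : Type*} (len : ℕ → ℕ) (hlen : ∀ n, 0 < len n) (conf : ℕ → ℕ → X)
    (hconf : ∀ n, conf n (len n) = conf (n + 1) 0) :
    ∃ (rho : ℕ → X) (T : ℕ → ℕ), T 0 = 0 ∧ (∀ n, T (n + 1) = T n + len n) ∧
      (∀ n, ∀ j ≤ len n, rho (T n + j) = conf n j) ∧
      ∀ k, ∃ n j, k = T n + j ∧ j < len n := by
  let T : ℕ → ℕ := fun n => ∑ i ∈ Finset.range n, len i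
  have hT : ∀ n, T (n + 1) = T n + len n := fun n => Finset.sum_range_succ _ _
  have hmono : StrictMono T := strictMono_nat_of_lt_succ fun n => by
    have := hlen n
    rw [hT]; omega
  have hex : ∀ k, ∃ n j, k = T n + j ∧ j < len n := by
    intro k
    induction k with
    | zero => exact ⟨0, 0, by simp [T], hlen 0⟩
    | succ k ih =>
      obtain ⟨n, j, h1, h2⟩ := ih
      rcases (Nat.succ_le_of_lt h2).eq_or_lt with h | h
      · exact ⟨n + 1, 0, by rw [hT]; omega, hlen _⟩
      · exact ⟨n, j + 1, by omega, h⟩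
  choose N J hNJ hJ using hex
  have huniq : ∀ n j, j < len n → N (T n + j) = n ∧ J (T n + j) = j := by
    intro n j hj
    have h1 := hNJ (T n + j)
    have h2 := hJ (T n + j)
    have h3 : T n < T (N (T n + j) + 1) := by rw [hT]; omega
    have h4 : T (N (T n + j)) < T (n + 1) := by rw [hT]; omega
    have h3' := hmono.lt_iff_lt.1 h3
    have h4' := hmono.lt_iff_lt.1 h4
    have h5 : N (T n + j) = n := by omega
    rw [h5] at h1
    exact ⟨h5, by omega⟩
  have hlt : ∀ n j, j < len n → conf (N (T n + j)) (J (T n + j)) = conf n j := by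
    intro n j hj
    rw [(huniq n j hj).1, (huniq n j hj).2]
  refine ⟨fun k => conf (N k) (J k), T, by simp [T], hT, fun n j hj => ?_,
    fun k => ⟨N k, J k, hNJ k, hJ k⟩⟩
  rcases hj.eq_or_lt with rfl | hj
  · have := hlt (n + 1) 0 (hlen _)
    rw [hT, add_zero] at this
    simpa only [hconf n] using this
  · exact hlt n j hj

theorem card_pend_add_ncard_spawn_le {A : DCPS} {rho : ℕ → DConfig}
    (hstep : ∀ i, DStep A (rho i) (rho (i + 1))) (a n : ℕ)
    (hact : ∀ k, a ≤ k → k ≤ a + n → (rho k).act ≠ none) :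
    Multiset.card (rho a).pend + Set.ncard {k | a ≤ k ∧ k < a + n ∧ SpawnAt rho k} ≤
      Multiset.card (rho (a + n)).pend := by
  induction n with
  | zero =>
    have : {k | a ≤ k ∧ k < a + 0 ∧ SpawnAt rho k} = ∅ := by
      ext k; simp; omega
    rw [this]
    simp
  | succ n ih =>
    have ih := ih fun k h1 h2 => hact k h1 (by omega)
    obtain ⟨_, _, _, _, _, sp, -, -, -, -, hp⟩ := (hstep (a + n)).thread_of_act_ne_none
      (hact _ (by omega) (by omega)) (hact (a + n + 1) (by omega) (by omega))
    have hfin : {k | a ≤ k ∧ k < a + n ∧ SpawnAt rho k}.Finite :=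
      (Set.finite_Iio (a + n)).subset fun k hk => hk.2.1
    rw [← add_assoc, hp, Multiset.card_add]
    by_cases hs : SpawnAt rho (a + n)
    · have hsub : {k | a ≤ k ∧ k < a + n + 1 ∧ SpawnAt rho k} ⊆
          insert (a + n) {k | a ≤ k ∧ k < a + n ∧ SpawnAt rho k} := by
        rintro k ⟨h1, h2, h3⟩
        rcases (Nat.lt_succ_iff.1 h2).eq_or_lt with h | h
        · exact Or.inl h
        · exact Or.inr ⟨h1, h, h3⟩
      have h1 := (Set.ncard_le_ncard hsub (hfin.insert _)).trans (Set.ncard_insert_le _ _)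
      obtain ⟨-, -, γ, hγ⟩ := hs
      rw [hp] at hγ
      have h2 := congrArg Multiset.card (add_left_cancel hγ)
      rw [h2, Multiset.card_singleton]
      omega
    · have hsub : {k | a ≤ k ∧ k < a + n + 1 ∧ SpawnAt rho k} ⊆
          {k | a ≤ k ∧ k < a + n ∧ SpawnAt rho k} := by
        rintro k ⟨h1, h2, h3⟩
        rcases (Nat.lt_succ_iff.1 h2).eq_or_lt with h | h
        · exact absurd (h ▸ h3) hs
        · exact ⟨h1, h, h3⟩
      have h1 := Set.ncard_le_ncard hsub hfin
      omega

/-- A macro run with boundedly many spawns in each segment induces a shallow progressive run. -/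
theorem MacroRun.exists_shallow {A : DCPS} {K : ℕ} {g : ℕ → ℕ} {m : ℕ → Multiset Loc} {t : ℕ → Loc}
    {S : ℕ → Multiset ℕ} {r : ℕ → Option Loc} (h : MacroRun A K g m t S r) {B : ℕ}
    (hB : ∀ n, Multiset.card (S n) ≤ B) :
    ∃ rho : ℕ → DConfig, IsInfRunD A rho ∧ KBoundedD K rho ∧ ProgressiveD A K rho ∧
      ShallowD rho := by
  choose len conf m₀ hlen c0 clen cstep cres cmid cle using fun n =>
    (h.seg n).exists_path (h.mem n) (h.step n)
  obtain ⟨rho, T, hT0, hT, hrho, hex⟩ := exists_concat len (fun n => by have := hlen n; omega) conf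
    (fun n => by rw [clen, c0])
  have hmono : StrictMono T := strictMono_nat_of_lt_succ fun n => by
    have := hlen n
    rw [hT]; omega
  have hT' : ∀ n, rho (T n) = ⟨g n, none, m n⟩ := fun n => by
    have := hrho n 0 (Nat.zero_le _)
    rwa [add_zero, c0] at this
  have hcase : ∀ k, ∃ n j, k = T n + j ∧ j < len n ∧ rho k = conf n j ∧
      rho (k + 1) = conf n (j + 1) := by
    intro k
    obtain ⟨n, j, rfl, hj⟩ := hex k
    exact ⟨n, j, rfl, hj, hrho n j hj.le, by rw [add_assoc]; exact hrho n (j + 1) hj⟩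
  have hstep : ∀ i, DStep A (rho i) (rho (i + 1)) := by
    intro k
    obtain ⟨n, j, -, hj, e1, e2⟩ := hcase k
    rw [e1, e2]
    exact cstep n j hj
  have hact : ∀ k w i, (rho k).act = some (w, i) →
      ∃ n j, k = T n + j ∧ 0 < j ∧ j < len n ∧ rho k = conf n j := by
    intro k w i hk
    obtain ⟨n, j, e, hj, e1, -⟩ := hcase k
    refine ⟨n, j, e, Nat.pos_of_ne_zero ?_, hj, e1⟩
    rintro rfl
    rw [e1, c0] at hk
    simp at hk
  refine ⟨rho, ⟨?_, hstep, ?_, ?_⟩, ?_, ⟨?_, ?_⟩, B, ?_⟩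
  · rw [← hT0, hT', h.g_zero, h.m_zero]; rfl
  · intro k hk
    obtain ⟨n, j, rfl, hj, e1, -⟩ := hcase k
    have hj0 : j = 0 := by
      by_contra hj0
      obtain ⟨_, _, e, -⟩ := cmid n j (Nat.pos_of_ne_zero hj0) hj
      rw [e1, e] at hk
      simp at hk
    subst hj0
    have := hlen n
    obtain ⟨_, _, e, -⟩ := cmid n 2 (by omega) (by omega)
    rw [add_zero, hrho n 2 (by omega), e]
    simp
  · intro i
    exact ⟨T i, hmono.le_apply, by rw [hT']⟩
  · intro k w i hk
    obtain ⟨n, j, rfl, hj0, hj, e1⟩ := hact k w i hk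
    obtain ⟨_, _, e, -⟩ := cmid n j hj0 hj
    rw [e1, e] at hk
    simp only [Option.some.injEq, Prod.mk.injEq] at hk
    rw [← hk.2]
    exact h.bound n
  · intro k i hk
    obtain ⟨n, j, rfl, hj0, hj, e1⟩ := hact k _ i hk
    obtain ⟨_, _, e, e', -⟩ := cmid n j hj0 hj
    rw [e1, e] at hk
    simp only [Option.some.injEq, Prod.mk.injEq] at hk
    rw [← hk.2]
    exact e' hk.1
  · intro k l hl
    obtain ⟨n, j, rfl, hj, e1, -⟩ := hcase k
    obtain ⟨n', hn', hl'⟩ : ∃ n', T n + j ≤ T n' ∧ l ∈ m n' := by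
      rcases j.eq_zero_or_pos with rfl | hj0
      · refine ⟨n, le_rfl, ?_⟩
        rwa [e1, c0] at hl
      · refine ⟨n + 1, by rw [hT]; omega, ?_⟩
        obtain ⟨_, S₁, -, -, e, e'⟩ := cmid n j hj0 hj
        rw [e1, e] at hl
        exact Multiset.mem_of_le ((add_le_add_right (Multiset.map_le_map e') _).trans (cle n)) hl
    obtain ⟨i, hi, rfl⟩ := h.prog n' l hl'
    refine ⟨T i, hn'.trans (hmono.monotone hi), ?_⟩
    have := cres i
    have h3 := hlen i
    rw [← hrho i 1 (by omega), ← hrho i 0 (by omega)] at this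
    exact this
  · intro a b hab
    rcases lt_or_ge b a with hba | hba
    · have : {k | a ≤ k ∧ k < b ∧ SpawnAt rho k} = ∅ := by
        ext k; simp; omega
      simp [this]
    obtain ⟨d, rfl⟩ := Nat.exists_eq_add_of_le hba
    have key := card_pend_add_ncard_spawn_le hstep a d hab
    obtain ⟨n, j, rfl, hj, e1, -⟩ := hcase a
    have hj0 : 0 < j := by
      rcases j.eq_zero_or_pos with rfl | hj0
      · exact absurd (by rw [e1, c0]) (hab _ le_rfl hba)
      · exact hj0
    have hjd : j + d < len n := by
      by_contra hjd
      exact hab (T (n + 1)) (by rw [hT]; omega) (by rw [hT]; omega) (by rw [hT'])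
    obtain ⟨_, S₁, -, -, p1, -⟩ := cmid n j hj0 hj
    obtain ⟨_, S₂, -, -, p2, le2⟩ := cmid n (j + d) (by omega) hjd
    rw [e1, add_assoc, hrho n (j + d) hjd.le, p1, p2] at key
    simp only [Multiset.card_add, Multiset.card_map] at key
    have := (Multiset.card_le_card le2).trans (hB n)
    rw [add_assoc]
    omega

/-! ### Threads of a macro run -/

theorem Seg.stage_of_some {A : DCPS} {K g : ℕ} {t : Loc} {S : Multiset ℕ} {r : Option Loc} {g' : ℕ}
    (h : Seg A K g t S r g') {l : Loc} (hl : r = some l) : l.2 = t.2 + 1 := by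
  subst hl
  obtain ⟨γ, w, i, g₁, g₂, w₁, n, -, rfl, -, ⟨γ₂, w₂, w', -, -, h⟩ | ⟨-, -, -, h⟩⟩ := h
  · rw [Option.some.inj h]
  · cases h

theorem Seg.stage_of_none {A : DCPS} {K g : ℕ} {t : Loc} {S : Multiset ℕ} {r : Option Loc} {g' : ℕ}
    (h : Seg A K g t S r g') (hr : r = none) : t.2 = K := by
  subst hr
  obtain ⟨γ, w, i, g₁, g₂, w₁, n, -, rfl, -, ⟨γ₂, w₂, w', -, -, h⟩ | ⟨-, h, -⟩⟩ := h
  · cases h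
  · exact h

theorem TSteps.mem_spawned {A : DCPS} {g : ℕ} {w : List ℕ} {n : ℕ} {S : Multiset ℕ} {g' : ℕ}
    {w' : List ℕ} (h : TSteps A g w n S g' w') :
    ∀ γ ∈ S, γ ∈ A.creation.biUnion fun c => c.2.2.2.2.toFinset := by
  induction h with
  | refl => simp
  | tail h hr ih =>
    intro γ hγ
    rcases Multiset.mem_add.1 hγ with hγ | hγ
    · exact ih γ hγ
    · exact Finset.mem_biUnion.2 ⟨_, hr, by simpa using hγ⟩

theorem Seg.mem_spawned {A : DCPS} {K g : ℕ} {t : Loc} {S : Multiset ℕ} {r : Option Loc} {g' : ℕ}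
    (h : Seg A K g t S r g') : ∀ γ ∈ S, γ ∈ A.creation.biUnion fun c => c.2.2.2.2.toFinset := by
  obtain ⟨γ, w, i, g₁, g₂, w₁, n, -, -, h, -⟩ := h
  exact h.mem_spawned

theorem Seg.mem_glob {A : DCPS} {K g : ℕ} {t : Loc} {S : Multiset ℕ} {r : Option Loc} {g' : ℕ}
    (h : Seg A K g t S r g') :
    g' ∈ A.interruption.image (fun c => c.2.2.1) ∪ A.termination.image Prod.snd := by
  obtain ⟨γ, w, i, g₁, g₂, w₁, n, -, -, -, ⟨γ₂, w₂, w', -, h, -⟩ | ⟨-, -, h, -⟩⟩ := h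
  · exact Finset.mem_union_left _ (Finset.mem_image.2 ⟨_, h, rfl⟩)
  · exact Finset.mem_union_right _ (Finset.mem_image.2 ⟨_, h, rfl⟩)

theorem exists_count_eq (p : ℕ → Prop) [DecidablePred p] {c N : ℕ} (h : c < Nat.count p N) :
    ∃ k < N, p k ∧ Nat.count p k = c := by
  induction N with
  | zero => simp at h
  | succ N ih =>
    by_cases hc : c < Nat.count p N
    · obtain ⟨k, hk, h⟩ := ih hc
      exact ⟨k, by omega, h⟩
    · rw [Nat.count_succ] at h
      split_ifs at h with hp
      · exact ⟨N, by omega, hp, by omega⟩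
      · omega

/-- `Threading t r next root` identifies the threads of a macro run: if segment `n` ends with a swap,
then segment `next n` continues the same thread, and `root n` is the first segment of the thread that
is active in segment `n`. -/
structure Threading (t : ℕ → Loc) (r : ℕ → Option Loc) (next root : ℕ → ℕ) : Prop where
  lt_next : ∀ n, r n ≠ none → n < next n
  next_spec : ∀ n l, r n = some l → t (next n) = l
  next_inj : ∀ n n', r n ≠ none → r n' ≠ none → next n = next n' → n = n'
  exists_prev : ∀ k, 0 < (t k).2 → ∃ n < k, r n ≠ none ∧ next n = k
  root_le : ∀ k, root k ≤ k
  root_stage : ∀ k, (t (root k)).2 = 0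
  root_iterate : ∀ k, next^[(t k).2] (root k) = k
  root_next : ∀ n, r n ≠ none → root (next n) = root n
  root_of_stage : ∀ n, (t n).2 = 0 → root n = n

namespace MacroRun

variable {A : DCPS} {K : ℕ} {g : ℕ → ℕ} {m : ℕ → Multiset Loc} {t : ℕ → Loc} {S : ℕ → Multiset ℕ}
  {r : ℕ → Option Loc}

theorem stage_le (h : MacroRun A K g m t S r) {n : ℕ} {l : Loc} (hl : r n = some l) :
    l.2 ≤ K ∧ l.2 = (t n).2 + 1 := by
  refine ⟨?_, (h.seg n).stage_of_some hl⟩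
  have hs := (h.seg n).stage_of_some hl
  have hmem : l ∈ m (n + 1) + {t n} := by
    rw [h.step, hl]
    simp [optM]
  rcases Multiset.mem_add.1 hmem with hmem | hmem
  · obtain ⟨j, -, rfl⟩ := h.prog _ _ hmem
    exact h.bound j
  · rw [Multiset.mem_singleton.1 hmem] at hs
    omega

theorem ne_none_iff (h : MacroRun A K g m t S r) (n : ℕ) : r n ≠ none ↔ (t n).2 < K := by
  constructor
  · intro hr
    obtain ⟨l, hl⟩ := Option.ne_none_iff_exists'.1 hr
    have := h.stage_le hl
    omega
  · intro hlt hr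
    have := (h.seg n).stage_of_none hr
    omega

theorem count_add_count (h : MacroRun A K g m t S r) {l : Loc} (hl : 0 < l.2) (n : ℕ) :
    (m n).count l + Nat.count (fun k => t k = l) n = Nat.count (fun k => r k = some l) n := by
  have hnew : ∀ γ, newThread γ ≠ l := by
    rintro γ rfl
    exact absurd hl (lt_irrefl _)
  induction n with
  | zero =>
    simp [h.m_zero, (hnew _).symm]
  | succ n ih =>
    have hc := congrArg (Multiset.count l) (h.step n)
    have h0 : Multiset.count l ((S n).map newThread) = 0 := by
      rw [Multiset.count_eq_zero, Multiset.mem_map]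
      rintro ⟨γ, -, hγ⟩
      exact hnew γ hγ
    have h1 : Multiset.count l {t n} = if t n = l then 1 else 0 := by
      simp [Multiset.count_singleton, eq_comm]
    have h2 : Multiset.count l (optM (r n)) = if r n = some l then 1 else 0 := by
      rcases r n with _ | l' <;> simp [optM, Multiset.count_singleton, eq_comm]
    rw [Multiset.count_add, Multiset.count_add, Multiset.count_add, h0, h1, h2] at hc
    rw [Nat.count_succ, Nat.count_succ]
    omega

theorem exists_next (h : MacroRun A K g m t S r) {n : ℕ} {l : Loc} (hl : r n = some l) :
    ∃ k, n < k ∧ t k = l ∧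
      Nat.count (fun k => t k = l) k = Nat.count (fun k => r k = some l) n := by
  have hs := (h.stage_le hl).2
  have hl0 : 0 < l.2 := by omega
  have hex : ∃ N, Nat.count (fun k => r k = some l) n < Nat.count (fun k => t k = l) N := by
    by_contra hcon
    push Not at hcon
    have hmem : ∀ N, n < N → l ∈ m N := by
      intro N hN
      have h1 := h.count_add_count hl0 N
      have h2 := hcon N
      have h3 := Nat.count_strict_mono (p := fun k => r k = some l) hl hN
      exact Multiset.count_pos.1 (by omega)
    have hunb : ∀ c, ∃ N, c ≤ Nat.count (fun k => t k = l) N := by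
      intro c
      induction c with
      | zero => exact ⟨0, Nat.zero_le _⟩
      | succ c ih =>
        obtain ⟨N, hN⟩ := ih
        obtain ⟨j, hj, htj⟩ := h.prog (max N (n + 1)) l (hmem _ (by omega))
        refine ⟨j + 1, ?_⟩
        have h1 := Nat.count_monotone (fun k => t k = l) (show N ≤ j by omega)
        have h2 := Nat.count_strict_mono (p := fun k => t k = l) htj j.lt_succ_self
        have h3 : Nat.count (fun k => t k = l) j < Nat.count (fun k => t k = l) (j + 1) := h2
        omega
    obtain ⟨N, hN⟩ := hunb (Nat.count (fun k => r k = some l) n + 1)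
    have := hcon N
    omega
  obtain ⟨N, hN⟩ := hex
  obtain ⟨k, -, hk, hc⟩ := exists_count_eq _ hN
  refine ⟨k, ?_, hk, hc⟩
  by_contra hkn
  have hne : k ≠ n := by
    rintro rfl
    rw [hk] at hs
    omega
  have h1 := Nat.count_strict_mono (p := fun k => t k = l) hk (show k < n by omega)
  have h2 := h.count_add_count hl0 n
  omega

theorem exists_threading (h : MacroRun A K g m t S r) : ∃ next root, Threading t r next root := by
  have hex : ∀ n, ∃ k, ∀ l, r n = some l → n < k ∧ t k = l ∧
      Nat.count (fun k => t k = l) k = Nat.count (fun k => r k = some l) n := by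
    intro n
    rcases hr : r n with _ | l
    · exact ⟨0, by simp⟩
    · obtain ⟨k, hk⟩ := h.exists_next hr
      refine ⟨k, fun l' hl' => ?_⟩
      obtain rfl := Option.some.inj hl'
      exact hk
  choose next hnext using hex
  have hinj : ∀ n n', r n ≠ none → r n' ≠ none → next n = next n' → n = n' := by
    intro n n' hn hn' e
    obtain ⟨l, hl⟩ := Option.ne_none_iff_exists'.1 hn
    obtain ⟨l', hl'⟩ := Option.ne_none_iff_exists'.1 hn'
    obtain ⟨-, h1, h2⟩ := hnext n l hl
    obtain ⟨-, h1', h2'⟩ := hnext n' l' hl'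
    obtain rfl : l = l' := by rw [← h1, ← h1', e]
    refine Nat.count_injective (p := fun k => r k = some l) hl hl' ?_
    rw [← h2, ← h2', e]
  have hprev : ∀ k, 0 < (t k).2 → ∃ n < k, r n ≠ none ∧ next n = k := by
    intro k hk
    have h1 := h.count_add_count hk k
    have h2 := Multiset.count_pos.2 (h.mem k)
    obtain ⟨n, hn, hr, hc⟩ := exists_count_eq (c := Nat.count (fun j => t j = t k) k) (N := k)
      (fun j => r j = some (t k)) (by omega)
    obtain ⟨-, k1, k2⟩ := hnext n _ hr
    refine ⟨n, hn, by simp [hr], ?_⟩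
    exact Nat.count_injective (p := fun j => t j = t k) k1 rfl (by rw [k2, hc])
  have hstage : ∀ n, r n ≠ none → (t (next n)).2 = (t n).2 + 1 := by
    intro n hn
    obtain ⟨l, hl⟩ := Option.ne_none_iff_exists'.1 hn
    rw [(hnext n l hl).2.1]
    exact (h.stage_le hl).2
  have hroot : ∀ k, ∃ a, a ≤ k ∧ (t a).2 = 0 ∧ next^[(t k).2] a = k := by
    intro k
    induction k using Nat.strong_induction_on with
    | _ k ih =>
      rcases Nat.eq_zero_or_pos (t k).2 with hk | hk
      · exact ⟨k, le_rfl, hk, by rw [hk]; rfl⟩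
      · obtain ⟨n, hn, hr, rfl⟩ := hprev k hk
        obtain ⟨a, h1, h2, h3⟩ := ih n hn
        exact ⟨a, by omega, h2, by rw [hstage n hr, Function.iterate_succ_apply', h3]⟩
  choose root hr1 hr2 hr3 using hroot
  have hiter : ∀ i a, (t a).2 = 0 → i ≤ K → (t (next^[i] a)).2 = i := by
    intro i a ha
    induction i with
    | zero => exact fun _ => ha
    | succ i ih =>
      intro hi
      have := ih (by omega)
      rw [Function.iterate_succ_apply', hstage _ ((h.ne_none_iff _).2 (by omega)), this]
  have hiinj : ∀ i a b, (t a).2 = 0 → (t b).2 = 0 → i ≤ K → next^[i] a = next^[i] b → a = b := by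
    intro i a b ha hb
    induction i with
    | zero => exact fun _ e => e
    | succ i ih =>
      intro hi e
      rw [Function.iterate_succ_apply', Function.iterate_succ_apply'] at e
      refine ih (by omega) (hinj _ _ ((h.ne_none_iff _).2 ?_) ((h.ne_none_iff _).2 ?_) e)
      · rw [hiter i a ha (by omega)]; omega
      · rw [hiter i b hb (by omega)]; omega
  refine ⟨next, root, ⟨fun n hn => ?_, fun n l hl => (hnext n l hl).2.1, hinj, hprev, hr1, hr2, hr3,
    fun n hn => ?_, fun n hn => ?_⟩⟩
  · obtain ⟨l, hl⟩ := Option.ne_none_iff_exists'.1 hn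
    exact (hnext n l hl).1
  · refine hiinj ((t n).2 + 1) _ _ (hr2 _) (hr2 _) ((h.ne_none_iff n).1 hn) ?_
    rw [Function.iterate_succ_apply' _ _ (root n), hr3, ← hstage n hn, hr3]
  · have := hr3 n
    rwa [hn] at this

end MacroRun

/-! ### Replacing threads by threads with more spawns -/

/-- In a family of threads with finitely many types and well-quasi-ordered sizes, finitely many
colours suffice to let a single thread dominate all threads of its colour, up to any finite set. -/
theorem exists_finite_colouring {α β X : Type*} [Nonempty α] [Preorder X] [WellQuasiOrderedLE X]
    (f : α → β) (hf : (Set.range f).Finite) (v : α → X) :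
    ∃ col : α → Set α, (Set.range col).Finite ∧ ∀ s : Finset α, ∃ b : Set α → α, ∀ a ∈ s,
      f a = f (b (col a)) ∧ v a ≤ v (b (col a)) := by
  classical
  let _ : Preorder α :=
    { le := fun a b => f a = f b ∧ v a ≤ v b
      le_refl := fun a => ⟨rfl, le_rfl⟩
      le_trans := fun a b c hab hbc => ⟨hab.1.trans hbc.1, hab.2.trans hbc.2⟩ }
  have : WellQuasiOrderedLE α := ⟨fun u => by
    obtain ⟨φ, hφ, hφ'⟩ := exists_subseq_const_monotone (fun n => f (u n))
      (hf.subset (Set.range_comp_subset_range u f)) (fun n => v (u n))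
    exact ⟨φ 0, φ 1, hφ one_pos, hφ' 0 1 zero_le_one⟩⟩
  obtain ⟨F, hF, hdir, hcov⟩ := exists_finite_directedOn_cover α
  choose col hcol hmem using hcov
  refine ⟨col, hF.subset (Set.range_subset_iff.2 hcol), fun s => ?_⟩
  have hb : ∀ D : Set α, ∃ b : α, ∀ a ∈ s, col a = D → f a = f b ∧ v a ≤ v b := by
    intro D
    by_cases hD : ∃ a, col a = D
    · obtain ⟨a₀, rfl⟩ := hD
      obtain ⟨b, -, hb⟩ := (hdir _ (hcol a₀)).exists_forall_le ⟨a₀, hmem a₀⟩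
        (s.filter fun a => col a = col a₀)
        (fun a ha => (Finset.mem_filter.1 ha).2 ▸ hmem a)
      exact ⟨b, fun a ha hc => hb a (Finset.mem_filter.2 ⟨ha, hc⟩)⟩
    · exact ⟨Classical.arbitrary α, fun a _ hc => absurd ⟨a, hc⟩ hD⟩
  choose b hb using hb
  exact ⟨b, fun a ha => hb _ a ha rfl⟩

/-- The thread with first segment `a` can be replaced by the thread with first segment `b`, at the
price of more spawns of the symbols that it spawns anyway. -/
structure Covers (K : ℕ) (g : ℕ → ℕ) (t : ℕ → Loc) (S : ℕ → Multiset ℕ) (next : ℕ → ℕ)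
    (a b : ℕ) : Prop where
  stage : (t b).2 = 0
  start : t b = t a
  glob : ∀ i ≤ K, g (next^[i] b) = g (next^[i] a)
  glob_succ : ∀ i ≤ K, g (next^[i] b + 1) = g (next^[i] a + 1)
  spawn_le : ∀ i ≤ K, S (next^[i] a) ≤ S (next^[i] b)
  spawn_supp : ∀ i ≤ K, ∀ γ ∈ S (next^[i] b), γ ∈ S (next^[i] a)

namespace MacroRun

variable {A : DCPS} {K : ℕ} {g : ℕ → ℕ} {m : ℕ → Multiset Loc} {t : ℕ → Loc} {S : ℕ → Multiset ℕ}
  {r : ℕ → Option Loc} {next root : ℕ → ℕ}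

theorem stage_next (h : MacroRun A K g m t S r) (θ : Threading t r next root) {n : ℕ}
    (hn : (t n).2 < K) : (t (next n)).2 = (t n).2 + 1 := by
  obtain ⟨l, hl⟩ := Option.ne_none_iff_exists'.1 ((h.ne_none_iff n).2 hn)
  rw [θ.next_spec n l hl]
  exact (h.stage_le hl).2

theorem stage_iterate (h : MacroRun A K g m t S r) (θ : Threading t r next root) {a : ℕ}
    (ha : (t a).2 = 0) : ∀ i ≤ K, (t (next^[i] a)).2 = i := by
  intro i
  induction i with
  | zero => exact fun _ => ha
  | succ i ih =>
    intro hi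
    have := ih (by omega)
    rw [Function.iterate_succ_apply', h.stage_next θ (by omega), this]

theorem finite_new (h : MacroRun A K g m t S r) : {l : Loc | l.2 = 0 ∧ ∃ n, l ∈ m n}.Finite := by
  refine Set.Finite.subset (s := {newThread A.gamma0} ∪
    newThread '' (A.creation.biUnion fun c => c.2.2.2.2.toFinset : Finset ℕ))
    ((Set.finite_singleton _).union ((Finset.finite_toSet _).image _)) ?_
  rintro l ⟨hl, n, hn⟩
  induction n with
  | zero =>
    rw [h.m_zero] at hn
    exact Or.inl (Multiset.mem_singleton.1 hn)
  | succ n ih =>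
    have hmem : l ∈ m (n + 1) + {t n} := Multiset.mem_add.2 (Or.inl hn)
    rw [h.step, Multiset.mem_add, Multiset.mem_add] at hmem
    rcases hmem with (hmem | hmem) | hmem
    · exact ih hmem
    · obtain ⟨γ, hγ, rfl⟩ := Multiset.mem_map.1 hmem
      exact Or.inr ⟨γ, (h.seg n).mem_spawned γ hγ, rfl⟩
    · rcases hr : r n with _ | l'
      · simp [hr, optM] at hmem
      · have h1 := (h.stage_le hr).2
        simp only [hr, optM, Option.elim, Multiset.mem_singleton] at hmem
        subst hmem
        omega

theorem finite_glob (h : MacroRun A K g m t S r) : (Set.range g).Finite := by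
  refine Set.Finite.subset (s := {A.g0} ∪
    (A.interruption.image (fun c => c.2.2.1) ∪ A.termination.image Prod.snd : Finset ℕ))
    ((Set.finite_singleton _).union (Finset.finite_toSet _)) ?_
  rintro _ ⟨n, rfl⟩
  cases n with
  | zero => exact Or.inl h.g_zero
  | succ n => exact Or.inr (h.seg n).mem_glob

theorem exists_covers (h : MacroRun A K g m t S r) (θ : Threading t r next root) (N : ℕ) :
    ∃ (Col : Type) (col : ℕ → Col), (Set.range col).Finite ∧ ∀ T, ∃ b : Col → ℕ,
      (∀ a < T, (t a).2 = 0 → Covers K g t S next a (b (col a))) ∧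
      ∀ a < N, (t a).2 = 0 → b (col a) = a := by
  classical
  set Γ : Finset ℕ := A.creation.biUnion fun c => c.2.2.2.2.toFinset with hΓ
  have hne : Nonempty {a // (t a).2 = 0} := ⟨⟨root 0, θ.root_stage 0⟩⟩
  let f : {a // (t a).2 = 0} → Loc × (Fin (K + 1) → ℕ × ℕ × Finset ℕ) := fun a =>
    (t a, fun i => (g (next^[i] a), g (next^[i] a + 1), (S (next^[i] a)).toFinset))
  have hf : (Set.range f).Finite := by
    refine Set.Finite.subset (h.finite_new.prod (Set.Finite.pi' fun _ : Fin (K + 1) =>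
      h.finite_glob.prod (h.finite_glob.prod (Finset.finite_toSet Γ.powerset)))) ?_
    rintro _ ⟨a, rfl⟩
    refine ⟨⟨a.2, a, h.mem a⟩, fun i => ⟨⟨_, rfl⟩, ⟨_, rfl⟩, ?_⟩⟩
    refine Finset.mem_coe.2 (Finset.mem_powerset.2 fun γ hγ => ?_)
    exact (h.seg _).mem_spawned γ (Multiset.mem_toFinset.1 hγ)
  let v : {a // (t a).2 = 0} → Fin (K + 1) × Γ → ℕ := fun a x =>
    (S (next^[x.1] a)).count (x.2 : ℕ)
  obtain ⟨col, hcol, hb⟩ := exists_finite_colouring f hf v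
  refine ⟨ℕ ⊕ Set {a // (t a).2 = 0}, fun a =>
    if ha : (t a).2 = 0 ∧ N ≤ a then Sum.inr (col ⟨a, ha.1⟩) else Sum.inl (min a N), ?_, ?_⟩
  · refine Set.Finite.subset (((Set.finite_Iic N).image Sum.inl).union (hcol.image Sum.inr)) ?_
    rintro _ ⟨a, rfl⟩
    dsimp only
    split_ifs
    · exact Or.inr ⟨_, ⟨_, rfl⟩, rfl⟩
    · exact Or.inl ⟨_, Set.mem_Iic.2 (min_le_right _ _), rfl⟩
  · intro T
    obtain ⟨b, hb⟩ := hb ((Finset.range T).subtype fun a => (t a).2 = 0)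
    refine ⟨Sum.elim id fun D => b D, fun a haT ha => ?_, fun a haN ha => ?_⟩
    · by_cases hN : N ≤ a
      · obtain ⟨h1, h2⟩ := hb ⟨a, ha⟩ (by simpa using haT)
        simp only [ha, hN, and_self, dif_pos, Sum.elim_inr]
        set c := b (col ⟨a, ha⟩) with hc
        have h3 := congrFun (congrArg Prod.snd h1)
        simp only [f, Prod.mk.injEq] at h3
        have h4 : ∀ i ≤ K, (S (next^[i] a)).toFinset = (S (next^[i] c)).toFinset := fun i hi =>
          (h3 ⟨i, by omega⟩).2.2
        refine ⟨c.2, (congrArg Prod.fst h1).symm, fun i hi => (h3 ⟨i, by omega⟩).1.symm,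
          fun i hi => (h3 ⟨i, by omega⟩).2.1.symm, fun i hi => Multiset.le_iff_count.2 fun γ => ?_,
          fun i hi γ hγ => ?_⟩
        · by_cases hγ : γ ∈ S (next^[i] a)
          · exact h2 (⟨i, by omega⟩, ⟨γ, (h.seg _).mem_spawned γ hγ⟩)
          · rw [Multiset.count_eq_zero.2 hγ]
            exact Nat.zero_le _
        · rw [← Multiset.mem_toFinset, h4 i hi]
          exact Multiset.mem_toFinset.2 hγ
      · have : ¬ ((t a).2 = 0 ∧ N ≤ a) := fun hh => hN hh.2
        simp only [this, dif_neg, not_false_eq_true, Sum.elim_inl, id]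
        rw [min_eq_left (by omega)]
        exact ⟨ha, rfl, fun _ _ => rfl, fun _ _ => rfl, fun _ _ => le_rfl, fun _ _ _ => id⟩
    · have : ¬ ((t a).2 = 0 ∧ N ≤ a) := fun hh => by omega
      simp only [this, dif_neg, not_false_eq_true, Sum.elim_inl, id]
      exact min_eq_left haN.le

/-! ### Kinds of inactive threads -/

/-- The kind of the thread active in segment `n`: its local configuration if it has just been
spawned, and otherwise its colour and context-switch number. -/
def kind {Col : Type} (t : ℕ → Loc) (root : ℕ → ℕ) (col : ℕ → Col) (n : ℕ) : Loc ⊕ Col × ℕ :=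
  if (t n).2 = 0 then Sum.inl (t n) else Sum.inr (col (root n), (t n).2)

theorem finite_kind {Col : Type} {col : ℕ → Col} (h : MacroRun A K g m t S r)
    (hcol : (Set.range col).Finite) : (Set.range (kind t root col)).Finite := by
  refine Set.Finite.subset ((h.finite_new.image Sum.inl).union
    ((hcol.prod (Set.finite_Iic K)).image Sum.inr)) ?_
  rintro _ ⟨n, rfl⟩
  unfold kind
  split_ifs with hn
  · exact Or.inl ⟨_, ⟨hn, n, h.mem n⟩, rfl⟩
  · exact Or.inr ⟨_, ⟨⟨_, rfl⟩, Set.mem_Iic.2 (h.bound n)⟩, rfl⟩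

theorem exists_kinds {Col : Type} (col : ℕ → Col) (h : MacroRun A K g m t S r)
    (θ : Threading t r next root) : ∃ L : ℕ → Multiset (Loc ⊕ Col × ℕ),
      L 0 = {Sum.inl (newThread A.gamma0)} ∧ (∀ n, kind t root col n ∈ L n) ∧
      (∀ n, L (n + 1) + {kind t root col n} = L n + (S n).map (fun γ => Sum.inl (newThread γ)) +
        if (t n).2 < K then {Sum.inr (col (root n), (t n).2 + 1)} else 0) ∧
      ∀ n, ∀ k ∈ L n, ∃ j ≥ n, kind t root col j = k := by
  classical
  let Q : ℕ → ℕ → Multiset (Loc ⊕ Col × ℕ) := fun n i =>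
    if r i ≠ none ∧ n ≤ next i then {kind t root col (next i)} else 0
  let P : ℕ → Multiset (Loc ⊕ Col × ℕ) := fun n => ((m n).filter fun l => l.2 = 0).map Sum.inl
  have hP : ∀ n, P (n + 1) + (if (t n).2 = 0 then {kind t root col n} else 0) =
      P n + (S n).map (fun γ => Sum.inl (newThread γ)) := by
    intro n
    have h1 := congrArg (fun M => (M.filter fun l : Loc => l.2 = 0).map
      (Sum.inl : Loc → Loc ⊕ Col × ℕ)) (h.step n)
    have h2 : (optM (r n)).filter (fun l : Loc => l.2 = 0) = 0 := by
      rcases hr : r n with _ | l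
      · rfl
      · have := (h.stage_le hr).2
        simp [optM, Multiset.filter_singleton, show ¬ l.2 = 0 by omega]
    have h3 : ((S n).map newThread).filter (fun l : Loc => l.2 = 0) = (S n).map newThread := by
      rw [Multiset.filter_eq_self]
      intro l hl
      obtain ⟨γ, -, rfl⟩ := Multiset.mem_map.1 hl
      rfl
    simp only [Multiset.filter_add, Multiset.map_add, h2, h3, add_zero,
      Multiset.map_map, Multiset.filter_singleton] at h1
    refine Eq.trans ?_ h1
    unfold kind
    split_ifs <;> rfl
  have hQ : ∀ n, (∑ i ∈ Finset.range (n + 1), Q (n + 1) i) +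
      (if (t n).2 = 0 then 0 else {kind t root col n}) =
      (∑ i ∈ Finset.range n, Q n i) +
        if (t n).2 < K then {Sum.inr (col (root n), (t n).2 + 1)} else 0 := by
    intro n
    have h1 : Q (n + 1) n =
        if (t n).2 < K then {Sum.inr (col (root n), (t n).2 + 1)} else 0 := by
      by_cases hn : (t n).2 < K
      · have hr := (h.ne_none_iff n).2 hn
        have hlt := θ.lt_next n hr
        have hs := h.stage_next θ hn
        simp only [Q]
        rw [if_pos ⟨hr, hlt⟩, if_pos hn]
        simp [kind, hs, θ.root_next n hr]
      · have hr : ¬ r n ≠ none := fun hr => hn ((h.ne_none_iff n).1 hr)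
        simp [Q, hr, hn]
    have h2 : ∀ i, Q n i = Q (n + 1) i +
        if r i ≠ none ∧ next i = n then {kind t root col n} else 0 := by
      intro i
      simp only [Q]
      by_cases hr : r i ≠ none
      · rcases lt_trichotomy (next i) n with hi | hi | hi
        · rw [if_neg (by omega), if_neg (by omega), if_neg (by omega), add_zero]
        · rw [if_pos ⟨hr, hi.ge⟩, if_neg (by omega), if_pos ⟨hr, hi⟩, zero_add, hi]
        · rw [if_pos ⟨hr, hi.le⟩, if_pos ⟨hr, hi⟩, if_neg (by omega), add_zero]
      · simp [hr]
    have h3 : (∑ i ∈ Finset.range n,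
        if r i ≠ none ∧ next i = n then {kind t root col n} else 0) =
        (if (t n).2 = 0 then 0 else {kind t root col n} : Multiset (Loc ⊕ Col × ℕ)) := by
      split_ifs with hn
      · refine Finset.sum_eq_zero fun i _ => if_neg ?_
        rintro ⟨hr, rfl⟩
        rw [h.stage_next θ ((h.ne_none_iff i).1 hr)] at hn
        omega
      · obtain ⟨i, hi, hr, hin⟩ := θ.exists_prev n (by omega)
        rw [Finset.sum_eq_single i, if_pos ⟨hr, hin⟩]
        · intro j _ hji
          refine if_neg fun hj => hji (θ.next_inj j i hj.1 hr (hj.2.trans hin.symm))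
        · exact fun hni => absurd (Finset.mem_range.2 hi) hni
    rw [Finset.sum_range_succ, h1, Finset.sum_congr rfl fun i _ => h2 i, Finset.sum_add_distrib, h3]
    abel
  refine ⟨fun n => P n + ∑ i ∈ Finset.range n, Q n i, ?_, fun n => ?_, fun n => ?_, fun n k hk => ?_⟩
  · simp [P, h.m_zero, Multiset.filter_singleton, newThread]
  · by_cases hn : (t n).2 = 0
    · refine Multiset.mem_add.2 (Or.inl (Multiset.mem_map.2
        ⟨t n, Multiset.mem_filter.2 ⟨h.mem n, hn⟩, ?_⟩))
      simp [kind, hn]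
    · obtain ⟨i, hi, hr, hin⟩ := θ.exists_prev n (by omega)
      refine Multiset.mem_add.2 (Or.inr (Multiset.mem_sum.2 ⟨i, Finset.mem_range.2 hi, ?_⟩))
      simp [Q, hr, hin]
  · have hsplit : ({kind t root col n} : Multiset (Loc ⊕ Col × ℕ)) =
        (if (t n).2 = 0 then {kind t root col n} else 0) +
        (if (t n).2 = 0 then 0 else {kind t root col n}) := by
      split_ifs <;> simp
    dsimp only
    rw [hsplit, add_add_add_comm, hP, hQ]
    abel
  · rcases Multiset.mem_add.1 hk with hk | hk
    · obtain ⟨l, hl, rfl⟩ := Multiset.mem_map.1 hk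
      obtain ⟨hl, hl0⟩ := Multiset.mem_filter.1 hl
      obtain ⟨j, hj, rfl⟩ := h.prog n l hl
      exact ⟨j, hj, by simp [kind, hl0]⟩
    · obtain ⟨i, -, hi⟩ := Multiset.mem_sum.1 hk
      simp only [Q] at hi
      split_ifs at hi with hc
      · exact ⟨next i, hc.2, (Multiset.mem_singleton.1 hi).symm⟩
      · simp at hi

end MacroRun

/-! ### The pumped run -/

/-- The position in the original run of each segment of the lasso that repeats `[s, T)` forever. -/
def lassoPos (s T : ℕ) : ℕ → ℕ
  | 0 => 0
  | p + 1 => if lassoPos s T p + 1 = T then s else lassoPos s T p + 1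

theorem lassoPos_lt {s T : ℕ} (hs : s < T) (p : ℕ) : lassoPos s T p < T := by
  induction p with
  | zero => exact Nat.zero_lt_of_lt hs
  | succ p ih =>
    rw [lassoPos]
    split_ifs <;> omega

theorem exists_lassoPos_eq_of_le {s T : ℕ} (p j : ℕ) (hp : lassoPos s T p ≤ j) (hj : j < T) :
    ∃ q ≥ p, lassoPos s T q = j := by
  induction j, hp using Nat.le_induction with
  | base => exact ⟨p, le_rfl, rfl⟩
  | succ j _ ih =>
    obtain ⟨q, hq, rfl⟩ := ih (by omega)
    exact ⟨q + 1, by omega, by rw [lassoPos, if_neg (by omega)]⟩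

theorem exists_lassoPos_eq {s T : ℕ} (hs : s < T) (p j : ℕ) (hsj : s ≤ j) (hj : j < T) :
    ∃ q ≥ p, lassoPos s T q = j := by
  have := lassoPos_lt hs p
  obtain ⟨q, hq, hqT⟩ := exists_lassoPos_eq_of_le (s := s) (T := T) p (T - 1) (by omega) (by omega)
  obtain ⟨q', hq', h⟩ := exists_lassoPos_eq_of_le (s := s) (T := T) (q + 1) j
    (by rw [lassoPos, if_pos (by omega)]; exact hsj) hj
  exact ⟨q', by omega, h⟩

namespace MacroRun

variable {A : DCPS} {K : ℕ} {g : ℕ → ℕ} {m : ℕ → Multiset Loc} {t : ℕ → Loc} {S : ℕ → Multiset ℕ}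
  {r : ℕ → Option Loc} {next root : ℕ → ℕ}

/-- The properties of a segment `σ` of the macro run that can replace segment `n`, where `φ` assigns
local configurations to kinds. -/
structure Replaces {Col : Type} (g : ℕ → ℕ) (t : ℕ → Loc) (S : ℕ → Multiset ℕ)
    (r : ℕ → Option Loc) (K : ℕ) (root : ℕ → ℕ) (col : ℕ → Col) (φ : Loc ⊕ Col × ℕ → Loc)
    (n σ : ℕ) : Prop where
  act : t σ = φ (kind t root col n)
  glob : g σ = g n
  glob_succ : g (σ + 1) = g (n + 1)
  spawn_le : S n ≤ S σ
  spawn_supp : ∀ γ ∈ S σ, γ ∈ S n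
  result : optM (r σ) =
    (if (t n).2 < K then {φ (Sum.inr (col (root n), (t n).2 + 1))} else 0 : Multiset Loc)

theorem exists_replaces {Col : Type} {col : ℕ → Col} (h : MacroRun A K g m t S r)
    (θ : Threading t r next root) {N T : ℕ} {b : Col → ℕ}
    (hb : ∀ a < T, (t a).2 = 0 → Covers K g t S next a (b (col a)))
    (hbN : ∀ a < N, (t a).2 = 0 → b (col a) = a) :
    ∃ (φ : Loc ⊕ Col × ℕ → Loc) (σ : ℕ → ℕ), (∀ l, φ (Sum.inl l) = l) ∧
      (∀ n < T, Replaces g t S r K root col φ n (σ n)) ∧ ∀ n < N, σ n = n := by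
  refine ⟨Sum.elim id fun x => t (next^[x.2] (b x.1)), fun n => next^[(t n).2] (b (col (root n))),
    fun l => rfl, fun n hn => ?_, fun n hn => ?_⟩
  · have hc := hb (root n) ((θ.root_le n).trans_lt hn) (θ.root_stage n)
    have hK := h.bound n
    have hs := h.stage_iterate θ hc.stage _ hK
    refine ⟨?_, ?_, ?_, ?_, ?_, ?_⟩
    · unfold kind
      split_ifs with h0
      · change t (next^[(t n).2] (b (col (root n)))) = t n
        rw [h0, Function.iterate_zero_apply, hc.start, θ.root_of_stage n h0]
      · rfl
    · rw [hc.glob _ hK, θ.root_iterate]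
    · rw [hc.glob_succ _ hK, θ.root_iterate]
    · have := hc.spawn_le _ hK
      rwa [θ.root_iterate] at this
    · have := hc.spawn_supp _ hK
      rwa [θ.root_iterate] at this
    · split_ifs with hlt
      · obtain ⟨l, hl⟩ := Option.ne_none_iff_exists'.1 ((h.ne_none_iff _).2 (hs.trans_lt hlt))
        rw [hl, Sum.elim_inr, Function.iterate_succ_apply', θ.next_spec _ l hl]
        rfl
      · have : ¬ r (next^[(t n).2] (b (col (root n)))) ≠ none := fun hr =>
          hlt (hs ▸ (h.ne_none_iff _).1 hr)
        rw [not_not.1 this]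
        rfl
  · dsimp only
    rw [hbN _ ((θ.root_le n).trans_lt hn) (θ.root_stage n), θ.root_iterate]

theorem exists_card_spawn_le (h : MacroRun A K g m t S r) :
    ∃ (g' : ℕ → ℕ) (m' : ℕ → Multiset Loc) (t' : ℕ → Loc) (S' : ℕ → Multiset ℕ)
      (r' : ℕ → Option Loc) (B : ℕ), MacroRun A K g' m' t' S' r' ∧
      ∀ n, Multiset.card (S' n) ≤ B := by
  classical
  obtain ⟨next, root, θ⟩ := h.exists_threading
  -- After time `N`, a fresh thread that is resumed is resumed infinitely often.
  obtain ⟨N, hN⟩ := exists_forall_ge_frequently (fun n => if (t n).2 = 0 then some (t n) else none)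
    (((h.finite_new.image some).insert none).subset (by
      rintro _ ⟨n, rfl⟩
      dsimp only
      split_ifs with hn
      · exact Or.inr ⟨_, ⟨hn, n, h.mem n⟩, rfl⟩
      · exact Or.inl rfl))
  obtain ⟨Col, col, hcol, hcov⟩ := h.exists_covers θ N
  obtain ⟨L, hL0, hLmem, hLstep, hLprog⟩ := h.exists_kinds col θ
  have hfin := h.finite_kind (root := root) hcol
  obtain ⟨N', hN'⟩ := exists_forall_ge_frequently _ hfin
  have : Finite (Set.range (kind t root col)) := hfin
  obtain ⟨ψ, hψ, hψ'⟩ := exists_subseq_const_monotone g h.finite_glob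
    (fun n (k : Set.range (kind t root col)) => (L n).count (k : Loc ⊕ Col × ℕ))
  obtain ⟨s, T, hsN', hsT, hgs, hLs, hrec⟩ : ∃ s T, N' ≤ s ∧ s < T ∧ g s = g T ∧ L s ≤ L T ∧
      ∀ n ≥ N', ∃ j, s ≤ j ∧ j < T ∧ kind t root col j = kind t root col n := by
    have hex : ∀ k, ∃ j, ∀ n ≥ N', kind t root col n = k →
        ψ N' ≤ j ∧ kind t root col j = kind t root col n := by
      intro k
      by_cases hk : ∃ n ≥ N', kind t root col n = k
      · obtain ⟨n, hn, rfl⟩ := hk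
        obtain ⟨j, hj, hjn⟩ := hN' n hn (ψ N')
        exact ⟨j, fun n' _ hn' => ⟨hj, hjn.trans hn'.symm⟩⟩
      · exact ⟨0, fun n hn hnk => absurd ⟨n, hn, hnk⟩ hk⟩
    choose e he using hex
    obtain ⟨B, hB⟩ := (hfin.image e).bddAbove
    refine ⟨ψ N', ψ (max N' B + 1), hψ.le_apply, hψ (by omega), (hψ' _ _ (by omega)).1, ?_, ?_⟩
    · refine Multiset.le_iff_count.2 fun k => ?_
      by_cases hk : k ∈ Set.range (kind t root col)
      · exact (hψ' N' (max N' B + 1) (by omega)).2 ⟨k, hk⟩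
      · rw [Multiset.count_eq_zero.2]
        · exact Nat.zero_le _
        · intro hkL
          obtain ⟨j, -, hj⟩ := hLprog _ k hkL
          exact hk ⟨j, hj⟩
    · intro n hn
      obtain ⟨h1, h2⟩ := he _ n hn rfl
      refine ⟨_, h1, ?_, h2⟩
      have h3 : e (kind t root col n) ≤ B := hB ⟨_, ⟨n, rfl⟩, rfl⟩
      have h4 : max N' B + 1 ≤ ψ (max N' B + 1) := hψ.le_apply
      omega
  obtain ⟨b, hb, hbN⟩ := hcov T
  obtain ⟨φ, σ, hφ, hσ, hσN⟩ := h.exists_replaces θ hb hbN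
  obtain ⟨D, hD⟩ := Multiset.le_iff_exists_add.1 hLs
  have hE : ∀ n, ∃ E, n < T → S (σ n) = S n + E := by
    intro n
    by_cases hn : n < T
    · obtain ⟨E, hE⟩ := Multiset.le_iff_exists_add.1 (hσ n hn).spawn_le
      exact ⟨E, fun _ => hE⟩
    · exact ⟨0, fun hn' => absurd hn' hn⟩
  choose E hE using hE
  let pos := lassoPos s T
  have hpos : ∀ p, pos p < T := lassoPos_lt hsT
  have hpos_succ : ∀ p, pos (p + 1) = if pos p + 1 = T then s else pos p + 1 := fun p => rfl
  -- The threads of the new run that have no counterpart in the original run.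
  let U : ℕ → Multiset Loc := fun p => ∑ q ∈ Finset.range p,
    ((E (pos q)).map newThread + if pos q + 1 = T then D.map φ else 0)
  have hU : ∀ p, ∀ l ∈ U p, ∃ n ≥ N', φ (kind t root col n) = l := by
    intro p l hl
    obtain ⟨q, -, hl⟩ := Multiset.mem_sum.1 hl
    rcases Multiset.mem_add.1 hl with hl | hl
    · obtain ⟨γ, hγ, rfl⟩ := Multiset.mem_map.1 hl
      have hSE := hE _ (hpos q)
      have hNq : N ≤ pos q := by
        by_contra hlt
        rw [hσN _ (by omega)] at hSE
        rw [left_eq_add.1 hSE] at hγ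
        simp at hγ
      have hγS : γ ∈ S (pos q) := (hσ _ (hpos q)).spawn_supp γ (by
        rw [hSE]
        exact Multiset.mem_add.2 (Or.inr hγ))
      have hj : ∃ j ≥ N, t j = newThread γ := by
        have hmem : newThread γ ∈ m (pos q + 1) + {t (pos q)} := by
          rw [h.step]
          exact Multiset.mem_add.2 (Or.inl (Multiset.mem_add.2
            (Or.inr (Multiset.mem_map_of_mem _ hγS))))
        rcases Multiset.mem_add.1 hmem with hmem | hmem
        · obtain ⟨j, hj, hjt⟩ := h.prog _ _ hmem
          exact ⟨j, by omega, hjt⟩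
        · exact ⟨pos q, hNq, (Multiset.mem_singleton.1 hmem).symm⟩
      obtain ⟨j, hj, hjt⟩ := hj
      obtain ⟨j', hj', hjj⟩ := hN j hj N'
      have h0 : (newThread γ).2 = 0 := rfl
      simp only [hjt, h0, if_true] at hjj
      split_ifs at hjj with h0'
      refine ⟨j', hj', ?_⟩
      rw [kind, if_pos h0', hφ, Option.some.inj hjj]
    · split_ifs at hl with hT
      · obtain ⟨k, hk, rfl⟩ := Multiset.mem_map.1 hl
        obtain ⟨j, hj, rfl⟩ := hLprog T k (by
          rw [hD]
          exact Multiset.mem_add.2 (Or.inr hk))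
        exact ⟨j, by omega, rfl⟩
      · simp at hl
  obtain ⟨B, hB⟩ := (((Set.finite_Iio T).image fun n => Multiset.card (S (σ n)))).bddAbove
  refine ⟨fun p => g (pos p), fun p => (L (pos p)).map φ + U p, fun p => t (σ (pos p)),
    fun p => S (σ (pos p)), fun p => r (σ (pos p)), B, ⟨h.g_zero, ?_, fun p => ?_, fun p => ?_,
    fun p => ?_, fun p => h.bound _, fun p l hl => ?_⟩,
    fun p => hB ⟨pos p, Set.mem_Iio.2 (hpos p), rfl⟩⟩
  · have : pos 0 = 0 := rfl
    simp [this, hL0, U, hφ]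
  · have h1 := h.seg (σ (pos p))
    rw [(hσ _ (hpos p)).glob, (hσ _ (hpos p)).glob_succ] at h1
    rw [hpos_succ]
    split_ifs with hT
    · rwa [hgs, ← hT]
    · exact h1
  · refine Multiset.mem_add.2 (Or.inl ?_)
    rw [(hσ _ (hpos p)).act]
    exact Multiset.mem_map_of_mem _ (hLmem _)
  · have h1 := congrArg (Multiset.map φ) (hLstep (pos p))
    have h2 : U (p + 1) = U p + ((E (pos p)).map newThread +
        if pos p + 1 = T then D.map φ else 0) := Finset.sum_range_succ _ _
    have h3 : (L (pos (p + 1))).map φ + (if pos p + 1 = T then D.map φ else 0) =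
        (L (pos p + 1)).map φ := by
      rw [hpos_succ]
      split_ifs with hT
      · rw [hT, hD, Multiset.map_add]
      · rw [add_zero]
    have h4 : (if (t (pos p)).2 < K then
        {Sum.inr (col (root (pos p)), (t (pos p)).2 + 1)} else 0 : Multiset _).map φ =
        optM (r (σ (pos p))) := by
      rw [(hσ _ (hpos p)).result]
      split_ifs <;> simp
    simp only [Multiset.map_add, Multiset.map_singleton, Multiset.map_map, h4] at h1
    simp only [Function.comp_def, hφ] at h1
    rw [(hσ _ (hpos p)).act, hE _ (hpos p), h2, Multiset.map_add]
    calc _ = ((L (pos (p + 1))).map φ + (if pos p + 1 = T then D.map φ else 0)) +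
          {φ (kind t root col (pos p))} + (U p + (E (pos p)).map newThread) := by abel
      _ = _ := by
        rw [h3, h1]
        abel
  · have hlate : ∀ n ≥ N', ∃ q ≥ p, t (σ (pos q)) = φ (kind t root col n) := by
      intro n hn
      obtain ⟨j, hj1, hj2, hj3⟩ := hrec n hn
      obtain ⟨q, hq, hqj⟩ := exists_lassoPos_eq hsT p j hj1 hj2
      have hqj : pos q = j := hqj
      exact ⟨q, hq, by rw [hqj, (hσ j hj2).act, hj3]⟩
    rcases Multiset.mem_add.1 hl with hl | hl
    · obtain ⟨k, hk, rfl⟩ := Multiset.mem_map.1 hl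
      obtain ⟨j, hj, rfl⟩ := hLprog _ k hk
      by_cases hjT : j < T
      · obtain ⟨q, hq, hqj⟩ := exists_lassoPos_eq_of_le p j hj hjT
        have hqj : pos q = j := hqj
        exact ⟨q, hq, by rw [hqj, (hσ j hjT).act]⟩
      · exact hlate j (by omega)
    · obtain ⟨n, hn, rfl⟩ := hU p l hl
      exact hlate n hn

end MacroRun

/-- For each `K ∈ ℕ`, a DCPS has an infinite progressive
`K`-context switch bounded run iff it has a shallow infinite progressive
`K`-context switch bounded run. -/
theorem progressive_iff_shallow_progressive (K : ℕ) (A : DCPS) :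
    (∃ rho : ℕ → DConfig, IsInfRunD A rho ∧ KBoundedD K rho ∧ ProgressiveD A K rho) ↔
    (∃ rho : ℕ → DConfig, IsInfRunD A rho ∧ KBoundedD K rho ∧ ProgressiveD A K rho ∧
      ShallowD rho) := by
  constructor
  · rintro ⟨rho, hrun, hK, hprog⟩
    obtain ⟨g, m, t, S, r, h⟩ := exists_macroRun hrun hK hprog
    obtain ⟨g', m', t', S', r', B, h', hB⟩ := h.exists_card_spawn_le
    exact h'.exists_shallow hB
  · rintro ⟨rho, hrun, hK, hprog, -⟩
    exact ⟨rho, hrun, hK, hprog⟩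


end CBL
end
end

section
/- A VASSB has an infinite progressive run from a given semiconfiguration if and only if it has a shallow infinite progressive run from that semiconfiguration. -/
/-!
Formalization of context-bounded liveness for dynamic networks of concurrent
pushdown systems (DCPS) and VASS with balloons (VASSB).
Global states, stack symbols, places, balloon states etc. are drawn from ℕ;
the finite components of the systems are recorded as `Finset`s.
-/

noncomputable section

namespace CBL

/-! ### VASS with balloons (VASSB) -/

/-- A vector in `ℕ^P` (finitely supported, places drawn from `ℕ`). -/
abbrev Vec : Type := ℕ →₀ ℕ

/-- A vector in `ℤ^P`. -/
abbrev ZVec : Type := ℕ →₀ ℤ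

/-- A balloon: a balloon state together with its contents, a vector over the
balloon places. -/
abbrev Balloon : Type := ℕ × Vec

/-- A representation of a semilinear subset of `ℕ^Φ`: a finite union of
linear sets, each given by a base vector and a list of period vectors. -/
abbrev SemilinRep : Type := List (Vec × List Vec)

/-- Membership in the semilinear set denoted by a representation. -/
def memSL (k : Vec) (L : SemilinRep) : Prop :=
  ∃ bp ∈ L, ∃ cs : List ℕ, cs.length = bp.2.length ∧
    k = bp.1 + (List.zipWith (fun (c : ℕ) (v : Vec) => c • v) cs bp.2).sum

/-- Operations labelling the edges of a VASSB. -/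
inductive VOp : Type where
  | delta : ZVec → VOp
  | inflate : ℕ → SemilinRep → VOp
  | deflate : ℕ → ℕ → ℕ → ℕ → VOp
  | burst : ℕ → VOp

/-- An edge of a VASSB: source state, operation, target state. -/
abbrev VEdge : Type := ℕ × VOp × ℕ

/-- A VASS with balloons `(Q, P, Ω, Φ, E)`. -/
structure VASSB where
  states : Finset ℕ
  places : Finset ℕ
  bstates : Finset ℕ
  bplaces : Finset ℕ
  edges : Finset VEdge

/-- A configuration `(q, m, n)` of a VASSB. -/
structure VConfig where
  q : ℕ
  m : Vec
  bag : Multiset Balloon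

/-- The effect of an operation on the places and the multiset of balloons. -/
def OpRel : VOp → Vec → Multiset Balloon → Vec → Multiset Balloon → Prop
  | .delta d, m, n, m', n' =>
      (∀ p, (m' p : ℤ) = (m p : ℤ) + d p) ∧ n' = n
  | .inflate s L, m, n, m', n' =>
      m' = m ∧ ∃ k : Vec, memSL k L ∧ n' = n + {(s, k)}
  | .deflate s s' pl p, m, n, m', n' =>
      ∃ (k : Vec) (n0 : Multiset Balloon),
        n = n0 + {(s, k)} ∧ m' = m + Finsupp.single p (k pl) ∧
        n' = n0 + {(s', Finsupp.erase pl k)}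
  | .burst s, m, n, m', n' =>
      m' = m ∧ ∃ (k : Vec) (n0 : Multiset Balloon), n = n0 + {(s, k)} ∧ n' = n0

/-- The step relation induced by the edge `e`. -/
def EdgeRel (e : VEdge) (c c' : VConfig) : Prop :=
  c.q = e.1 ∧ c'.q = e.2.2 ∧ OpRel e.2.1 c.m c.bag c'.m c'.bag

/-- One step of the VASSB `V`. -/
def VStep (V : VASSB) (c c' : VConfig) : Prop :=
  ∃ e ∈ V.edges, EdgeRel e c c'

/-- Reachability in a VASSB. -/
def VReach (V : VASSB) : VConfig → VConfig → Prop :=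
  Relation.ReflTransGen (VStep V)

/-- Semiconfigurations: configurations with no balloons. -/
def IsSemi (c : VConfig) : Prop := c.bag = 0

/-- An infinite run of the VASSB `V` from `c0`, given by its sequence of
configurations and the sequence of edges taken. -/
def IsInfRunV (V : VASSB) (c0 : VConfig) (rho : ℕ → VConfig) (es : ℕ → VEdge) : Prop :=
  rho 0 = c0 ∧ ∀ i, es i ∈ V.edges ∧ EdgeRel (es i) (rho i) (rho (i + 1))

/-- A finite run of length `n` of the VASSB `V` (the first `n` steps). -/
def IsFinRunV (V : VASSB) (n : ℕ) (rho : ℕ → VConfig) (es : ℕ → VEdge) : Prop :=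
  ∀ i < n, es i ∈ V.edges ∧ EdgeRel (es i) (rho i) (rho (i + 1))

/-- The step from `c` to `c'` via the edge `e` applies a deflate or a burst
operation to (an instance of) the balloon `b`. -/
def Touches (e : VEdge) (c c' : VConfig) (b : Balloon) : Prop :=
  (∃ (s' pl p : ℕ), e.2.1 = VOp.deflate b.1 s' pl p ∧
     ∃ n0, c.bag = n0 + {b} ∧ c'.bag = n0 + {(s', Finsupp.erase pl b.2)}) ∨
  (e.2.1 = VOp.burst b.1 ∧ ∃ n0, c.bag = n0 + {b} ∧ c'.bag = n0)

/-- A progressive infinite run: every balloon present in some configuration is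
deflated or burst at some later point, and every place carrying a token is
decremented by some later edge. -/
def ProgressiveV (V : VASSB) (c0 : VConfig) (rho : ℕ → VConfig) (es : ℕ → VEdge) : Prop :=
  IsInfRunV V c0 rho es ∧
  (∀ k, ∀ b ∈ (rho k).bag, ∃ j ≥ k, Touches (es j) (rho j) (rho (j + 1)) b) ∧
  (∀ k p, (rho k).m p ≠ 0 → ∃ j ≥ k, ∃ d : ZVec, (es j).2.1 = VOp.delta d ∧ d p < 0)

/-- `V` has an infinite progressive run from `c0`. -/
def HasProgRunV (V : VASSB) (c0 : VConfig) : Prop :=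
  ∃ rho es, ProgressiveV V c0 rho es

/-- A run of a VASSB is shallow if there is a bound `B` such that every
balloon inflated along the run contains at most `B` tokens. -/
def ShallowVRun (rho : ℕ → VConfig) (es : ℕ → VEdge) : Prop :=
  ∃ B, ∀ (i : ℕ) (s : ℕ) (L : SemilinRep) (k : Vec),
    (es i).2.1 = VOp.inflate s L →
    (rho (i + 1)).bag = (rho i).bag + {(s, k)} →
    (k.sum fun _ x => x) ≤ B

/-- A VASSB is zero-base if every linear set occurring in an inflate label of
one of its edges has base vector `0`. -/
def ZeroBase (V : VASSB) : Prop :=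
  ∀ e ∈ V.edges, ∀ (s : ℕ) (L : SemilinRep), e.2.1 = VOp.inflate s L →
    ∀ bp ∈ L, bp.1 = (0 : Vec)

/-- The operations that are applied to a balloon of the current multiset. -/
def VOp.IsTouch : VOp → Prop
  | .deflate _ _ _ _ => True
  | .burst _ => True
  | _ => False

theorem exists_touches {e : VEdge} {c c' : VConfig} (h : EdgeRel e c c') (ht : e.2.1.IsTouch) :
    ∃ b ∈ c.bag, Touches e c c' b := by
  obtain ⟨-, -, h⟩ := h
  unfold Touches
  revert h ht
  cases e.2.1 with
  | delta d => exact fun h => h.elim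
  | inflate s L => exact fun h => h.elim
  | deflate s s' pl p =>
    rintro - ⟨k, n0, h1, -, h3⟩
    exact ⟨(s, k), by simp [h1], Or.inl ⟨s', pl, p, rfl, n0, h1, h3⟩⟩
  | burst s =>
    rintro - ⟨-, k, n0, h1, h2⟩
    exact ⟨(s, k), by simp [h1], Or.inr ⟨rfl, n0, h1, h2⟩⟩

theorem Touches.deflate_spec {e : VEdge} {c c' : VConfig} {b : Balloon} {s s' pl p : ℕ}
    (hb : Touches e c c' b) (h : EdgeRel e c c') (he : e.2.1 = .deflate s s' pl p) :
    b.1 = s ∧ c'.m = c.m + Finsupp.single p (b.2 pl) ∧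
      ∃ n0, c.bag = n0 + {b} ∧ c'.bag = n0 + {(s', Finsupp.erase pl b.2)} := by
  obtain ⟨-, -, h⟩ := h
  rw [he] at h
  obtain ⟨k, n1, h1, h2, h3⟩ := h
  rcases hb with ⟨s'', pl', p', he', n0, h4, h5⟩ | ⟨he', -⟩
  · rw [he] at he'
    injection he' with e1 e2 e3 e4
    subst e1 e2 e3 e4
    refine ⟨rfl, ?_, n0, h4, h5⟩
    suffices hk : b.2 pl = k pl by rw [hk]; exact h2
    by_cases hbk : b = (b.1, k)
    · rw [hbk]
    · have hm : b ∈ n1 := by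
        have : b ∈ n1 + {(b.1, k)} := by rw [← h1, h4]; simp
        simpa [hbk] using this
      obtain ⟨n2, rfl⟩ := Multiset.exists_cons_of_mem hm
      have hn0 : n0 = (b.1, k) ::ₘ n2 := by
        have := h4.symm.trans h1
        rw [Multiset.add_comm, Multiset.singleton_add, Multiset.cons_add,
          Multiset.cons_inj_right] at this
        rw [this, Multiset.add_comm, Multiset.singleton_add]
      have h6 := h5.symm.trans h3
      rw [hn0, Multiset.cons_add, Multiset.cons_add, Multiset.add_comm n2, Multiset.add_comm n2,
        Multiset.singleton_add, Multiset.singleton_add] at h6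
      have h7 : b ∈ (b.1, k) ::ₘ (s', Finsupp.erase pl b.2) ::ₘ (0 : Multiset Balloon) ∧
          (b.1, k) ∈ b ::ₘ (s', Finsupp.erase pl k) ::ₘ (0 : Multiset Balloon) := by
        have h8 : (b.1, k) ::ₘ (s', Finsupp.erase pl b.2) ::ₘ (0 : Multiset Balloon) =
            b ::ₘ (s', Finsupp.erase pl k) ::ₘ (0 : Multiset Balloon) := by
          have := congrArg (fun n => n - n2) h6
          simpa [← Multiset.singleton_add, ← Multiset.add_assoc] using this
        exact ⟨by rw [h8]; simp, by rw [← h8]; simp⟩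
      have ha : b = (s', Finsupp.erase pl b.2) := by simpa [hbk] using h7.1
      have hc : (b.1, k) = (s', Finsupp.erase pl k) := by
        rcases Multiset.mem_cons.1 h7.2 with h | h
        · exact (hbk h.symm).elim
        · simpa using h
      have ha' := congrArg (fun x : Balloon => x.2 pl) ha
      have hc' := congrArg (fun x : Balloon => x.2 pl) hc
      simp only [Finsupp.erase_same] at ha' hc'
      rw [ha', hc']
  · rw [he] at he'
    cases he'

theorem Touches.burst_spec {e : VEdge} {c c' : VConfig} {b : Balloon} {s : ℕ}
    (hb : Touches e c c' b) (h : EdgeRel e c c') (he : e.2.1 = .burst s) :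
    b.1 = s ∧ c'.m = c.m ∧ ∃ n0, c.bag = n0 + {b} ∧ c'.bag = n0 := by
  obtain ⟨-, -, h⟩ := h
  rw [he] at h
  obtain ⟨h2, -⟩ := h
  rcases hb with ⟨s'', pl', p', he', -⟩ | ⟨he', n0, h4, h5⟩
  · rw [he] at he'
    cases he'
  · rw [he] at he'
    injection he' with e1
    exact ⟨e1.symm, h2, n0, h4, h5⟩

theorem Touches.isTouch {e : VEdge} {c c' : VConfig} {b : Balloon} (hb : Touches e c c' b) :
    e.2.1.IsTouch := by
  rcases hb with ⟨s'', pl', p', he', -⟩ | ⟨he', -⟩ <;> rw [he'] <;> trivial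

/-- A balloon stays in the multiset as long as it is not touched. -/
theorem EdgeRel.mem_bag {e : VEdge} {c c' : VConfig} (h : EdgeRel e c c') {b : Balloon}
    (hb : b ∈ c.bag) : b ∈ c'.bag ∨ Touches e c c' b := by
  obtain ⟨-, -, h⟩ := h
  unfold Touches
  revert h
  cases e.2.1 with
  | delta d => rintro ⟨-, h⟩; left; rwa [h]
  | inflate s L => rintro ⟨-, k, -, h⟩; left; rw [h]; simp [hb]
  | deflate s s' pl p =>
    rintro ⟨k, n0, h1, -, h3⟩
    by_cases hbk : b = (s, k)
    · right; left
      subst hbk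
      exact ⟨s', pl, p, rfl, n0, h1, h3⟩
    · left
      rw [h1] at hb
      rw [h3]
      have : b ∈ n0 := by simpa [hbk] using hb
      simp [this]
  | burst s =>
    rintro ⟨-, k, n0, h1, h2⟩
    by_cases hbk : b = (s, k)
    · right; right
      subst hbk
      exact ⟨rfl, n0, h1, h2⟩
    · left
      rw [h1] at hb
      rw [h2]
      simpa [hbk] using hb

theorem mem_bag_of_not_touches {rho : ℕ → VConfig} {es : ℕ → VEdge} {k n : ℕ} (hkn : k ≤ n)
    (hrun : ∀ t, k ≤ t → t < n → EdgeRel (es t) (rho t) (rho (t + 1))) {b : Balloon}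
    (hb : b ∈ (rho k).bag)
    (hnt : ∀ t, k ≤ t → t < n → ¬ Touches (es t) (rho t) (rho (t + 1)) b) : b ∈ (rho n).bag := by
  induction n, hkn using Nat.le_induction with
  | base => exact hb
  | succ n hkn ih =>
    have := ih (fun t h1 h2 => hrun t h1 (by omega)) (fun t h1 h2 => hnt t h1 (by omega))
    exact ((hrun n hkn (by omega)).mem_bag this).resolve_right (hnt n hkn (by omega))

/-- One step of a run whose balloons carry names: `A` is the set of names in use, `v` gives the
balloon of each name, `x` is the name of the balloon that is touched, and a newly inflated
balloon is named after the time `t` of its inflation. -/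
def LStep (t x : ℕ) : VOp → Vec → Vec → Finset ℕ → Finset ℕ → (ℕ → Balloon) → (ℕ → Balloon) → Prop
  | .delta d, m, m', A, A', v, v' => (∀ p, (m' p : ℤ) = (m p : ℤ) + d p) ∧ A' = A ∧ v' = v
  | .inflate s L, m, m', A, A', v, v' =>
      m' = m ∧ ∃ k, memSL k L ∧ A' = insert t A ∧ v' = Function.update v t (s, k)
  | .deflate s s' pl p, m, m', A, A', v, v' =>
      x ∈ A ∧ (v x).1 = s ∧ m' = m + Finsupp.single p ((v x).2 pl) ∧ A' = A ∧
        v' = Function.update v x (s', Finsupp.erase pl (v x).2)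
  | .burst s, m, m', A, A', v, v' => x ∈ A ∧ (v x).1 = s ∧ m' = m ∧ A' = A.erase x ∧ v' = v

/-- A naming of the balloons along a run such that every balloon is touched again and again. -/
structure LRun (rho : ℕ → VConfig) (es : ℕ → VEdge) where
  A : ℕ → Finset ℕ
  val : ℕ → ℕ → Balloon
  tgt : ℕ → ℕ
  A_lt : ∀ t, ∀ x ∈ A t, x < t
  bag : ∀ t, (rho t).bag = (A t).val.map (val t)
  step : ∀ t, LStep t (tgt t) (es t).2.1 (rho t).m (rho (t + 1)).m (A t) (A (t + 1))
    (val t) (val (t + 1))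
  fair : ∀ t, ∀ x ∈ A t, ∃ j ≥ t, (es j).2.1.IsTouch ∧ tgt j = x

theorem map_update_of_notMem {A : Finset ℕ} {v : ℕ → Balloon} {x : ℕ} {b : Balloon}
    (hx : x ∉ A) : A.val.map (Function.update v x b) = A.val.map v := by
  refine Multiset.map_congr rfl fun y hy => ?_
  rw [Function.update_of_ne]
  rintro rfl
  exact hx hy

theorem map_eq_erase_add {A : Finset ℕ} {v : ℕ → Balloon} {x : ℕ} (hx : x ∈ A) :
    A.val.map v = (A.erase x).val.map v + {v x} := by
  conv_lhs => rw [← Finset.insert_erase hx]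
  rw [Finset.insert_val_of_notMem (Finset.notMem_erase x A), Multiset.map_cons,
    Multiset.add_comm, Multiset.singleton_add]

theorem map_update_of_mem {A : Finset ℕ} {v : ℕ → Balloon} {x : ℕ} {b : Balloon} (hx : x ∈ A) :
    A.val.map (Function.update v x b) = (A.erase x).val.map v + {b} := by
  rw [map_eq_erase_add hx, map_update_of_notMem (Finset.notMem_erase x A), Function.update_self]

/-- Given a naming of the balloons before a step, the step can be followed by the naming, and the
touched balloon can be chosen to be the one whose last access is longest ago. -/
theorem exists_lstep {e : VEdge} {c c' : VConfig} (h : EdgeRel e c c') (t : ℕ)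
    (A : Finset ℕ) (v : ℕ → Balloon) (last : ℕ → ℕ) (hbag : c.bag = A.val.map v)
    (hA : ∀ x ∈ A, x < t) :
    ∃ (A' : Finset ℕ) (v' : ℕ → Balloon) (x : ℕ), c'.bag = A'.val.map v' ∧
      (∀ y ∈ A', y < t + 1) ∧ LStep t x e.2.1 c.m c'.m A A' v v' ∧
      (e.2.1.IsTouch → x ∈ A ∧ ∀ y ∈ A, Touches e c c' (v y) → last x ≤ last y) := by
  classical
  have hA' : ∀ x ∈ A, x < t + 1 := fun x hx => (hA x hx).trans (Nat.lt_succ_self t)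
  have htA : t ∉ A := fun ht => lt_irrefl t (hA t ht)
  by_cases htouch : e.2.1.IsTouch
  · obtain ⟨b, hb, hbt⟩ := exists_touches h htouch
    obtain ⟨y, hy, rfl⟩ : ∃ y ∈ A, v y = b := by simpa [hbag] using hb
    obtain ⟨x, hx, hmin⟩ := Finset.exists_min_image (A.filter fun y => Touches e c c' (v y)) last
      ⟨y, by simp [hy, hbt]⟩
    obtain ⟨hxA, hxt⟩ := Finset.mem_filter.1 hx
    have hmin' : x ∈ A ∧ ∀ y ∈ A, Touches e c c' (v y) → last x ≤ last y :=
      ⟨hxA, fun y hy hyt => hmin y (by simp [hy, hyt])⟩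
    cases he : e.2.1 with
    | delta d => rw [he] at htouch; exact htouch.elim
    | inflate s L => rw [he] at htouch; exact htouch.elim
    | deflate s s' pl p =>
      obtain ⟨h1, h2, n0, h3, h4⟩ := hxt.deflate_spec h he
      refine ⟨A, _, x, ?_, hA', ⟨hxA, h1, h2, rfl, rfl⟩, fun _ => hmin'⟩
      rw [map_update_of_mem hxA, h4]
      rw [hbag, map_eq_erase_add hxA] at h3
      rw [add_right_cancel h3]
    | burst s =>
      obtain ⟨h1, h2, n0, h3, h4⟩ := hxt.burst_spec h he
      refine ⟨A.erase x, v, x, ?_, fun y hy => hA' y (Finset.mem_of_mem_erase hy),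
        ⟨hxA, h1, h2, rfl, rfl⟩, fun _ => hmin'⟩
      rw [hbag, map_eq_erase_add hxA] at h3
      rw [h4, add_right_cancel h3]
  · obtain ⟨-, -, h⟩ := h
    cases he : e.2.1 with
    | delta d =>
      rw [he] at h
      exact ⟨A, v, 0, by rw [h.2, hbag], hA', ⟨h.1, rfl, rfl⟩, fun h => h.elim⟩
    | inflate s L =>
      rw [he] at h
      obtain ⟨h1, k, h2, h3⟩ := h
      refine ⟨insert t A, _, 0, ?_, ?_, ⟨h1, k, h2, rfl, rfl⟩, fun h => h.elim⟩
      · rw [map_update_of_mem (Finset.mem_insert_self t A), Finset.erase_insert htA, h3, hbag]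
      · intro y hy
        rcases Finset.mem_insert.1 hy with rfl | hy
        · exact Nat.lt_succ_self y
        · exact hA' y hy
    | deflate s s' pl p => rw [he] at htouch; exact (htouch trivial).elim
    | burst s => rw [he] at htouch; exact (htouch trivial).elim

/-- A name that is in use and is not touched by a step keeps its balloon. -/
theorem LStep.keep {t x : ℕ} {op : VOp} {m m' : Vec} {A A' : Finset ℕ} {v v' : ℕ → Balloon}
    (h : LStep t x op m m' A A' v v') (htA : t ∉ A) {y : ℕ} (hy : y ∈ A)
    (hxy : op.IsTouch → x ≠ y) : y ∈ A' ∧ v' y = v y := by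
  have hty : y ≠ t := fun h => htA (h ▸ hy)
  cases op with
  | delta d => obtain ⟨-, rfl, rfl⟩ := h; exact ⟨hy, rfl⟩
  | inflate s L =>
    obtain ⟨-, k, -, rfl, rfl⟩ := h
    exact ⟨Finset.mem_insert_of_mem hy, Function.update_of_ne hty _ _⟩
  | deflate s s' pl p =>
    obtain ⟨-, -, -, rfl, rfl⟩ := h
    exact ⟨hy, Function.update_of_ne (hxy trivial).symm _ _⟩
  | burst s =>
    obtain ⟨-, -, -, rfl, rfl⟩ := h
    exact ⟨Finset.mem_erase.2 ⟨(hxy trivial).symm, hy⟩, rfl⟩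

/-- Names come into use only at the time of their inflation. -/
theorem LStep.mem_of_mem {t x : ℕ} {op : VOp} {m m' : Vec} {A A' : Finset ℕ} {v v' : ℕ → Balloon}
    (h : LStep t x op m m' A A' v v') {y : ℕ} (hy : y ∈ A') (hyt : y ≠ t) : y ∈ A := by
  cases op with
  | delta d => obtain ⟨-, rfl, rfl⟩ := h; exact hy
  | inflate s L =>
    obtain ⟨-, k, -, rfl, rfl⟩ := h
    exact Finset.mem_of_mem_insert_of_ne hy hyt
  | deflate s s' pl p => obtain ⟨-, -, -, rfl, rfl⟩ := h; exact hy
  | burst s => obtain ⟨-, -, -, rfl, rfl⟩ := h; exact Finset.mem_of_mem_erase hy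

open scoped Classical in
theorem exists_lrun {V : VASSB} {c0 : VConfig} {rho : ℕ → VConfig} {es : ℕ → VEdge}
    (hrun : ProgressiveV V c0 rho es) (hs : IsSemi c0) : Nonempty (LRun rho es) := by
  obtain ⟨⟨h0, hstep⟩, hprog, -⟩ := hrun
  let St := Finset ℕ × (ℕ → Balloon) × (ℕ → ℕ)
  let Ok : ℕ → St → Prop := fun t S => (rho t).bag = S.1.val.map S.2.1 ∧ (∀ x ∈ S.1, x < t) ∧
    ∀ x, S.2.2 x ≤ t
  let Next : ℕ → ℕ → St → St → Prop := fun t x S S' =>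
    LStep t x (es t).2.1 (rho t).m (rho (t + 1)).m S.1 S'.1 S.2.1 S'.2.1 ∧
    S'.2.2 = Function.update S.2.2 (if (es t).2.1.IsTouch then x else t) (t + 1) ∧
    ((es t).2.1.IsTouch → x ∈ S.1 ∧
      ∀ y ∈ S.1, Touches (es t) (rho t) (rho (t + 1)) (S.2.1 y) → S.2.2 x ≤ S.2.2 y)
  have key : ∀ t (S : {S // Ok t S}), ∃ (S' : {S // Ok (t + 1) S}) (x : ℕ),
      Next t x S.1 S'.1 := by
    rintro t ⟨⟨A, v, last⟩, h1, h2, h3⟩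
    obtain ⟨A', v', x, h4, h5, h6, h7⟩ := exists_lstep (hstep t).2 t A v last h1 h2
    refine ⟨⟨⟨A', v', Function.update last (if (es t).2.1.IsTouch then x else t) (t + 1)⟩,
      h4, h5, fun y => ?_⟩, x, h6, rfl, h7⟩
    simp only [Function.update_apply]
    have := (h3 y).trans (Nat.le_succ t)
    split_ifs <;> first | exact le_rfl | exact this
  choose nxt tg hnxt using key
  have hOk0 : Ok 0 (∅, fun _ => (0, 0), fun _ => 0) := by
    refine ⟨?_, by simp, by simp⟩
    rw [h0]
    simpa [IsSemi] using hs
  let f : (t : ℕ) → {S // Ok t S} := fun t => Nat.rec ⟨_, hOk0⟩ (fun t S => nxt t S) t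
  have hf : ∀ t, Next t (tg t (f t)) (f t).1 (f (t + 1)).1 := fun t => hnxt t (f t)
  refine ⟨⟨fun t => (f t).1.1, fun t => (f t).1.2.1, fun t => tg t (f t), fun t => (f t).2.2.1,
    fun t => (f t).2.1, fun t => (hf t).1, ?_⟩⟩
  intro t x hx
  by_contra! hcon
  have hnot : ∀ j, t ≤ j → (es j).2.1.IsTouch → tg j (f j) ≠ x := fun j hj h => hcon j hj h
  have hlt : ∀ j, j ∉ (f j).1.1 := fun j hj => lt_irrefl j ((f j).2.2.1 j hj)
  have hkeep : ∀ j, t ≤ j → x ∈ (f j).1.1 ∧ (f j).1.2.1 x = (f t).1.2.1 x ∧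
      (f j).1.2.2 x = (f t).1.2.2 x := by
    intro j hj
    induction j, hj using Nat.le_induction with
    | base => exact ⟨hx, rfl, rfl⟩
    | succ j hj ih =>
      obtain ⟨h1, h2⟩ := (hf j).1.keep (hlt j) ih.1 (hnot j hj)
      refine ⟨h1, h2.trans ih.2.1, ?_⟩
      rw [(hf j).2.1, Function.update_of_ne, ih.2.2]
      split_ifs with h
      · exact (hnot j hj h).symm
      · rintro rfl
        exact hlt _ ih.1
  set l := (f t).1.2.2 x with hl
  have hlt' : l ≤ t := (f t).2.2.2 x
  let M : ℕ → Finset ℕ := fun j => (f j).1.1.filter fun y => (f j).1.2.2 y ≤ l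
  have hM : ∀ j, t ≤ j → M (j + 1) ⊆ M j ∧
      ((es j).2.1.IsTouch → tg j (f j) ∉ M (j + 1)) := by
    intro j hj
    have hup : ∀ y, y ∈ M (j + 1) → y ≠ if (es j).2.1.IsTouch then tg j (f j) else j := by
      rintro y hy rfl
      have := (Finset.mem_filter.1 hy).2
      rw [(hf j).2.1, Function.update_self] at this
      omega
    refine ⟨fun y hy => ?_, fun h hm => hup _ hm (by rw [if_pos h])⟩
    have hne := hup y hy
    obtain ⟨h1, h2⟩ := Finset.mem_filter.1 hy
    rw [(hf j).2.1, Function.update_of_ne hne] at h2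
    refine Finset.mem_filter.2 ⟨?_, h2⟩
    by_cases hyj : y = j
    · subst hyj
      by_contra hyA
      have hst := (hf y).1
      have : (es y).2.1.IsTouch := by
        by_contra hn
        exact hne (by rw [if_neg hn])
      revert this hst h1
      cases (es y).2.1 with
      | delta d => exact fun _ _ h => h.elim
      | inflate s L => exact fun _ _ h => h.elim
      | deflate s s' pl p =>
        rintro h1 ⟨-, -, -, h, -⟩ -
        exact hyA (h ▸ h1)
      | burst s =>
        rintro h1 ⟨-, -, -, h, -⟩ -
        rw [h] at h1
        exact hyA (Finset.mem_of_mem_erase h1)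
    · exact (hf j).1.mem_of_mem h1 hyj
  have hMmono : ∀ j j', t ≤ j → j ≤ j' → M j' ⊆ M j := by
    intro j j' hj hjj'
    induction j', hjj' using Nat.le_induction with
    | base => exact subset_rfl
    | succ j' hjj' ih => exact (hM j' (hj.trans hjj')).1.trans ih
  have hfin : ∀ n j, t ≤ j → (M j).card = n → False := by
    intro n
    induction n using Nat.strong_induction_on with
    | _ n ih =>
      intro j hj hn
      have hxj := hkeep j hj
      have hb : (f j).1.2.1 x ∈ (rho j).bag := by
        rw [(f j).2.1]
        exact Multiset.mem_map_of_mem _ hxj.1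
      obtain ⟨j', hj', htj⟩ := hprog j _ hb
      have hxj' := hkeep j' (hj.trans hj')
      rw [hxj.2.1, ← hxj'.2.1] at htj
      have hz := (hf j').2.2 htj.isTouch
      have hzM : tg j' (f j') ∈ M j' :=
        Finset.mem_filter.2 ⟨hz.1, (hz.2 x hxj'.1 htj).trans hxj'.2.2.le⟩
      have hlt2 : (M (j' + 1)).card < (M j').card := by
        refine Finset.card_lt_card ⟨(hM j' (hj.trans hj')).1, fun hsub => ?_⟩
        exact (hM j' (hj.trans hj')).2 htj.isTouch (hsub hzM)
      have hle : (M j').card ≤ (M j).card := Finset.card_le_card (hMmono j j' hj hj')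
      exact ih _ (by omega) (j' + 1) (by omega) rfl
  exact hfin _ t le_rfl rfl

/-- `w` is an `ℕ`-linear combination of the vectors in `ps`. -/
def IsPer (ps : List Vec) (w : Vec) : Prop :=
  ∃ cs : List ℕ, cs.length = ps.length ∧
    w = (List.zipWith (fun (c : ℕ) (v : Vec) => c • v) cs ps).sum

theorem isPer_nil_iff {w : Vec} : IsPer [] w ↔ w = 0 := by
  constructor
  · rintro ⟨cs, h, rfl⟩
    simp
  · rintro rfl
    exact ⟨[], rfl, by simp⟩

theorem isPer_cons_iff {v : Vec} {ps : List Vec} {w : Vec} :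
    IsPer (v :: ps) w ↔ ∃ (c : ℕ) (u : Vec), IsPer ps u ∧ w = c • v + u := by
  constructor
  · rintro ⟨cs, h, rfl⟩
    cases cs with
    | nil => simp at h
    | cons c cs => exact ⟨c, _, ⟨cs, by simpa using h, rfl⟩, by simp⟩
  · rintro ⟨c, u, ⟨cs, h, rfl⟩, rfl⟩
    exact ⟨c :: cs, by simpa using h, by simp⟩

theorem IsPer.zero (ps : List Vec) : IsPer ps 0 := by
  induction ps with
  | nil => exact isPer_nil_iff.2 rfl
  | cons v ps ih => exact isPer_cons_iff.2 ⟨0, 0, ih, by simp⟩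

theorem IsPer.add {ps : List Vec} {w w' : Vec} (h : IsPer ps w) (h' : IsPer ps w') :
    IsPer ps (w + w') := by
  induction ps generalizing w w' with
  | nil =>
    rw [isPer_nil_iff] at *
    simp [h, h']
  | cons v ps ih =>
    rw [isPer_cons_iff] at *
    obtain ⟨c, u, hu, rfl⟩ := h
    obtain ⟨c', u', hu', rfl⟩ := h'
    refine ⟨c + c', u + u', ih hu hu', ?_⟩
    rw [add_smul]
    abel

theorem IsPer.sum {ι : Type*} {ps : List Vec} {s : Finset ι} {f : ι → Vec}
    (h : ∀ x ∈ s, IsPer ps (f x)) : IsPer ps (∑ x ∈ s, f x) :=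
  Finset.sum_induction f (IsPer ps) (fun _ _ => IsPer.add) (IsPer.zero ps) h

/-- The pairs of a balloon place and a place that occur in deflate operations. -/
def VASSB.transfers (V : VASSB) : Finset (ℕ × ℕ) :=
  V.edges.image fun e => match e.2.1 with
    | .deflate _ _ pl p => (pl, p)
    | _ => (0, 0)

namespace LRun

variable {rho : ℕ → VConfig} {es : ℕ → VEdge}

/-- At time `t`, the balloon `x` is deflated from `pl` into `p`. -/
def Defl (R : LRun rho es) (t x pl p : ℕ) : Prop :=
  (∃ s s', (es t).2.1 = .deflate s s' pl p) ∧ R.tgt t = x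

/-- At time `t`, the balloon place `pl` of `x` is deflated for the first time, into `p`. -/
def First (R : LRun rho es) (t x pl p : ℕ) : Prop :=
  R.Defl t x pl p ∧ ∀ u < t, ∀ p', ¬ R.Defl u x pl p'

/-- The initial contents of the balloon inflated at time `x`. -/
def init (R : LRun rho es) (x : ℕ) : Vec := (R.val (x + 1) x).2

open scoped Classical in
/-- The transfers of the balloon `x` that take place before time `t`. -/
def done (R : LRun rho es) (V : VASSB) (t x : ℕ) : Finset (ℕ × ℕ) :=
  V.transfers.filter fun a => ∃ u < t, R.First u x a.1 a.2

open scoped Classical in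
/-- All transfers of the balloon `x`. -/
def pairs (R : LRun rho es) (V : VASSB) (x : ℕ) : Finset (ℕ × ℕ) :=
  V.transfers.filter fun a => ∃ u, R.First u x a.1 a.2

variable {R : LRun rho es} {V : VASSB}

theorem notMem_A (R : LRun rho es) (t : ℕ) : t ∉ R.A t := fun h => lt_irrefl t (R.A_lt t t h)

theorem Defl.mem {t x pl p : ℕ} (h : R.Defl t x pl p) : x ∈ R.A t := by
  obtain ⟨⟨s, s', he⟩, rfl⟩ := h
  have := R.step t
  rw [he] at this
  exact this.1

theorem Defl.eq {t x pl p p' : ℕ} (h : R.Defl t x pl p) (h' : R.Defl t x pl p') : p = p' := by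
  obtain ⟨⟨s, s', he⟩, -⟩ := h
  obtain ⟨⟨u, u', he'⟩, -⟩ := h'
  rw [he] at he'
  injection he'

theorem Defl.exists_first {t x pl p : ℕ} (h : R.Defl t x pl p) :
    ∃ u ≤ t, ∃ p', R.First u x pl p' := by
  induction t using Nat.strong_induction_on generalizing p with
  | _ t ih =>
    by_cases hu : ∃ u < t, ∃ p', R.Defl u x pl p'
    · obtain ⟨u, hut, p', hu⟩ := hu
      obtain ⟨u', h1, h2⟩ := ih u hut hu
      exact ⟨u', h1.trans hut.le, h2⟩
    · push Not at hu
      exact ⟨t, le_rfl, p, h, hu⟩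

theorem First.eq {t t' x pl p p' : ℕ} (h : R.First t x pl p) (h' : R.First t' x pl p') :
    t = t' ∧ p = p' := by
  have ht : t = t' := by
    rcases lt_trichotomy t t' with hlt | heq | hlt
    · exact (h'.2 t hlt p h.1).elim
    · exact heq
    · exact (h.2 t' hlt p' h'.1).elim
  subst ht
  exact ⟨rfl, h.1.eq h'.1⟩

theorem First.mem_transfers (hE : ∀ t, es t ∈ V.edges) {t x pl p : ℕ} (h : R.First t x pl p) :
    (pl, p) ∈ V.transfers := by
  obtain ⟨⟨⟨s, s', he⟩, -⟩, -⟩ := h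
  exact Finset.mem_image.2 ⟨es t, hE t, by rw [he]⟩

theorem mem_done (hE : ∀ t, es t ∈ V.edges) {t x : ℕ} {a : ℕ × ℕ} :
    a ∈ R.done V t x ↔ ∃ u < t, R.First u x a.1 a.2 := by
  classical
  simp only [done, Finset.mem_filter, and_iff_right_iff_imp]
  rintro ⟨u, -, h⟩
  exact h.mem_transfers hE

theorem mem_pairs (hE : ∀ t, es t ∈ V.edges) {x : ℕ} {a : ℕ × ℕ} :
    a ∈ R.pairs V x ↔ ∃ u, R.First u x a.1 a.2 := by
  classical
  simp only [pairs, Finset.mem_filter, and_iff_right_iff_imp]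
  rintro ⟨u, h⟩
  exact h.mem_transfers hE

theorem done_subset_pairs (hE : ∀ t, es t ∈ V.edges) (t x : ℕ) :
    R.done V t x ⊆ R.pairs V x := by
  intro a ha
  obtain ⟨u, -, h⟩ := (mem_done hE).1 ha
  exact (mem_pairs hE).2 ⟨u, h⟩

theorem done_mono (hE : ∀ t, es t ∈ V.edges) {t t' : ℕ} (h : t ≤ t') (x : ℕ) :
    R.done V t x ⊆ R.done V t' x := by
  intro a ha
  obtain ⟨u, hu, h'⟩ := (mem_done hE).1 ha
  exact (mem_done hE).2 ⟨u, hu.trans_le h, h'⟩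

theorem done_of_le (hE : ∀ t, es t ∈ V.edges) {t x : ℕ} (h : t ≤ x + 1) : R.done V t x = ∅ := by
  rw [Finset.eq_empty_iff_forall_notMem]
  intro a ha
  obtain ⟨u, hu, h'⟩ := (mem_done hE).1 ha
  have := R.A_lt u x h'.1.mem
  omega

theorem exists_done_eq (hE : ∀ t, es t ∈ V.edges) (R : LRun rho es) (x : ℕ) :
    ∃ T, ∀ t ≥ T, R.done V t x = R.pairs V x := by
  have : ∀ a ∈ R.pairs V x, ∃ u, R.First u x a.1 a.2 := fun a ha => (mem_pairs hE).1 ha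
  choose! u hu using this
  refine ⟨(R.pairs V x).sup u + 1, fun t ht => ?_⟩
  refine (done_subset_pairs hE t x).antisymm fun a ha => (mem_done hE).2 ⟨u a, ?_, hu a ha⟩
  have := Finset.le_sup (f := u) ha
  omega

theorem done_succ_of_first (hE : ∀ t, es t ∈ V.edges) {t x pl p : ℕ} (h : R.First t x pl p) :
    R.done V (t + 1) x = insert (pl, p) (R.done V t x) ∧ (pl, p) ∉ R.done V t x := by
  constructor
  · ext a
    rw [Finset.mem_insert, mem_done hE, mem_done hE]
    constructor
    · rintro ⟨u, hu, h'⟩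
      rcases Nat.lt_succ_iff_lt_or_eq.1 hu with hu | rfl
      · exact Or.inr ⟨u, hu, h'⟩
      · left
        obtain ⟨⟨⟨s, s', he⟩, -⟩, -⟩ := h
        obtain ⟨⟨⟨r, r', he'⟩, -⟩, -⟩ := h'
        rw [he] at he'
        injection he' with e1 e2 e3 e4
        rw [e3, e4]
    · rintro (rfl | ⟨u, hu, h'⟩)
      · exact ⟨t, Nat.lt_succ_self t, h⟩
      · exact ⟨u, hu.trans (Nat.lt_succ_self t), h'⟩
  · intro hm
    obtain ⟨u, hu, h'⟩ := (mem_done hE).1 hm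
    exact hu.ne (h'.eq h).1

theorem done_succ_of_not_first (hE : ∀ t, es t ∈ V.edges) {t x : ℕ}
    (h : ∀ pl p, ¬ R.First t x pl p) : R.done V (t + 1) x = R.done V t x := by
  refine Finset.Subset.antisymm (fun a ha => ?_) (done_mono hE (Nat.le_succ t) x)
  obtain ⟨u, hu, h'⟩ := (mem_done hE).1 ha
  rcases Nat.lt_succ_iff_lt_or_eq.1 hu with hu | rfl
  · exact (mem_done hE).2 ⟨u, hu, h'⟩
  · exact (h _ _ h').elim

theorem pairs_functional (hE : ∀ t, es t ∈ V.edges) {x pl p p' : ℕ} (h : (pl, p) ∈ R.pairs V x)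
    (h' : (pl, p') ∈ R.pairs V x) : p = p' := by
  obtain ⟨u, hu⟩ := (mem_pairs hE).1 h
  obtain ⟨u', hu'⟩ := (mem_pairs hE).1 h'
  exact (hu.eq hu').2

theorem contents {t x : ℕ} (hx : x ∈ R.A t) (pl : ℕ) :
    ((∃ u < t, ∃ p, R.Defl u x pl p) → (R.val t x).2 pl = 0) ∧
      ((∀ u < t, ∀ p, ¬ R.Defl u x pl p) → (R.val t x).2 pl = R.init x pl) := by
  induction t with
  | zero => exact absurd (R.A_lt 0 x hx) (Nat.not_lt_zero x)
  | succ t ih =>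
    by_cases hxt : x = t
    · subst hxt
      refine ⟨?_, fun _ => rfl⟩
      rintro ⟨u, hu, p, h⟩
      have := R.A_lt u x h.mem
      omega
    have hst := R.step t
    have hxA := hst.mem_of_mem hx hxt
    obtain ⟨ih1, ih2⟩ := ih hxA
    by_cases htouch : (es t).2.1.IsTouch ∧ R.tgt t = x
    · obtain ⟨h1, rfl⟩ := htouch
      cases he : (es t).2.1 with
      | delta d => rw [he] at h1; exact h1.elim
      | inflate s L => rw [he] at h1; exact h1.elim
      | burst s =>
        rw [he] at hst
        obtain ⟨-, -, -, h, -⟩ := hst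
        rw [h] at hx
        exact absurd hx (Finset.notMem_erase _ _)
      | deflate s s' pl' p =>
        rw [he] at hst
        obtain ⟨-, -, -, -, h⟩ := hst
        have hd : R.Defl t (R.tgt t) pl' p := ⟨⟨s, s', he⟩, rfl⟩
        rw [h, Function.update_self]
        by_cases hpl : pl = pl'
        · subst hpl
          exact ⟨fun _ => Finsupp.erase_same, fun hn => (hn t (Nat.lt_succ_self t) p hd).elim⟩
        · rw [Finsupp.erase_ne hpl]
          refine ⟨?_, fun hn => ih2 fun u hu => hn u (hu.trans (Nat.lt_succ_self t))⟩
          rintro ⟨u, hu, p', h'⟩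
          rcases Nat.lt_succ_iff_lt_or_eq.1 hu with hu | rfl
          · exact ih1 ⟨u, hu, p', h'⟩
          · obtain ⟨⟨r, r', he'⟩, -⟩ := h'
            rw [he] at he'
            injection he' with _ _ e
            exact (hpl e.symm).elim
    · rw [(hst.keep (R.notMem_A t) hxA fun h h' => htouch ⟨h, h'⟩).2]
      refine ⟨?_, fun hn => ih2 fun u hu => hn u (hu.trans (Nat.lt_succ_self t))⟩
      rintro ⟨u, hu, p', h'⟩
      rcases Nat.lt_succ_iff_lt_or_eq.1 hu with hu | rfl
      · exact ih1 ⟨u, hu, p', h'⟩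
      · obtain ⟨⟨r, r', he'⟩, h'⟩ := h'
        exact (htouch ⟨by rw [he']; trivial, h'⟩).elim

/-- What the balloon `x` with initial contents `w` transfers before time `t`. -/
def got (R : LRun rho es) (V : VASSB) (t x : ℕ) (w : Vec) : Vec :=
  ∑ a ∈ R.done V t x, Finsupp.single a.2 (w a.1)

/-- What the balloon `x` with initial contents `w` transfers in total. -/
def tot (R : LRun rho es) (V : VASSB) (x : ℕ) (w : Vec) : Vec :=
  ∑ a ∈ R.pairs V x, Finsupp.single a.2 (w a.1)

theorem got_le_tot (hE : ∀ t, es t ∈ V.edges) (t x : ℕ) (w : Vec) :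
    R.got V t x w ≤ R.tot V x w :=
  Finset.sum_le_sum_of_subset (done_subset_pairs hE t x)

theorem got_succ_of_first (hE : ∀ t, es t ∈ V.edges) {t x pl p : ℕ} (h : R.First t x pl p)
    (w : Vec) : R.got V (t + 1) x w = R.got V t x w + Finsupp.single p (w pl) := by
  obtain ⟨h1, h2⟩ := done_succ_of_first hE h
  rw [got, got, h1, Finset.sum_insert h2, add_comm]

theorem got_succ_of_not_first (hE : ∀ t, es t ∈ V.edges) {t x : ℕ}
    (h : ∀ pl p, ¬ R.First t x pl p) (w : Vec) : R.got V (t + 1) x w = R.got V t x w := by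
  rw [got, got, done_succ_of_not_first hE h]

theorem sum_got_succ_of_first (hE : ∀ t, es t ∈ V.edges) {t z pl p : ℕ} (h : R.First t z pl p)
    (S : Finset ℕ) (Y : ℕ → ℕ) (w : ℕ → Vec) :
    ∑ x ∈ S, R.got V (t + 1) (Y x) (w x) = ∑ x ∈ S, R.got V t (Y x) (w x) +
      Finsupp.single p ((∑ x ∈ S.filter (fun x => Y x = z), w x) pl) := by
  have h1 : ∀ x ∈ S, R.got V (t + 1) (Y x) (w x) = R.got V t (Y x) (w x) +
      if Y x = z then Finsupp.single p (w x pl) else 0 := by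
    intro x _
    split_ifs with hx
    · rw [hx, got_succ_of_first hE h]
    · rw [got_succ_of_not_first hE, add_zero]
      intro pl' p' h'
      exact hx (h'.1.2.symm.trans h.1.2)
  rw [Finset.sum_congr rfl h1, Finset.sum_add_distrib, ← Finset.sum_filter]
  congr 1
  rw [Finsupp.finsetSum_apply]
  exact (map_sum (Finsupp.singleAddHom p) _ _).symm

end LRun

/-- The data for pumping a run from time `i` on. The part `per x` of the initial contents of each
balloon `x ∈ S` is handed to the balloon `Y x`, which is inflated after time `i` and makes
the same transfers as `x`. No tokens occur outside of `G` after time `i`. -/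
structure Surgery (V : VASSB) {rho : ℕ → VConfig} {es : ℕ → VEdge} (R : LRun rho es) where
  i : ℕ
  G : Finset ℕ
  S : Finset ℕ
  Y : ℕ → ℕ
  per : ℕ → Vec
  bp : ℕ → Vec × List Vec
  mem_edges : ∀ t, es t ∈ V.edges
  source : ∀ t, (rho t).q = (es t).1
  target : ∀ t, (rho (t + 1)).q = (es t).2.2
  places : ∀ t ≥ i, ∀ p ∉ G, (rho t).m p = 0
  le_Y : ∀ x ∈ S, i ≤ Y x
  bp_Y : ∀ x ∈ S, bp (Y x) = bp x
  pairs_Y : ∀ x ∈ S, R.pairs V (Y x) = R.pairs V x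
  per_eq_zero : ∀ x ∈ S, ∀ a ∈ R.pairs V x, a.2 ∉ G → per x a.1 = 0
  init_eq_zero : ∀ t ≥ i, ∀ a ∈ R.pairs V t, a.2 ∉ G → R.init t a.1 = 0
  inflate : ∀ x s L, (es x).2.1 = .inflate s L →
    bp x ∈ L ∧ IsPer (bp x).2 (per x) ∧ R.init x = (bp x).1 + per x
  isPer : ∀ x ∈ S, IsPer (bp x).2 (per x)

namespace Surgery

variable {rho : ℕ → VConfig} {es : ℕ → VEdge} {R : LRun rho es} {V : VASSB}

/-- The additional contents of the balloon `y`. -/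
def extra (Z : Surgery V R) (y : ℕ) : Vec := ∑ x ∈ Z.S.filter (fun x => Z.Y x = y), Z.per x

theorem extra_of_lt (Z : Surgery V R) {y : ℕ} (hy : y < Z.i) : Z.extra y = 0 := by
  rw [extra, Finset.filter_false_of_mem, Finset.sum_empty]
  rintro x hx rfl
  exact absurd (Z.le_Y x hx) (not_le.2 hy)

theorem extra_eq_zero (Z : Surgery V R) (y : ℕ) (a : ℕ × ℕ) (ha : a ∈ R.pairs V y)
    (hG : a.2 ∉ Z.G) : Z.extra y a.1 = 0 := by
  rw [extra, Finsupp.finsetSum_apply]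
  refine Finset.sum_eq_zero fun x hx => ?_
  obtain ⟨hxS, rfl⟩ := Finset.mem_filter.1 hx
  exact Z.per_eq_zero x hxS a (Z.pairs_Y x hxS ▸ ha) hG

theorem memSL_add_extra (Z : Surgery V R) {t s : ℕ} {L : SemilinRep}
    (h : (es t).2.1 = .inflate s L) : memSL (R.init t + Z.extra t) L := by
  obtain ⟨h1, h2, h3⟩ := Z.inflate t s L h
  have h4 : IsPer (Z.bp t).2 (Z.per t + Z.extra t) := by
    refine h2.add (IsPer.sum fun x hx => ?_)
    obtain ⟨hxS, rfl⟩ := Finset.mem_filter.1 hx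
    rw [Z.bp_Y x hxS]
    exact Z.isPer x hxS
  obtain ⟨cs, h5, h6⟩ := h4
  exact ⟨_, h1, cs, h5, by rw [h3, add_assoc, h6]⟩

/-- The balloon `b` can play the part that `x` plays in the original run from time `t` on. For
`x ∈ X`, it need not contain the part `per x` of the contents. -/
def Match (Z : Surgery V R) (X : Finset ℕ) (t x : ℕ) (b : Balloon) : Prop :=
  b.1 = (R.val t x).1 ∧
  (∀ a ∈ R.pairs V x, a ∉ R.done V t x →
    R.init x a.1 + Z.extra x a.1 ≤ b.2 a.1 + (if x ∈ X then Z.per x a.1 else 0) ∧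
    (a.2 ∉ Z.G → b.2 a.1 = 0)) ∧
  ∀ a ∈ R.done V t x, b.2 a.1 = 0

/-- The configuration `C` can follow the original run from time `t` on, the part of `x` being
played by `g x`, while the balloons in `W` are idle. -/
structure Inv (Z : Surgery V R) (X : Finset ℕ) (W : Multiset Balloon) (t : ℕ) (C : VConfig)
    (g : ℕ → Balloon) : Prop where
  state : C.q = (rho t).q
  bag : C.bag = (R.A t).val.map g + W
  matches' : ∀ x ∈ R.A t, Z.Match X t x (g x)
  tokens : (rho t).m + ∑ x ∈ Z.S, R.got V t (Z.Y x) (Z.per x) + ∑ x ∈ X, R.tot V x (Z.per x) ≤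
    C.m + ∑ x ∈ X, R.got V t x (Z.per x)
  supp : ∀ p ∉ Z.G, C.m p = 0

theorem Inv.le {Z : Surgery V R} {X : Finset ℕ} {W : Multiset Balloon} {t : ℕ} {C : VConfig}
    {g : ℕ → Balloon} (h : Z.Inv X W t C g) :
    (rho t).m + ∑ x ∈ Z.S, R.got V t (Z.Y x) (Z.per x) ≤ C.m := by
  have h1 : ∑ x ∈ X, R.got V t x (Z.per x) ≤ ∑ x ∈ X, R.tot V x (Z.per x) :=
    Finset.sum_le_sum fun x _ => LRun.got_le_tot Z.mem_edges t x _
  exact le_of_add_le_add_right ((add_le_add_right h1 _).trans h.tokens)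

theorem Match.of_same {Z : Surgery V R} {X : Finset ℕ} {t x : ℕ} {b : Balloon}
    (h : Z.Match X t x b) (h1 : (R.val (t + 1) x).1 = (R.val t x).1)
    (h2 : ∀ pl p, ¬ R.First t x pl p) : Z.Match X (t + 1) x b := by
  unfold Match at *
  rwa [h1, LRun.done_succ_of_not_first Z.mem_edges h2]

theorem Inv.step {Z : Surgery V R} {X : Finset ℕ} {W : Multiset Balloon} {t : ℕ} {C : VConfig}
    {g : ℕ → Balloon} (h : Z.Inv X W t C g) (ht : Z.i ≤ t) :
    ∃ C' g', Z.Inv X W (t + 1) C' g' ∧ EdgeRel (es t) C C' ∧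
      (∀ s L, (es t).2.1 = .inflate s L →
        C'.bag = C.bag + {(s, R.init t + Z.extra t)}) ∧
      ∀ x ∈ R.A t, Touches (es t) C C' (g x) ∨
        (x ∈ R.A (t + 1) ∧ g' x = g x ∧ ¬ ((es t).2.1.IsTouch ∧ R.tgt t = x)) := by
  have hE := Z.mem_edges
  have hst := R.step t
  have htA := R.notMem_A t
  have hbag := h.bag
  have hkeep : ∀ x ∈ R.A t, ¬ ((es t).2.1.IsTouch ∧ R.tgt t = x) →
      x ∈ R.A (t + 1) ∧ ∀ b, Z.Match X t x b → Z.Match X (t + 1) x b := by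
    intro x hx hn
    have hk := hst.keep htA hx fun h1 h2 => hn ⟨h1, h2⟩
    refine ⟨hk.1, fun b hb => hb.of_same (by rw [hk.2]) ?_⟩
    rintro pl p ⟨⟨⟨s, s', he⟩, hz⟩, -⟩
    exact hn ⟨by rw [he]; trivial, hz⟩
  have hgot : (∀ x pl p, ¬ R.First t x pl p) → ∀ x w, R.got V (t + 1) x w = R.got V t x w :=
    fun hn x w => LRun.got_succ_of_not_first hE (hn x) w
  have hq : C.q = (es t).1 := h.state.trans (Z.source t)
  have hnf : ¬ (∃ s s' pl p, (es t).2.1 = .deflate s s' pl p) → ∀ x pl p, ¬ R.First t x pl p :=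
    fun hn x pl p hf => hn (by obtain ⟨⟨⟨s, s', he⟩, -⟩, -⟩ := hf; exact ⟨s, s', pl, p, he⟩)
  cases he : (es t).2.1 with
  | delta d =>
    rw [he] at hst
    obtain ⟨h1, h2, h3⟩ := hst
    have hnt : ∀ x, ¬ ((es t).2.1.IsTouch ∧ R.tgt t = x) := fun x hx => by
      rw [he] at hx; exact hx.1
    have hle : (rho t).m ≤ C.m := le_self_add.trans h.le
    have hnf' := hnf (by simp [he])
    refine ⟨⟨(es t).2.2, (rho (t + 1)).m + (C.m - (rho t).m), C.bag⟩, g, ⟨?_, ?_, ?_, ?_, ?_⟩,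
      ⟨hq, rfl, ?_⟩, by simp, fun x hx => Or.inr ⟨(hkeep x hx (hnt x)).1, rfl, he ▸ hnt x⟩⟩
    · exact (Z.target t).symm
    · rw [h2]; exact hbag
    · intro x hx
      rw [h2] at hx
      exact (hkeep x hx (hnt x)).2 _ (h.matches' x hx)
    · simp only [hgot hnf']
      have := h.tokens
      rw [← add_tsub_cancel_of_le hle] at this
      simp only [add_assoc, add_le_add_iff_left] at this ⊢
      exact this
    · intro p hp
      have h5 := Z.places (t + 1) (by omega) p hp
      have h6 := h.supp p hp
      simp [h5, h6]
    · rw [he]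
      refine ⟨fun p => ?_, rfl⟩
      have h5 := h1 p
      have h6 := hle p
      simp only [Finsupp.add_apply, Finsupp.tsub_apply, Nat.cast_add, Nat.cast_sub h6]
      omega
  | inflate s L =>
    have hst' := hst
    rw [he] at hst
    obtain ⟨h1, k, -, h2, h3⟩ := hst
    have hnt : ∀ x, ¬ ((es t).2.1.IsTouch ∧ R.tgt t = x) := fun x hx => by
      rw [he] at hx; exact hx.1
    have hnf' := hnf (by simp [he])
    have hne : ∀ x ∈ R.A t, x ≠ t := fun x hx hxt => htA (hxt ▸ hx)
    refine ⟨⟨(es t).2.2, C.m, C.bag + {(s, R.init t + Z.extra t)}⟩,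
      Function.update g t (s, R.init t + Z.extra t), ⟨?_, ?_, ?_, ?_, h.supp⟩,
      ⟨hq, rfl, ?_⟩, ?_, fun x hx => Or.inr ⟨(hkeep x hx (hnt x)).1,
        Function.update_of_ne (hne x hx) _ _, he ▸ hnt x⟩⟩
    · exact (Z.target t).symm
    · rw [h2, map_update_of_mem (Finset.mem_insert_self _ _), Finset.erase_insert htA]
      simp only [hbag]
      abel
    · intro x hx
      by_cases hxt : x = t
      · subst hxt
        rw [Function.update_self]
        have hd : R.done V (x + 1) x = ∅ := LRun.done_of_le hE le_rfl
        refine ⟨by rw [h3, Function.update_self], fun a ha _ => ⟨?_, fun hG => ?_⟩, ?_⟩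
        · simp
        · simp [Z.init_eq_zero x ht a ha hG, Z.extra_eq_zero x a ha hG]
        · simp [hd]
      · rw [Function.update_of_ne hxt]
        have hxA := hst'.mem_of_mem hx hxt
        exact (hkeep x hxA (hnt x)).2 _ (h.matches' x hxA)
    · simp only [hgot hnf', h1]
      exact h.tokens
    · rw [he]
      exact ⟨rfl, _, Z.memSL_add_extra he, rfl⟩
    · intro s' L' he'
      injection he' with e1 e2
      rw [e1]
  | burst s =>
    rw [he] at hst
    obtain ⟨hz, h1, h2, h3, h4⟩ := hst
    have hnf' := hnf (by simp [he])
    have hzs : g (R.tgt t) = (s, (g (R.tgt t)).2) := by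
      rw [← h1, ← (h.matches' _ hz).1]
    have hT : C.bag = ((R.A t).erase (R.tgt t)).val.map g + W + {g (R.tgt t)} := by
      rw [hbag, map_eq_erase_add hz]
      abel
    refine ⟨⟨(es t).2.2, C.m, ((R.A t).erase (R.tgt t)).val.map g + W⟩, g,
      ⟨(Z.target t).symm, by rw [h3], ?_, ?_, h.supp⟩, ⟨hq, rfl, ?_⟩, by simp, ?_⟩
    · intro x hx
      rw [h3] at hx
      obtain ⟨hxz, hx⟩ := Finset.mem_erase.1 hx
      exact (hkeep x hx fun h => hxz h.2.symm).2 _ (h.matches' x hx)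
    · simp only [hgot hnf', h2]
      exact h.tokens
    · rw [he]
      exact ⟨rfl, _, _, hzs ▸ hT, rfl⟩
    · intro x hx
      by_cases hxz : R.tgt t = x
      · subst hxz
        refine Or.inl (Or.inr ⟨?_, _, hT, rfl⟩)
        rw [he, hzs]
      · exact Or.inr ⟨(hkeep x hx fun h => hxz h.2).1, rfl, fun h => hxz h.2⟩
  | deflate s s' pl p =>
    rw [he] at hst
    obtain ⟨hz, h1, h2, h3, h4⟩ := hst
    have hd : R.Defl t (R.tgt t) pl p := ⟨⟨s, s', he⟩, rfl⟩
    set z := R.tgt t with hzdef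
    have hM := h.matches' z hz
    have hzs : g z = (s, (g z).2) := by
      rw [← h1, ← hM.1]
    have hT : C.bag = ((R.A t).erase z).val.map g + W + {g z} := by
      rw [hbag, map_eq_erase_add hz]
      abel
    have hC' : (R.A (t + 1)).val.map (Function.update g z (s', Finsupp.erase pl (g z).2)) + W =
        ((R.A t).erase z).val.map g + W + {(s', Finsupp.erase pl (g z).2)} := by
      rw [h3, map_update_of_mem hz]
      abel
    have hother : ∀ x ∈ R.A (t + 1), x ≠ z →
        Z.Match X (t + 1) x (Function.update g z (s', Finsupp.erase pl (g z).2) x) := by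
      intro x hx hxz
      rw [h3] at hx
      rw [Function.update_of_ne hxz]
      exact (hkeep x hx fun h => hxz h.2.symm).2 _ (h.matches' x hx)
    have hnf' : ¬ R.First t z pl p → ∀ x pl p, ¬ R.First t x pl p := by
      rintro hf x pl' p' ⟨⟨⟨r, r', he'⟩, hx⟩, h5⟩
      rw [he] at he'
      injection he' with _ _ e3 e4
      subst e3 e4 hx
      exact hf ⟨hd, h5⟩
    have hzero : ¬ R.First t z pl p → (R.val t z).2 pl = 0 ∧ (g z).2 pl = 0 := by
      intro hf
      have h5 : ∃ u < t, ∃ p', R.Defl u z pl p' := by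
        by_contra! h5
        exact hf ⟨hd, h5⟩
      refine ⟨(LRun.contents hz pl).1 h5, ?_⟩
      obtain ⟨u, hu, p', h6⟩ := h5
      obtain ⟨u', hu', p'', h7⟩ := h6.exists_first
      exact hM.2.2 (pl, p'') ((LRun.mem_done hE).2 ⟨u', hu'.trans_lt hu, h7⟩)
    have hst1 : (R.val (t + 1) z).1 = s' := by rw [h4, Function.update_self]
    refine ⟨⟨(es t).2.2, C.m + Finsupp.single p ((g z).2 pl),
      ((R.A t).erase z).val.map g + W + {(s', Finsupp.erase pl (g z).2)}⟩,
      Function.update g z (s', Finsupp.erase pl (g z).2),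
      ⟨(Z.target t).symm, hC'.symm, ?_, ?_, ?_⟩, ⟨hq, rfl, ?_⟩, by simp, ?_⟩
    · intro x hx
      by_cases hxz : x = z
      · subst hxz
        rw [Function.update_self]
        refine ⟨hst1.symm, fun a ha hna => ?_, fun a ha => ?_⟩
        · have hna' : a ∉ R.done V t z := fun h => hna (LRun.done_mono hE (Nat.le_succ t) z h)
          have hne : a.1 ≠ pl := by
            rintro rfl
            obtain ⟨u, hu, p', hp'⟩ := hd.exists_first
            have hm : (a.1, p') ∈ R.done V (t + 1) z :=
              (LRun.mem_done hE).2 ⟨u, Nat.lt_succ_of_le hu, hp'⟩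
            have := LRun.pairs_functional hE (LRun.done_subset_pairs hE _ _ hm) ha
            subst this
            exact hna hm
          simp only [Finsupp.erase_ne hne]
          exact hM.2.1 a ha hna'
        · by_cases hne : a.1 = pl
          · simp [hne]
          · simp only [Finsupp.erase_ne hne]
            obtain ⟨u, hu, hf⟩ := (LRun.mem_done hE).1 ha
            rcases Nat.lt_succ_iff_lt_or_eq.1 hu with hu | rfl
            · exact hM.2.2 a ((LRun.mem_done hE).2 ⟨u, hu, hf⟩)
            · obtain ⟨⟨⟨r, r', he'⟩, -⟩, -⟩ := hf
              rw [he] at he'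
              injection he' with _ _ e
              exact (hne e.symm).elim
      · exact hother x hx hxz
    · by_cases hf : R.First t z pl p
      · have h5 := (LRun.contents hz pl).2 hf.2
        have h6 := (hM.2.1 (pl, p) ((LRun.mem_pairs hE).2 ⟨t, hf⟩)
          (LRun.done_succ_of_first hE hf).2).1
        have h7 : (∑ x ∈ X.filter (fun x => id x = z), Z.per x) pl =
            if z ∈ X then Z.per z pl else 0 := by
          rw [Finset.sum_filter]
          simp only [id, Finset.sum_ite_eq']
          split_ifs <;> rfl
        have h8 := LRun.sum_got_succ_of_first hE hf X id Z.per
        simp only [id] at h7 h8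
        rw [LRun.sum_got_succ_of_first hE hf Z.S Z.Y Z.per, h2, h8, h7, h5]
        intro q
        have h9 := h.tokens q
        simp only [Finsupp.add_apply, Finsupp.single_apply] at h9 ⊢
        dsimp only [extra] at h6
        split_ifs at h6 ⊢ <;> omega
      · have h5 := hnf' hf
        have h6 := hzero hf
        simp only [hgot h5, h2, h6.1, h6.2, Finsupp.single_zero, add_zero]
        exact h.tokens
    · intro q hq
      rw [Finsupp.add_apply, h.supp q hq, zero_add, Finsupp.single_apply]
      split_ifs with hpq
      · subst hpq
        by_cases hf : R.First t z pl p
        · exact (hM.2.1 (pl, p) ((LRun.mem_pairs hE).2 ⟨t, hf⟩)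
            (LRun.done_succ_of_first hE hf).2).2 hq
        · exact (hzero hf).2
      · rfl
    · rw [he]
      exact ⟨_, _, hzs ▸ hT, rfl, rfl⟩
    · intro x hx
      by_cases hxz : z = x
      · subst hxz
        refine Or.inl (Or.inl ⟨s', pl, p, ?_, _, hT, rfl⟩)
        rw [he, hzs]
      · exact Or.inr ⟨h3 ▸ hx, Function.update_of_ne (Ne.symm hxz) _ _, fun h => hxz h.2⟩

end Surgery

/-- If every good configuration can be led to a good one along the cyclic edge sequence `eo`
of length `l`, while touching a given balloon, then there is an infinite run in which every
balloon is touched again and again. -/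
theorem exists_fair_run {eo : ℕ → VEdge} {l : ℕ} (hl : 0 < l) {Good : VConfig → Prop}
    {Q : ℕ → VConfig → VConfig → Prop}
    (hrep : ∀ C, Good C → ∀ b, ∃ cfg : ℕ → VConfig, cfg 0 = C ∧ Good (cfg l) ∧
      (∀ n, EdgeRel (eo n) (cfg n) (cfg (n + 1)) ∧ Q n (cfg n) (cfg (n + 1))) ∧
      (b ∈ C.bag → ∃ n < l, Touches (eo n) (cfg n) (cfg (n + 1)) b))
    {C0 : VConfig} (hC0 : Good C0) :
    ∃ rho : ℕ → VConfig, rho 0 = C0 ∧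
      (∀ k, EdgeRel (eo (k % l)) (rho k) (rho (k + 1)) ∧ Q (k % l) (rho k) (rho (k + 1))) ∧
      ∀ k, ∀ b ∈ (rho k).bag, ∃ j ≥ k, Touches (eo (j % l)) (rho j) (rho (j + 1)) b := by
  choose! cfg h0 hgood hstep htouch using hrep
  let nxt : VConfig × List Balloon → VConfig × List Balloon := fun S =>
    (cfg S.1 (S.2.headD (0, 0)) l, if S.2 = [] then
      (cfg S.1 (S.2.headD (0, 0)) l).bag.toList else S.2.tail)
  let St : ℕ → VConfig × List Balloon := fun r => nxt^[r] (C0, [])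
  have hSt : ∀ r, St (r + 1) = nxt (St r) := fun r => Function.iterate_succ_apply' nxt r _
  have hG : ∀ r, Good (St r).1 := by
    intro r
    induction r with
    | zero => exact hC0
    | succ r ih => rw [hSt]; exact hgood _ ih _
  let seg : ℕ → ℕ → VConfig := fun r => cfg (St r).1 ((St r).2.headD (0, 0))
  have hseg0 : ∀ r, seg r 0 = (St r).1 := fun r => h0 _ (hG r) _
  have hsegl : ∀ r, seg r l = seg (r + 1) 0 := fun r => by rw [hseg0, hSt]
  let rho : ℕ → VConfig := fun k => seg (k / l) (k % l)
  have hrho : ∀ r n, n < l → rho (r * l + n) = seg r n := by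
    intro r n hn
    simp only [rho]
    rw [mul_comm, Nat.mul_add_div hl, Nat.mul_add_mod, Nat.div_eq_of_lt hn, Nat.mod_eq_of_lt hn,
      add_zero]
  have hrho' : ∀ r n, n ≤ l → rho (r * l + n) = seg r n := by
    intro r n hn
    rcases hn.lt_or_eq with hn | rfl
    · exact hrho r n hn
    · rw [hsegl, ← hrho (r + 1) 0 hl, add_mul, one_mul, add_zero]
  have hk : ∀ k, k = k / l * l + k % l := fun k => (Nat.div_add_mod' k l).symm
  have hrhok : ∀ k, rho (k + 1) = seg (k / l) (k % l + 1) := by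
    intro k
    rw [← hrho' (k / l) (k % l + 1) (Nat.mod_lt k hl), ← add_assoc, ← hk k]
  have hrun : ∀ k, EdgeRel (eo (k % l)) (rho k) (rho (k + 1)) ∧
      Q (k % l) (rho k) (rho (k + 1)) := by
    intro k
    rw [hrhok]
    exact hstep _ (hG _) _ _
  refine ⟨rho, ?_, hrun, ?_⟩
  · have := hrho 0 0 hl
    rw [zero_mul, zero_add, hseg0] at this
    exact this
  intro k b hb
  by_contra! hcon
  have hmem : ∀ k' ≥ k, b ∈ (rho k').bag := fun k' hk' =>
    mem_bag_of_not_touches hk' (fun t _ _ => (hrun t).1) hb fun t h1 _ => hcon t h1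
  have hSmem : ∀ r, k ≤ r * l → b ∈ (St r).1.bag := by
    intro r hr
    have := hmem _ hr
    rwa [← add_zero (r * l), hrho r 0 hl, hseg0] at this
  have hhead : ∀ r, k ≤ r * l → (St r).2.headD (0, 0) ≠ b := by
    rintro r hr rfl
    obtain ⟨n, hn, h⟩ := htouch _ (hG r) _ (hSmem r hr)
    refine hcon (r * l + n) (by omega) ?_
    rw [add_assoc, hrho' r n hn.le, hrho' r (n + 1) hn, mul_comm, Nat.mul_add_mod,
      Nat.mod_eq_of_lt hn]
    exact h
  have hle : ∀ r, k ≤ r * l → k ≤ (r + 1) * l := fun r hr => hr.trans (by rw [add_mul]; omega)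
  have hin : ∀ (L : List Balloon) r, k ≤ r * l → (St r).2 = L → b ∉ L := by
    intro L
    induction L with
    | nil => simp
    | cons c L ih =>
      intro r hr hL hbL
      rcases List.mem_cons.1 hbL with rfl | hbL
      · exact hhead r hr (by rw [hL]; rfl)
      · refine ih (r + 1) (hle r hr) ?_ hbL
        rw [hSt]
        simp [nxt, hL]
  have hend : ∀ (L : List Balloon) r, k ≤ r * l → (St r).2 ≠ L := by
    intro L
    induction L with
    | nil =>
      intro r hr hL
      refine hin _ (r + 1) (hle r hr) rfl ?_
      have h1 : (St (r + 1)).2 = (St (r + 1)).1.bag.toList := by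
        rw [hSt]
        simp [nxt, hL]
      rw [h1, Multiset.mem_toList]
      exact hSmem (r + 1) (hle r hr)
    | cons c L ih =>
      intro r hr hL
      refine ih (r + 1) (hle r hr) ?_
      rw [hSt]
      simp [nxt, hL]
  exact hend _ k (Nat.le_mul_of_pos_right k hl) rfl

namespace LRun

variable {rho : ℕ → VConfig} {es : ℕ → VEdge} {R : LRun rho es} {V : VASSB}

theorem exists_inflate_of_mem (R : LRun rho es) {t x : ℕ} (hx : x ∈ R.A t) :
    ∃ s L, (es x).2.1 = .inflate s L := by
  induction t with
  | zero => exact absurd (R.A_lt 0 x hx) (Nat.not_lt_zero x)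
  | succ t ih =>
    by_cases hxt : x = t
    · subst hxt
      have hst := R.step x
      have hn := R.notMem_A x
      cases he : (es x).2.1 with
      | inflate s L => exact ⟨s, L, rfl⟩
      | delta d =>
        rw [he] at hst
        exact (hn (hst.2.1 ▸ hx)).elim
      | burst s =>
        rw [he] at hst
        exact (hn (Finset.mem_of_mem_erase (hst.2.2.2.1 ▸ hx))).elim
      | deflate s s' pl p =>
        rw [he] at hst
        exact (hn (hst.2.2.2.1 ▸ hx)).elim
    · exact ih ((R.step t).mem_of_mem hx hxt)

theorem contents_of_fresh (hE : ∀ t, es t ∈ V.edges) {t x : ℕ} {a : ℕ × ℕ} (hx : x ∈ R.A t)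
    (ha : a ∈ R.pairs V x) (hd : a ∉ R.done V t x) : (R.val t x).2 a.1 = R.init x a.1 := by
  refine (contents hx a.1).2 fun u hu p hp => hd ?_
  obtain ⟨u', hu', p', h⟩ := hp.exists_first
  have hm : (a.1, p') ∈ R.done V t x := (mem_done hE).2 ⟨u', hu'.trans_lt hu, h⟩
  have := pairs_functional hE (done_subset_pairs hE _ _ hm) ha
  subst this
  exact hm

/-- Nothing is transferred to a place that stays empty. -/
theorem init_eq_zero_of_empty (hE : ∀ t, es t ∈ V.edges) {N x : ℕ} {a : ℕ × ℕ}
    (hN : ∀ t ≥ N, (rho t).m a.2 = 0) (ha : a ∈ R.pairs V x) (hd : a ∉ R.done V N x) :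
    R.init x a.1 = 0 := by
  obtain ⟨u, hu⟩ := (mem_pairs hE).1 ha
  have huN : N ≤ u := by
    by_contra! h
    exact hd ((mem_done hE).2 ⟨u, h, hu⟩)
  have h1 := (contents hu.1.mem a.1).2 hu.2
  obtain ⟨⟨⟨s, s', he⟩, rfl⟩, -⟩ := hu
  have hst := R.step u
  rw [he] at hst
  obtain ⟨-, -, h2, -⟩ := hst
  have h3 := hN (u + 1) (by omega)
  rw [h2, Finsupp.add_apply, Finsupp.single_eq_same] at h3
  omega

end LRun

namespace Surgery

variable {rho : ℕ → VConfig} {es : ℕ → VEdge} {R : LRun rho es} {V : VASSB}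

/-- The balloon `y` at time `j` and the balloon `x` at time `i` can be exchanged. -/
structure Same (Z : Surgery V R) (j y x : ℕ) : Prop where
  bp : Z.bp y = Z.bp x
  pairs : R.pairs V y = R.pairs V x
  done : R.done V j y = R.done V Z.i x
  state : (R.val j y).1 = (R.val Z.i x).1

/-- The segment of the run from time `i` to time `j` can be repeated. -/
structure Repeats (Z : Surgery V R) (j : ℕ) (phi : ℕ → ℕ) : Prop where
  lt : Z.i < j
  injOn : Set.InjOn phi (R.A Z.i)
  mapsTo : ∀ x ∈ R.A Z.i, phi x ∈ R.A j
  same : ∀ x ∈ R.A Z.i, Z.Same j (phi x) x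
  exists_same : ∀ y ∈ R.A j, ∃ x ∈ R.A Z.i, Z.Same j y x
  m_le : (rho Z.i).m ≤ (rho j).m
  state : (rho Z.i).q = (rho j).q
  subset : Z.S ⊆ R.A Z.i
  done_of_notMem : ∀ x ∈ R.A Z.i, x ∉ Z.S → R.done V Z.i x = R.pairs V x
  done_eq : ∀ x ∈ Z.S, R.done V j x = R.pairs V x
  done_Y : ∀ x ∈ Z.S, R.done V j (Z.Y x) = R.pairs V (Z.Y x)
  touched : ∀ x ∈ R.A Z.i, ∃ t, Z.i ≤ t ∧ t < j ∧ (es t).2.1.IsTouch ∧ R.tgt t = x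

/-- The configurations from which the segment can be repeated. -/
def Good (Z : Surgery V R) (C : VConfig) : Prop :=
  ∃ X ⊆ Z.S, ∃ (W : Multiset Balloon) (g : ℕ → Balloon), C.q = (rho Z.i).q ∧
    C.bag = (R.A Z.i).val.map g + W ∧ (∀ x ∈ R.A Z.i, Z.Match X Z.i x (g x)) ∧
    (∀ b ∈ W, ∃ x ∈ R.A Z.i, Z.Match X Z.i x b) ∧
    (rho Z.i).m + ∑ x ∈ X, R.tot V x (Z.per x) ≤ C.m ∧ ∀ p ∉ Z.G, C.m p = 0

theorem good_start (Z : Surgery V R) : Z.Good (rho Z.i) := by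
  refine ⟨∅, Finset.empty_subset _, 0, R.val Z.i, rfl, by simp [R.bag], fun x hx => ?_, by simp,
    by simp, Z.places _ le_rfl⟩
  have hE := Z.mem_edges
  refine ⟨rfl, fun a ha hd => ?_, fun a ha => ?_⟩
  · rw [LRun.contents_of_fresh hE hx ha hd, Z.extra_of_lt (R.A_lt _ _ hx)]
    exact ⟨by simp, fun hG => LRun.init_eq_zero_of_empty hE
      (fun t ht => Z.places t ht _ hG) ha hd⟩
  · obtain ⟨u, hu, h⟩ := (LRun.mem_done hE).1 ha
    exact (LRun.contents hx a.1).1 ⟨u, hu, _, h.1⟩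

theorem Match.mono {Z : Surgery V R} {X X' : Finset ℕ} {t x : ℕ} {b : Balloon}
    (h : Z.Match X t x b) (hX : X ⊆ X') : Z.Match X' t x b := by
  refine ⟨h.1, fun a ha hd => ⟨(h.2.1 a ha hd).1.trans ?_, (h.2.1 a ha hd).2⟩, h.2.2⟩
  by_cases hx : x ∈ X
  · simp [hx, hX hx]
  · simp [hx]

theorem Match.of_repeats {Z : Surgery V R} {X : Finset ℕ} {j x y : ℕ} {phi : ℕ → ℕ} {b : Balloon}
    (hZ : Z.Repeats j phi) (hX : X ⊆ Z.S) (hx : x ∈ R.A Z.i) (hy : y ∈ R.A j)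
    (hs : Z.Same j y x) (h : Z.Match X j y b) : Z.Match Z.S Z.i x b := by
  obtain ⟨h1, h2, h3⟩ := h
  rw [hs.pairs, hs.done] at h2
  rw [hs.done] at h3
  refine ⟨h1.trans hs.state, fun a ha hd => ⟨?_, (h2 a ha hd).2⟩, h3⟩
  have hxS : x ∈ Z.S := by
    by_contra hxS
    exact hd (by rwa [hZ.done_of_notMem x hx hxS])
  have hyX : y ∉ X := by
    intro hyX
    have := hZ.done_eq y (hX hyX)
    rw [hs.done, hs.pairs] at this
    exact hd (by rwa [this])
  have h4 := (h2 a ha hd).1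
  obtain ⟨s, L, he⟩ := R.exists_inflate_of_mem hx
  obtain ⟨s', L', he'⟩ := R.exists_inflate_of_mem hy
  rw [if_neg hyX, (Z.inflate y _ _ he').2.2, hs.bp] at h4
  rw [if_pos hxS, (Z.inflate x _ _ he).2.2, Z.extra_of_lt (R.A_lt _ _ hx)]
  simp only [Finsupp.add_apply, Finsupp.coe_zero, Pi.zero_apply] at h4 ⊢
  omega

theorem Good.of_inv {Z : Surgery V R} {X : Finset ℕ} {j : ℕ} {phi : ℕ → ℕ}
    {W : Multiset Balloon} {C : VConfig} {g : ℕ → Balloon}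
    (hZ : Z.Repeats j phi) (hX : X ⊆ Z.S) (h : Z.Inv X W j C g)
    (hW : ∀ b ∈ W, ∃ x ∈ R.A Z.i, Z.Match X Z.i x b) : Z.Good C := by
  classical
  have hsub : (R.A Z.i).image phi ⊆ R.A j := Finset.image_subset_iff.2 hZ.mapsTo
  refine ⟨Z.S, subset_rfl, (R.A j \ (R.A Z.i).image phi).val.map g + W, g ∘ phi,
    h.state.trans hZ.state.symm, ?_, ?_, ?_, ?_, h.supp⟩
  · rw [h.bag, ← add_assoc, ← Multiset.map_map, ← Finset.image_val_of_injOn hZ.injOn,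
      ← Multiset.map_add, Finset.sdiff_val, add_tsub_cancel_of_le (Finset.val_le_iff.2 hsub)]
  · intro x hx
    exact (h.matches' _ (hZ.mapsTo x hx)).of_repeats hZ hX hx (hZ.mapsTo x hx) (hZ.same x hx)
  · intro b hb
    rcases Multiset.mem_add.1 hb with hb | hb
    · obtain ⟨y, hy, rfl⟩ := Multiset.mem_map.1 hb
      have hyj : y ∈ R.A j := (Finset.mem_sdiff.1 hy).1
      obtain ⟨x, hx, hs⟩ := hZ.exists_same y hyj
      exact ⟨x, hx, (h.matches' y hyj).of_repeats hZ hX hx hyj hs⟩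
    · obtain ⟨x, hx, hm⟩ := hW b hb
      exact ⟨x, hx, hm.mono hX⟩
  · refine le_trans (add_le_add hZ.m_le (Finset.sum_le_sum fun x hx => ?_)) h.le
    rw [LRun.got, hZ.done_Y x hx, Z.pairs_Y x hx]
    rfl

theorem Good.rep {Z : Surgery V R} {j : ℕ} {phi : ℕ → ℕ} (hZ : Z.Repeats j phi) {C : VConfig}
    (hC : Z.Good C) (b : Balloon) : ∃ cfg : ℕ → VConfig, cfg 0 = C ∧ Z.Good (cfg (j - Z.i)) ∧
      (∀ n, EdgeRel (es (Z.i + n)) (cfg n) (cfg (n + 1)) ∧ ((∀ p ∉ Z.G, (cfg n).m p = 0) ∧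
        ∀ s L, (es (Z.i + n)).2.1 = .inflate s L →
          (cfg (n + 1)).bag = (cfg n).bag + {(s, R.init (Z.i + n) + Z.extra (Z.i + n))})) ∧
      (b ∈ C.bag → ∃ n < j - Z.i, Touches (es (Z.i + n)) (cfg n) (cfg (n + 1)) b) := by
  classical
  obtain ⟨X, hX, W, g, hq, hbag, hg, hW, hm, hsupp⟩ := hC
  -- the balloon `b` may be assumed to take part
  obtain ⟨W', g', hbag', hg', hW', hb⟩ : ∃ (W' : Multiset Balloon) (g' : ℕ → Balloon),
      C.bag = (R.A Z.i).val.map g' + W' ∧ (∀ x ∈ R.A Z.i, Z.Match X Z.i x (g' x)) ∧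
      (∀ b ∈ W', ∃ x ∈ R.A Z.i, Z.Match X Z.i x b) ∧
      (b ∈ C.bag → ∃ x ∈ R.A Z.i, g' x = b) := by
    by_cases hb : b ∈ W
    · obtain ⟨x, hx, hxb⟩ := hW b hb
      refine ⟨W.erase b + {g x}, Function.update g x b, ?_, ?_, ?_, fun _ => ⟨x, hx, by simp⟩⟩
      · rw [hbag, map_update_of_mem hx, map_eq_erase_add hx, ← Multiset.cons_erase hb,
          Multiset.erase_cons_head, ← Multiset.singleton_add]
        abel
      · intro y hy
        by_cases hyx : y = x
        · subst hyx
          simpa using hxb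
        · simpa [hyx] using hg y hy
      · intro c hc
        rcases Multiset.mem_add.1 hc with hc | hc
        · exact hW c (Multiset.mem_of_mem_erase hc)
        · rw [Multiset.mem_singleton.1 hc]
          exact ⟨x, hx, hg x hx⟩
    · refine ⟨W, g, hbag, hg, hW, fun h => ?_⟩
      rw [hbag] at h
      obtain ⟨x, hx, h⟩ := Multiset.mem_map.1 ((Multiset.mem_add.1 h).resolve_right hb)
      exact ⟨x, hx, h⟩
  have hinv : Z.Inv X W' Z.i C g' := by
    refine ⟨hq, hbag', hg', ?_, hsupp⟩
    have : ∑ x ∈ Z.S, R.got V Z.i (Z.Y x) (Z.per x) = 0 := by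
      refine Finset.sum_eq_zero fun x hx => ?_
      rw [LRun.got, LRun.done_of_le Z.mem_edges ((Z.le_Y x hx).trans (Nat.le_succ _)),
        Finset.sum_empty]
    rw [this, add_zero]
    exact hm.trans le_self_add
  have hstep : ∀ n (s : VConfig × (ℕ → Balloon)), ∃ s' : VConfig × (ℕ → Balloon),
      Z.Inv X W' (Z.i + n) s.1 s.2 → Z.Inv X W' (Z.i + (n + 1)) s'.1 s'.2 ∧
        EdgeRel (es (Z.i + n)) s.1 s'.1 ∧
      (∀ r L, (es (Z.i + n)).2.1 = .inflate r L →
        s'.1.bag = s.1.bag + {(r, R.init (Z.i + n) + Z.extra (Z.i + n))}) ∧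
      ∀ x ∈ R.A (Z.i + n), Touches (es (Z.i + n)) s.1 s'.1 (s.2 x) ∨
        (x ∈ R.A (Z.i + (n + 1)) ∧ s'.2 x = s.2 x ∧
          ¬ ((es (Z.i + n)).2.1.IsTouch ∧ R.tgt (Z.i + n) = x)) := by
    intro n s
    by_cases h : Z.Inv X W' (Z.i + n) s.1 s.2
    · obtain ⟨C', g'', h'⟩ := h.step (Nat.le_add_right _ _)
      exact ⟨(C', g''), fun _ => h'⟩
    · exact ⟨s, fun h' => (h h').elim⟩
  choose nxt hnxt using hstep
  let st : ℕ → VConfig × (ℕ → Balloon) := fun n => Nat.rec (C, g') nxt n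
  have hst : ∀ n, st (n + 1) = nxt n (st n) := fun n => rfl
  have hinv' : ∀ n, Z.Inv X W' (Z.i + n) (st n).1 (st n).2 := by
    intro n
    induction n with
    | zero => exact hinv
    | succ n ih => exact (hnxt n _ ih).1
  have hlt := hZ.lt
  refine ⟨fun n => (st n).1, rfl, ?_, fun n => ⟨(hnxt n _ (hinv' n)).2.1, (hinv' n).supp,
    (hnxt n _ (hinv' n)).2.2.1⟩, fun h => ?_⟩
  · have := hinv' (j - Z.i)
    rw [Nat.add_sub_cancel' hlt.le] at this
    exact Good.of_inv hZ hX this hW'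
  · obtain ⟨x, hx, rfl⟩ := hb h
    obtain ⟨t, h1, h2, h3⟩ := hZ.touched x hx
    by_contra! hn
    have key : ∀ n, n ≤ t - Z.i → x ∈ R.A (Z.i + n) ∧ (st n).2 x = g' x := by
      intro n
      induction n with
      | zero => exact fun _ => ⟨hx, rfl⟩
      | succ n ih =>
        intro hnt
        obtain ⟨ih1, ih2⟩ := ih (by omega)
        rcases (hnxt n _ (hinv' n)).2.2.2 x ih1 with h4 | h4
        · rw [ih2] at h4
          exact (hn n (by omega) h4).elim
        · exact ⟨h4.1, h4.2.1.trans ih2⟩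
    obtain ⟨k1, k2⟩ := key _ le_rfl
    rcases (hnxt _ _ (hinv' _)).2.2.2 x k1 with h4 | h4
    · rw [k2] at h4
      exact hn _ (by omega) h4
    · rw [Nat.add_sub_cancel' h1] at h4
      exact h4.2.2 h3

end Surgery

namespace Surgery

variable {rho : ℕ → VConfig} {es : ℕ → VEdge} {R : LRun rho es} {V : VASSB}

theorem exists_shallow {s : VConfig} (hrun : ProgressiveV V s rho es) {Z : Surgery V R} {j : ℕ}
    {phi : ℕ → ℕ} (hZ : Z.Repeats j phi)
    (hG : ∀ p ∈ Z.G, ∃ t, Z.i ≤ t ∧ t < j ∧ ∃ d : ZVec, (es t).2.1 = .delta d ∧ d p < 0)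
    (hG' : ∀ t ≥ Z.i, ∀ (d : ZVec), (es t).2.1 = .delta d → ∀ p, d p < 0 → p ∈ Z.G) :
    ∃ (rho' : ℕ → VConfig) (es' : ℕ → VEdge),
      ProgressiveV V s rho' es' ∧ ShallowVRun rho' es' := by
  obtain ⟨⟨h0, hstep⟩, hbal, hpl⟩ := hrun
  have hlt := hZ.lt
  have hl : 0 < j - Z.i := by omega
  obtain ⟨fr, hfr0, hfr, hfrb⟩ := exists_fair_run (eo := fun n => es (Z.i + n)) hl
    (Q := fun n c c' => (∀ p ∉ Z.G, c.m p = 0) ∧ ∀ s L, (es (Z.i + n)).2.1 = .inflate s L →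
          c'.bag = c.bag + {(s, R.init (Z.i + n) + Z.extra (Z.i + n))})
    (fun C hC b => Good.rep hZ hC b) Z.good_start
  let rho' : ℕ → VConfig := fun k => if k < Z.i then rho k else fr (k - Z.i)
  let es' : ℕ → VEdge := fun k => if k < Z.i then es k else es (Z.i + (k - Z.i) % (j - Z.i))
  have hr1 : ∀ k ≤ Z.i, rho' k = rho k := by
    intro k hk
    rcases hk.lt_or_eq with hk | rfl
    · simp [rho', hk]
    · simp [rho', hfr0]
  have hr2 : ∀ n, rho' (Z.i + n) = fr n := fun n => by simp [rho']
  have he1 : ∀ k < Z.i, es' k = es k := fun k hk => by simp [es', hk]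
  have he2 : ∀ n, es' (Z.i + n) = es (Z.i + n % (j - Z.i)) := fun n => by simp [es']
  have hstep' : ∀ k, es' k ∈ V.edges ∧ EdgeRel (es' k) (rho' k) (rho' (k + 1)) := by
    intro k
    rcases lt_or_ge k Z.i with hk | hk
    · rw [he1 k hk, hr1 k hk.le, hr1 (k + 1) hk]
      exact hstep k
    · obtain ⟨n, rfl⟩ := Nat.exists_eq_add_of_le hk
      rw [he2, hr2, add_assoc, hr2]
      exact ⟨Z.mem_edges _, (hfr n).1⟩
  have hbalI : ∀ n, ∀ b ∈ (rho' (Z.i + n)).bag, ∃ k ≥ Z.i + n,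
      Touches (es' k) (rho' k) (rho' (k + 1)) b := by
    intro n b hb
    rw [hr2] at hb
    obtain ⟨k, hk, h⟩ := hfrb n b hb
    refine ⟨Z.i + k, by omega, ?_⟩
    rw [he2, hr2, add_assoc, hr2]
    exact h
  have hGI : ∀ p ∈ Z.G, ∀ k, ∃ k' ≥ k, ∃ d : ZVec, (es' k').2.1 = .delta d ∧ d p < 0 := by
    intro p hp k
    obtain ⟨t, h1, h2, h3⟩ := hG p hp
    refine ⟨Z.i + ((t - Z.i) + (j - Z.i) * k), ?_, ?_⟩
    · have : k ≤ (j - Z.i) * k := Nat.le_mul_of_pos_left k hl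
      omega
    · rw [he2, Nat.add_mul_mod_self_left, Nat.mod_eq_of_lt (by omega), Nat.add_sub_cancel' h1]
      exact h3
  refine ⟨rho', es', ⟨⟨(hr1 0 (Nat.zero_le _)).trans h0, hstep'⟩, fun k b hb => ?_,
    fun k p hp => ?_⟩, ?_⟩
  · rcases le_or_gt Z.i k with hk | hk
    · obtain ⟨n, rfl⟩ := Nat.exists_eq_add_of_le hk
      exact hbalI n b hb
    · by_cases h : ∃ t, k ≤ t ∧ t < Z.i ∧ Touches (es' t) (rho' t) (rho' (t + 1)) b
      · obtain ⟨t, h1, -, h3⟩ := h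
        exact ⟨t, h1, h3⟩
      · push Not at h
        have := mem_bag_of_not_touches hk.le (fun t _ _ => (hstep' t).2) hb h
        obtain ⟨t, h1, h2⟩ := hbalI 0 b this
        exact ⟨t, by omega, h2⟩
  · by_cases hpG : p ∈ Z.G
    · exact hGI p hpG k
    · rcases le_or_gt Z.i k with hk | hk
      · obtain ⟨n, rfl⟩ := Nat.exists_eq_add_of_le hk
        rw [hr2] at hp
        exact (hp ((hfr n).2.1 p hpG)).elim
      · rw [hr1 k hk.le] at hp
        obtain ⟨t, h1, d, h2, h3⟩ := hpl k p hp
        have ht : t < Z.i := by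
          by_contra! ht
          exact hpG (hG' t ht d h2 p h3)
        exact ⟨t, h1, d, by rw [he1 t ht, h2], h3⟩
  · refine ⟨∑ y ∈ Finset.range j, ((R.init y).sum (fun _ x => x) +
      (R.init y + Z.extra y).sum fun _ x => x), fun k r L w he hb => ?_⟩
    rcases lt_or_ge k Z.i with hk | hk
    · rw [he1 k hk] at he
      rw [hr1 k hk.le, hr1 (k + 1) hk] at hb
      have hst := R.step k
      rw [he] at hst
      obtain ⟨-, u, -, h2, h3⟩ := hst
      have h4 : (rho (k + 1)).bag = (rho k).bag + {(r, u)} := by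
        rw [R.bag, R.bag, h2, h3, map_update_of_mem (Finset.mem_insert_self _ _),
          Finset.erase_insert (R.notMem_A k)]
      have h5 : R.init k = u := by rw [LRun.init, h3, Function.update_self]
      have h6 := Multiset.singleton_inj.1 (add_left_cancel (hb.symm.trans h4))
      injection h6 with _ h6
      rw [h6, ← h5]
      exact (Nat.le_add_right _ _).trans (Finset.single_le_sum
        (f := fun y => (R.init y).sum (fun _ x => x) + (R.init y + Z.extra y).sum fun _ x => x)
        (fun _ _ => Nat.zero_le _) (Finset.mem_range.2 (by omega : k < j)))
    · obtain ⟨n, rfl⟩ := Nat.exists_eq_add_of_le hk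
      rw [he2] at he
      rw [add_assoc, hr2, hr2, (hfr n).2.2 r L he] at hb
      have h6 := Multiset.singleton_inj.1 (add_left_cancel hb)
      injection h6 with _ h6
      rw [← h6]
      have h7 := Nat.mod_lt n hl
      exact (Nat.le_add_left _ _).trans (Finset.single_le_sum
        (f := fun y => (R.init y).sum (fun _ x => x) + (R.init y + Z.extra y).sum fun _ x => x)
        (fun _ _ => Nat.zero_le _)
        (Finset.mem_range.2 (by omega : Z.i + n % (j - Z.i) < j)))

end Surgery

/-- From some time on, only those of finitely many properties hold that hold infinitely often. -/
theorem exists_forall_recurrent {α : Type*} (T : Finset α) (P : ℕ → α → Prop) :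
    ∃ N, ∀ t ≥ N, ∀ a ∈ T, P t a → ∀ n, ∃ t' ≥ n, P t' a := by
  have : ∀ a, ∃ n, ∀ t ≥ n, P t a → ∀ n, ∃ t' ≥ n, P t' a := by
    intro a
    by_cases h : ∀ n, ∃ t' ≥ n, P t' a
    · exact ⟨0, fun _ _ _ => h⟩
    · push Not at h
      obtain ⟨n, hn⟩ := h
      exact ⟨n, fun t ht hP => (hn t ht hP).elim⟩
  choose n hn using this
  exact ⟨T.sup n, fun t ht a ha => hn a t ((Finset.le_sup ha).trans ht)⟩

/-- An injection that respects classes exists if no class shrinks. -/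
theorem exists_injOn_of_card_fiber_le {α β : Type*} [DecidableEq β] {A B : Finset α}
    {f g : α → β} (h : ∀ b, (A.filter (f · = b)).card ≤ (B.filter (g · = b)).card) :
    ∃ phi : α → α, Set.InjOn phi A ∧ ∀ x ∈ A, phi x ∈ B ∧ g (phi x) = f x := by
  classical
  have h1 : ∀ b, ∃ psi : α → α, Set.InjOn psi (A.filter (f · = b)) ∧
      ∀ x ∈ A.filter (f · = b), psi x ∈ B.filter (g · = b) := by
    intro b
    obtain ⟨e⟩ : Nonempty (↥(A.filter (f · = b)) ↪ ↥(B.filter (g · = b))) :=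
      Function.Embedding.nonempty_of_card_le (by simpa only [Fintype.card_coe] using h b)
    refine ⟨fun x => if hx : x ∈ A.filter (f · = b) then (e ⟨x, hx⟩).1 else x,
      fun x hx y hy hxy => ?_, fun x hx => ?_⟩
    · rw [Finset.mem_coe] at hx hy
      simp only [hx, hy, dif_pos] at hxy
      exact congrArg Subtype.val (e.injective (Subtype.ext hxy))
    · simp only [hx, dif_pos]
      exact (e ⟨x, hx⟩).2
  choose psi h2 h3 using h1
  have h4 : ∀ x ∈ A, psi (f x) x ∈ B ∧ g (psi (f x) x) = f x := fun x hx =>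
    Finset.mem_filter.1 (h3 (f x) x (Finset.mem_filter.2 ⟨hx, rfl⟩))
  refine ⟨fun x => psi (f x) x, fun x hx y hy hxy => ?_, h4⟩
  have hxy' : psi (f x) x = psi (f y) y := hxy
  have h5 : f x = f y := by rw [← (h4 x hx).2, ← (h4 y hy).2, hxy']
  rw [← h5] at hxy'
  exact h2 (f x) (Finset.mem_coe.2 (Finset.mem_filter.2 ⟨hx, rfl⟩))
    (Finset.mem_coe.2 (Finset.mem_filter.2 ⟨hy, h5.symm⟩)) hxy'

open scoped Classical in
/-- The linear sets that occur in inflate operations. -/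
def VASSB.linearSets (V : VASSB) : Finset (Vec × List Vec) :=
  V.edges.biUnion fun e => match e.2.1 with
    | .inflate _ L => L.toFinset
    | _ => ∅

theorem VASSB.mem_linearSets {V : VASSB} {e : VEdge} (he : e ∈ V.edges) {s : ℕ}
    {L : SemilinRep} (h : e.2.1 = .inflate s L) {l : Vec × List Vec} (hl : l ∈ L) :
    l ∈ V.linearSets := by
  classical
  refine Finset.mem_biUnion.2 ⟨e, he, ?_⟩
  rw [h]
  exact List.mem_toFinset.2 hl

/-- The balloon states that are the result of an operation. -/
def VASSB.balloonStates (V : VASSB) : Finset ℕ :=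
  V.edges.image fun e => match e.2.1 with
    | .inflate s _ => s
    | .deflate _ s _ _ => s
    | _ => 0

/-- The places that are decremented by some edge. -/
def VASSB.decPlaces (V : VASSB) : Finset ℕ :=
  V.edges.biUnion fun e => match e.2.1 with
    | .delta d => d.support
    | _ => ∅

theorem VASSB.mem_decPlaces {V : VASSB} {e : VEdge} (he : e ∈ V.edges) {d : ZVec}
    (h : e.2.1 = .delta d) {p : ℕ} (hp : d p < 0) : p ∈ V.decPlaces := by
  refine Finset.mem_biUnion.2 ⟨e, he, ?_⟩
  rw [h]
  exact Finsupp.mem_support_iff.2 hp.ne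

namespace LRun

variable {rho : ℕ → VConfig} {es : ℕ → VEdge} {R : LRun rho es} {V : VASSB}

theorem val_mem_balloonStates (hE : ∀ t, es t ∈ V.edges) {t x : ℕ} (hx : x ∈ R.A t) :
    (R.val t x).1 ∈ V.balloonStates := by
  induction t with
  | zero => exact absurd (R.A_lt 0 x hx) (Nat.not_lt_zero x)
  | succ t ih =>
    have hst := R.step t
    have hm : (match (es t).2.1 with
      | .inflate s _ => s
      | .deflate _ s _ _ => s
      | _ => 0) ∈ V.balloonStates := Finset.mem_image_of_mem _ (hE t)
    cases he : (es t).2.1 with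
    | delta d =>
      rw [he] at hst
      obtain ⟨-, h1, h2⟩ := hst
      rw [h2]
      exact ih (h1 ▸ hx)
    | burst s =>
      rw [he] at hst
      obtain ⟨-, -, -, h1, h2⟩ := hst
      rw [h2]
      exact ih (Finset.mem_of_mem_erase (h1 ▸ hx))
    | inflate s L =>
      rw [he] at hst hm
      obtain ⟨-, k, -, h1, h2⟩ := hst
      rw [h2]
      by_cases hxt : x = t
      · subst hxt
        simpa using hm
      · rw [Function.update_of_ne hxt]
        exact ih ((Finset.mem_insert.1 (h1 ▸ hx)).resolve_left hxt)
    | deflate s s' pl p =>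
      rw [he] at hst hm
      obtain ⟨-, -, -, h1, h2⟩ := hst
      rw [h2]
      by_cases hxt : x = R.tgt t
      · rw [hxt, Function.update_self]
        exact hm
      · rw [Function.update_of_ne hxt]
        exact ih (h1 ▸ hx)

theorem exists_base_per (R : LRun rho es) (x : ℕ) : ∃ bp : (Vec × List Vec) × Vec,
    ∀ s L, (es x).2.1 = .inflate s L →
      bp.1 ∈ L ∧ IsPer bp.1.2 bp.2 ∧ R.init x = bp.1.1 + bp.2 := by
  by_cases h : ∃ s L, (es x).2.1 = .inflate s L
  · obtain ⟨s, L, he⟩ := h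
    have hst := R.step x
    rw [he] at hst
    obtain ⟨-, k, ⟨bp, h1, cs, h2, h3⟩, -, h4⟩ := hst
    refine ⟨(bp, (List.zipWith (fun (c : ℕ) (v : Vec) => c • v) cs bp.2).sum), fun s' L' he' => ?_⟩
    rw [he] at he'
    injection he' with e1 e2
    subst e2
    exact ⟨h1, ⟨cs, h2, rfl⟩, by rw [init, h4, Function.update_self, h3]⟩
  · exact ⟨((0, []), 0), fun s L he => (h ⟨s, L, he⟩).elim⟩

end LRun

open scoped Classical in
theorem exists_shallow_of_progressive {V : VASSB} {s : VConfig} {rho : ℕ → VConfig}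
    {es : ℕ → VEdge} (hs : IsSemi s) (hrun : ProgressiveV V s rho es) :
    ∃ (rho' : ℕ → VConfig) (es' : ℕ → VEdge),
      ProgressiveV V s rho' es' ∧ ShallowVRun rho' es' := by
  obtain ⟨R⟩ := exists_lrun hrun hs
  have hE : ∀ t, es t ∈ V.edges := fun t => (hrun.1.2 t).1
  choose bpr hbpr using R.exists_base_per
  let bp : ℕ → Vec × List Vec := fun x => (bpr x).1
  let per : ℕ → Vec := fun x => (bpr x).2
  have hbpV : ∀ x s L, (es x).2.1 = .inflate s L → bp x ∈ V.linearSets := fun x s L he =>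
    VASSB.mem_linearSets (hE x) he (hbpr x s L he).1
  have hpairs : ∀ x, R.pairs V x ∈ V.transfers.powerset := fun x =>
    Finset.mem_powerset.2 (Finset.filter_subset _ _)
  have hdone : ∀ t x, R.done V t x ∈ V.transfers.powerset := fun t x =>
    Finset.mem_powerset.2 (Finset.filter_subset _ _)
  -- the places that are decremented infinitely often
  let Dec : ℕ → ℕ → Prop := fun t p => ∃ d : ZVec, (es t).2.1 = .delta d ∧ d p < 0
  let G : Finset ℕ := V.decPlaces.filter fun p => ∀ n, ∃ t ≥ n, Dec t p
  obtain ⟨N0, hN0⟩ := exists_forall_recurrent V.decPlaces Dec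
  have hdec : ∀ t ≥ N0, ∀ p, Dec t p → p ∈ G := by
    intro t ht p h
    have hp : p ∈ V.decPlaces := by
      obtain ⟨d, h1, h2⟩ := h
      exact VASSB.mem_decPlaces (hE t) h1 h2
    exact Finset.mem_filter.2 ⟨hp, hN0 t ht p hp h⟩
  have hplaces : ∀ t ≥ N0, ∀ p ∉ G, (rho t).m p = 0 := by
    intro t ht p hp
    by_contra h
    obtain ⟨k, hk, h⟩ := hrun.2.2 t p h
    exact hp (hdec k (ht.trans hk) p h)
  -- the types of balloons that are inflated infinitely often
  let Inf : ℕ → (Vec × List Vec) × Finset (ℕ × ℕ) → Prop := fun x τ =>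
    (∃ s L, (es x).2.1 = .inflate s L) ∧ (bp x, R.pairs V x) = τ
  obtain ⟨N', hN'⟩ := exists_forall_recurrent (V.linearSets ×ˢ V.transfers.powerset) Inf
  obtain ⟨N, hNN0, hNN'⟩ : ∃ N, N0 ≤ N ∧ N' ≤ N := ⟨max N0 N', le_max_left _ _, le_max_right _ _⟩
  choose T hT using R.exists_done_eq hE
  obtain ⟨N1, hN1N, hN1T⟩ : ∃ N1, N ≤ N1 ∧ ∀ x < N, T x ≤ N1 :=
    ⟨max N ((Finset.range N).sup T), le_max_left _ _, fun x hx =>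
      (Finset.le_sup (Finset.mem_range.2 hx)).trans (le_max_right _ _)⟩
  -- two similar configurations
  let cls : ℕ → ℕ → (Vec × List Vec) × Finset (ℕ × ℕ) × Finset (ℕ × ℕ) × ℕ := fun t x =>
    (bp x, R.pairs V x, R.done V t x, (R.val t x).1)
  let K := V.linearSets ×ˢ V.transfers.powerset ×ˢ V.transfers.powerset ×ˢ V.balloonStates
  have hcls : ∀ t, ∀ x ∈ R.A t, cls t x ∈ K := by
    intro t x hx
    obtain ⟨s, L, he⟩ := R.exists_inflate_of_mem hx
    simp only [K, cls, Finset.mem_product]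
    exact ⟨hbpV x s L he, hpairs x, hdone t x, LRun.val_mem_balloonStates hE hx⟩
  let cnt : ℕ → (Vec × List Vec) × Finset (ℕ × ℕ) × Finset (ℕ × ℕ) × ℕ → ℕ := fun t κ =>
    ((R.A t).filter (cls t · = κ)).card
  let F : ℕ → (K → ℕ × ℕ) × (G → ℕ) × (V.edges.image Prod.fst → ℕ) := fun n =>
    (fun κ => (cnt (N1 + n) κ, if cnt (N1 + n) κ = 0 then 1 else 0),
      fun p => (rho (N1 + n)).m p, fun q => if (rho (N1 + n)).q = q then 1 else 0)
  obtain ⟨h, hF⟩ := (wellQuasiOrdered_le (α := (K → ℕ × ℕ) × (G → ℕ) ×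
    (V.edges.image Prod.fst → ℕ))).exists_monotone_subseq F
  obtain ⟨i, hi⟩ : ∃ i, i = N1 + h 0 := ⟨_, rfl⟩
  have hNi : N ≤ i := by omega
  have hplaces' : ∀ t ≥ N, ∀ p ∉ G, (rho t).m p = 0 := fun t ht =>
    hplaces t (hNN0.trans ht)
  let S : Finset ℕ := (R.A i).filter (N ≤ ·)
  have hY : ∀ x ∈ S, ∃ y ≥ i, bp y = bp x ∧ R.pairs V y = R.pairs V x := by
    intro x hx
    obtain ⟨hxA, hxN⟩ := Finset.mem_filter.1 hx
    obtain ⟨s, L, he⟩ := R.exists_inflate_of_mem hxA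
    obtain ⟨y, hy, -, h1⟩ := hN' x (hNN'.trans hxN) (bp x, R.pairs V x)
      (Finset.mem_product.2 ⟨hbpV x s L he, hpairs x⟩) ⟨⟨s, L, he⟩, rfl⟩ i
    exact ⟨y, hy, (Prod.ext_iff.1 h1).1, (Prod.ext_iff.1 h1).2⟩
  choose! Y hY1 hY2 hY3 using hY
  have hfresh : ∀ x ≥ N, ∀ a ∈ R.pairs V x, a.2 ∉ G → R.init x a.1 = 0 := by
    intro x hx a ha hG
    refine LRun.init_eq_zero_of_empty hE (fun t ht => hplaces' t ht _ hG) ha ?_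
    simp [LRun.done_of_le hE (hx.trans (Nat.le_succ x))]
  have hper : ∀ x ∈ R.A i, IsPer (bp x).2 (per x) ∧ R.init x = (bp x).1 + per x := by
    intro x hx
    obtain ⟨s, L, he⟩ := R.exists_inflate_of_mem hx
    exact (hbpr x s L he).2
  let Z : Surgery V R :=
    { i := i, G := G, S := S, Y := Y, per := per, bp := bp
      mem_edges := hE
      source := fun t => (hrun.1.2 t).2.1
      target := fun t => (hrun.1.2 t).2.2.1
      places := fun t ht => hplaces' t (hNi.trans ht)
      le_Y := hY1
      bp_Y := hY2
      pairs_Y := hY3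
      per_eq_zero := fun x hx a ha hG => by
        obtain ⟨hxA, hxN⟩ := Finset.mem_filter.1 hx
        have h1 := hfresh x hxN a ha hG
        rw [(hper x hxA).2, Finsupp.add_apply] at h1
        omega
      init_eq_zero := fun t ht => hfresh t (hNi.trans ht)
      inflate := fun x s L he => hbpr x s L he
      isPer := fun x hx => (hper x (Finset.mem_filter.1 hx).1).1 }
  -- the length of the repeated segment
  choose! tt htt1 htt2 using R.fair i
  have hGi : ∀ p ∈ G, ∃ t ≥ i, Dec t p := fun p hp => (Finset.mem_filter.1 hp).2 i
  choose! tg htg1 htg2 using hGi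
  obtain ⟨M, hM1, hM2, hM3, hM4, hM5⟩ : ∃ M, i < M ∧ (∀ x ∈ R.A i, tt x < M) ∧
      (∀ p ∈ G, tg p < M) ∧ (∀ x ∈ S, T x ≤ M) ∧ ∀ x ∈ S, T (Y x) ≤ M := by
    refine ⟨i + (R.A i).sup tt + G.sup tg + S.sup T + S.sup (fun x => T (Y x)) + 1, by omega,
      fun x hx => ?_, fun x hx => ?_, fun x hx => ?_, fun x hx => ?_⟩
    · have := Finset.le_sup (f := tt) hx
      omega
    · have := Finset.le_sup (f := tg) hx
      omega
    · have := Finset.le_sup (f := T) hx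
      omega
    · have := Finset.le_sup (f := fun x => T (Y x)) hx
      omega
  obtain ⟨j, hj⟩ : ∃ j, j = N1 + h M := ⟨_, rfl⟩
  have hMj : M ≤ j := by
    have : M ≤ h M := h.strictMono.id_le M
    omega
  have hFij := hF 0 M (Nat.zero_le M)
  simp only [F, ← hi, ← hj] at hFij
  obtain ⟨hF1, hF2, hF3⟩ := hFij
  have hcnt : ∀ κ, cnt i κ ≤ cnt j κ := by
    intro κ
    by_cases hκ : κ ∈ K
    · exact (hF1 ⟨κ, hκ⟩).1
    · have : cnt i κ = 0 := by
        refine Finset.card_eq_zero.2 (Finset.filter_eq_empty_iff.2 fun x hx hxκ => hκ ?_)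
        rw [← hxκ]
        exact hcls i x hx
      omega
  have hsame : ∀ x y, cls j y = cls i x → Z.Same j y x := by
    intro x y hxy
    simp only [cls, Prod.mk.injEq] at hxy
    exact ⟨hxy.1, hxy.2.1, hxy.2.2.1, hxy.2.2.2⟩
  obtain ⟨phi, hphi1, hphi2⟩ := exists_injOn_of_card_fiber_le (A := R.A i) (B := R.A j)
    (f := cls i) (g := cls j) hcnt
  refine Surgery.exists_shallow hrun (Z := Z) (j := j) (phi := phi)
    { lt := by
        change i < j
        omega
      injOn := hphi1
      mapsTo := fun x hx => (hphi2 x hx).1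
      same := fun x hx => hsame _ _ (hphi2 x hx).2
      exists_same := fun y hy => ?_
      m_le := fun p => ?_
      state := ?_
      subset := Finset.filter_subset _ _
      done_of_notMem := fun x hx hxS => ?_
      done_eq := fun x hx => hT x j ((hM4 x hx).trans hMj)
      done_Y := fun x hx => hT _ j ((hM5 x hx).trans hMj)
      touched := fun x hx => ⟨tt x, htt1 x hx, (hM2 x hx).trans_le hMj, htt2 x hx⟩ } ?_ ?_
  · have h1 := (hF1 ⟨cls j y, hcls j y hy⟩).2
    have h2 : cnt j (cls j y) ≠ 0 :=
      Finset.card_ne_zero.2 ⟨y, Finset.mem_filter.2 ⟨hy, rfl⟩⟩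
    have h3 : cnt i (cls j y) ≠ 0 := by
      intro h3
      simp [h2, h3] at h1
    obtain ⟨x, hx⟩ := Finset.card_ne_zero.1 h3
    obtain ⟨hx, hxy⟩ := Finset.mem_filter.1 hx
    exact ⟨x, hx, hsame _ _ hxy.symm⟩
  · by_cases hp : p ∈ G
    · exact hF2 ⟨p, hp⟩
    · exact (hplaces' i hNi p hp).trans_le (Nat.zero_le _)
  · change (rho i).q = (rho j).q
    have hq : (rho i).q ∈ V.edges.image Prod.fst := by
      rw [(hrun.1.2 i).2.1]
      exact Finset.mem_image_of_mem _ (hE i)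
    have h1 := hF3 ⟨_, hq⟩
    by_contra h2
    simp [Ne.symm h2] at h1
  · refine hT x i ((hN1T x ?_).trans (by omega))
    by_contra! hxN
    exact hxS (Finset.mem_filter.2 ⟨hx, hxN⟩)
  · exact fun p hp => ⟨tg p, htg1 p hp, (hM3 p hp).trans_le hMj, htg2 p hp⟩
  · exact fun t ht d hd p hp => hdec t (hNN0.trans (hNi.trans ht)) p ⟨d, hd, hp⟩

/-- A VASSB has an infinite progressive run from a given
semiconfiguration iff it has a shallow infinite progressive run from that
semiconfiguration. -/
theorem vassb_progressive_iff_shallow (V : VASSB) (s : VConfig) (hs : IsSemi s) :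
    HasProgRunV V s ↔
      ∃ (rho : ℕ → VConfig) (es : ℕ → VEdge),
        ProgressiveV V s rho es ∧ ShallowVRun rho es := by
  constructor
  · rintro ⟨rho, es, hrun⟩
    exact exists_shallow_of_progressive hs hrun
  · rintro ⟨rho, es, hrun, -⟩
    exact ⟨rho, es, hrun⟩

end CBL
end
end
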